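/- Let Γ ⊂ ℂ be a bounded quasicircle with interior Ω and exterior Ω*, let f : 𝔻 → Ω be a conformal bijection, and let g : Δ → Ω* be a conformal bijection with g(z) → ∞ as z → ∞. Then ∬_𝔻 |f''(z)/f'(z)|² dA(z) < ∞ if and only if ∬_Δ |g''(z)/g'(z)|² dA(z) < ∞; that is, Γ is a Weil–Petersson quasicircle exactly when log g' belongs to the Dirichlet space of Δ (Shen–Liu). -/

import Mathlib

/-!
STATEMENT 5 (Shen–Liu): for a bounded quasicircle `Γ` with interior Riemann map `f : 𝔻 → Ω`
and exterior Riemann map `g : Δ → Ω*` fixing `∞`,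
`∬_𝔻 |f''/f'|² dA < ∞  ↔  ∬_Δ |g''/g'|² dA < ∞`; i.e. `Γ` is a Weil–Petersson quasicircle
exactly when `log g'` belongs to the Dirichlet space of `Δ`.
-/

open MeasureTheory Metric Real

namespace WeilPetersson

section Injective
open Set Filter Topology

theorem nhds_le_map_of_injOn {f : ℂ → ℂ} {U : Set ℂ} (hU : IsOpen U)
    (hf : DifferentiableOn ℂ f U) (hi : InjOn f U) {z : ℂ} (hz : z ∈ U) :
    𝓝 (f z) ≤ map f (𝓝 z) := by
  have han : AnalyticAt ℂ f z := hf.analyticAt (hU.mem_nhds hz)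
  rcases han.eventually_constant_or_nhds_le_map_nhds with h | h
  · exfalso
    have h1 : ∀ᶠ w in 𝓝[≠] z, w ∈ U ∧ f w = f z :=
      (((hU.eventually_mem hz).and h).filter_mono nhdsWithin_le_nhds)
    obtain ⟨w, hw, hne⟩ := (h1.and self_mem_nhdsWithin).exists
    exact hne (hi hw.1 hz hw.2)
  · exact h

theorem isOpen_image_of_injOn {f : ℂ → ℂ} {U : Set ℂ} (hU : IsOpen U)
    (hf : DifferentiableOn ℂ f U) (hi : InjOn f U) : IsOpen (f '' U) := by
  rw [isOpen_iff_mem_nhds]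
  rintro _ ⟨z, hz, rfl⟩
  exact nhds_le_map_of_injOn hU hf hi hz (image_mem_map (hU.mem_nhds hz))

theorem continuousAt_leftInverse {f g : ℂ → ℂ} {U : Set ℂ} (hU : IsOpen U)
    (hf : DifferentiableOn ℂ f U) (hg : ∀ z ∈ U, g (f z) = z) {z : ℂ} (hz : z ∈ U) :
    ContinuousAt g (f z) := by
  have hi : InjOn f U := fun a ha b hb h => by rw [← hg a ha, h, hg b hb]
  rw [ContinuousAt, hg z hz]
  refine (tendsto_map'_iff (x := 𝓝 z) (f := g) (g := f)).2 ?_ |>.mono_left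
    (nhds_le_map_of_injOn hU hf hi hz)
  refine tendsto_id.congr' ?_
  filter_upwards [hU.mem_nhds hz] with w hw
  exact (hg w hw).symm

theorem deriv_ne_zero_of_injOn {f : ℂ → ℂ} {U : Set ℂ} (hU : IsOpen U)
    (hf : DifferentiableOn ℂ f U) (hi : InjOn f U) {z : ℂ} (hz : z ∈ U) :
    deriv f z ≠ 0 := by
  classical
  have hg : ∀ w ∈ U, Function.invFunOn f U (f w) = w := fun w hw => hi.leftInvOn_invFunOn hw
  set g := Function.invFunOn f U
  have hfd : ∀ w ∈ U, HasDerivAt f (deriv f w) w := fun w hw =>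
    (hf.differentiableAt (hU.mem_nhds hw)).hasDerivAt
  have han : AnalyticAt ℂ (deriv f) z := (hf.analyticAt (hU.mem_nhds hz)).deriv
  have hc := fun w (hw : w ∈ U) => continuousAt_leftInverse hU hf hg hw
  have key : ∀ w ∈ U, deriv f w ≠ 0 → DifferentiableAt ℂ g (f w) := by
    intro w hw hne
    have := (hfd w hw)
    rw [← hg w hw] at this hne
    refine (HasDerivAt.of_local_left_inverse (hc w hw) this hne ?_).differentiableAt
    have : f '' U ∈ 𝓝 (f w) := (isOpen_image_of_injOn hU hf hi).mem_nhds ⟨w, hw, rfl⟩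
    filter_upwards [this]
    rintro _ ⟨v, hv, rfl⟩
    rw [hg v hv]
  have hnz : ∀ᶠ w in 𝓝[≠] z, deriv f w ≠ 0 := by
    rcases han.eventually_eq_zero_or_eventually_ne_zero with h | h
    · exfalso
      obtain ⟨r, hr, hb⟩ := Metric.eventually_nhds_iff_ball.1 ((hU.eventually_mem hz).and h)
      have hcst : ∀ w ∈ ball z r, f w = f z := by
        intro w hw
        refine (convex_ball z r).is_const_of_fderivWithin_eq_zero (𝕜 := ℂ) (f := f)
          (fun v hv => ((hfd v (hb v hv).1).differentiableAt).differentiableWithinAt) ?_ hw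
          (mem_ball_self hr)
        intro v hv
        rw [fderivWithin_of_isOpen isOpen_ball hv]
        ext
        simpa using (hb v hv).2
      have : z + (r / 2 : ℝ) ∈ ball z r := by
        simp only [mem_ball, dist_self_add_left, Complex.norm_real, Real.norm_eq_abs]
        rw [abs_of_pos (by positivity)]; linarith
      have h2 := hi (hb _ this).1 hz (hcst _ this)
      have h3 : ((r / 2 : ℝ) : ℂ) = 0 := by simpa using h2
      have : r / 2 = 0 := by exact_mod_cast h3
      linarith
    · exact h
  have hgd : DifferentiableAt ℂ g (f z) := by
    obtain ⟨V, hVo, hzV, hV⟩ : ∃ V, IsOpen V ∧ z ∈ V ∧ ∀ w ∈ V, w ∈ U ∧ (w ≠ z → deriv f w ≠ 0) := by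
      have : ∀ᶠ w in 𝓝 z, w ∈ U ∧ (w ≠ z → deriv f w ≠ 0) :=
        (hU.eventually_mem hz).and (eventually_nhdsWithin_iff.1 hnz)
      obtain ⟨V, h1, h2, h3⟩ := _root_.eventually_nhds_iff.1 this
      exact ⟨V, h2, h3, h1⟩
    have hVU : V ⊆ U := fun w hw => (hV w hw).1
    have hO : f '' V ∈ 𝓝 (f z) :=
      (isOpen_image_of_injOn hVo (hf.mono hVU) (hi.mono hVU)).mem_nhds ⟨z, hzV, rfl⟩
    have := (Complex.differentiableOn_compl_singleton_and_continuousAt_iff (f := g) hO).1 ⟨?_, hc z hz⟩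
    · exact this.differentiableAt hO
    · rintro _ ⟨⟨w, hw, rfl⟩, hne⟩
      refine (key w (hV w hw).1 ((hV w hw).2 ?_)).differentiableWithinAt
      rintro rfl
      exact hne rfl
  intro h0
  have h1 := hgd.hasDerivAt.comp z (hfd z hz)
  have h2 : HasDerivAt (g ∘ f) 1 z := by
    refine (hasDerivAt_id z).congr_of_eventuallyEq ?_
    filter_upwards [hU.mem_nhds hz] with w hw
    exact hg w hw
  have := h1.unique h2
  rw [h0] at this
  simp at this

theorem hasDerivAt_leftInverse {f g : ℂ → ℂ} {U : Set ℂ} (hU : IsOpen U)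
    (hf : DifferentiableOn ℂ f U) (hg : ∀ z ∈ U, g (f z) = z) {z : ℂ} (hz : z ∈ U) :
    HasDerivAt g (deriv f z)⁻¹ (f z) := by
  have hi : InjOn f U := fun a ha b hb h => by rw [← hg a ha, h, hg b hb]
  have hd : HasDerivAt f (deriv f z) (g (f z)) := by
    rw [hg z hz]
    exact (hf.differentiableAt (hU.mem_nhds hz)).hasDerivAt
  refine HasDerivAt.of_local_left_inverse (continuousAt_leftInverse hU hf hg hz) hd
    (deriv_ne_zero_of_injOn hU hf hi hz) ?_
  filter_upwards [(isOpen_image_of_injOn hU hf hi).mem_nhds ⟨z, hz, rfl⟩]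
  rintro _ ⟨v, hv, rfl⟩
  rw [hg v hv]

end Injective

section MeanValue
open Set Filter Topology
open scoped ENNReal

theorem lintegral_polar {f : ℂ → ℝ≥0∞} (hf : Measurable f) {I : Set ℝ} (hI : MeasurableSet I) :
    ∫⁻ z in {z : ℂ | ‖z‖ ∈ I}, f z =
      ∫⁻ r in I ∩ Ioi 0, ∫⁻ θ in Ioo (-π) π, ENNReal.ofReal r * f (circleMap 0 r θ) := by
  have hS : MeasurableSet {z : ℂ | ‖z‖ ∈ I} := measurable_norm hI
  rw [← lintegral_indicator hS, ← Complex.lintegral_comp_polarCoord_symm]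
  have : polarCoord.target = Ioi (0 : ℝ) ×ˢ Ioo (-π) π := rfl
  rw [this, Measure.volume_eq_prod, setLIntegral_prod]
  · rw [← setLIntegral_indicator hI]
    refine setLIntegral_congr_fun measurableSet_Ioi fun r hr => ?_
    have hr' : (0 : ℝ) < r := hr
    have hn : ∀ θ, Complex.polarCoord.symm (r, θ) = circleMap 0 r θ := by
      intro θ
      rw [Complex.polarCoord_symm_apply, circleMap, zero_add, Complex.exp_mul_I]
      simp
    by_cases h : r ∈ I
    · rw [indicator_of_mem h]
      refine lintegral_congr fun θ => ?_
      rw [hn, indicator_of_mem, smul_eq_mul]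
      simpa [abs_of_pos hr'] using h
    · rw [indicator_of_notMem h]
      refine (lintegral_congr fun θ => ?_).trans lintegral_zero
      rw [hn, indicator_of_notMem, smul_eq_mul, mul_zero]
      simpa [abs_of_pos hr'] using h
  · refine Measurable.aemeasurable ?_
    refine (ENNReal.measurable_ofReal.comp measurable_fst).mul ?_
    refine (hf.indicator hS).comp ?_
    have : (fun p : ℝ × ℝ => Complex.polarCoord.symm p) = fun p => p.1 * (Real.cos p.2 + Real.sin p.2 * Complex.I) := by
      ext p; exact Complex.polarCoord_symm_apply p
    show Measurable (fun p : ℝ × ℝ => Complex.polarCoord.symm p)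
    rw [this]
    fun_prop

theorem norm_sq_le_integral_circle {h : ℂ → ℂ} {z : ℂ} {r ρ : ℝ} (hd : DifferentiableOn ℂ h (ball z r))
    (h0 : 0 < ρ) (hρ : ρ < r) :
    ENNReal.ofReal (2 * π * ‖h z‖ ^ 2) ≤
      ∫⁻ θ in Ioo (-π) π, ENNReal.ofReal (‖h (z + circleMap 0 ρ θ)‖ ^ 2) := by
  have hsub : closedBall z |ρ| ⊆ ball z r := by
    rw [abs_of_pos h0]; exact closedBall_subset_ball hρ
  have hmv : circleAverage (fun w => h w ^ 2) z ρ = h z ^ 2 := by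
    refine DiffContOnCl.circleAverage ?_
    refine DifferentiableOn.diffContOnCl ?_
    rw [closure_ball _ (abs_pos.2 h0.ne').ne']
    exact (hd.mono hsub).pow 2
  have hcm : ∀ θ, circleMap z ρ θ = z + circleMap 0 ρ θ := fun θ => by simp [circleMap]
  have hcont : Continuous fun θ => h (circleMap z ρ θ) := by
    refine hd.continuousOn.comp_continuous (continuous_circleMap z ρ) fun θ => hsub ?_
    rw [abs_of_pos h0]
    exact circleMap_mem_closedBall z h0.le θ
  rw [circleAverage] at hmv
  have hle : 2 * π * ‖h z‖ ^ 2 ≤ ∫ θ in (0)..(2 * π), ‖h (circleMap z ρ θ)‖ ^ 2 := by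
    have h1 : ‖∫ θ in (0)..(2 * π), h (circleMap z ρ θ) ^ 2‖ ≤
        ∫ θ in (0)..(2 * π), ‖h (circleMap z ρ θ)‖ ^ 2 := by
      refine (intervalIntegral.norm_integral_le_integral_norm (by positivity)).trans (le_of_eq ?_)
      simp only [norm_pow]
    rw [← norm_pow, ← hmv, norm_smul, norm_inv, Real.norm_eq_abs, abs_of_pos (by positivity)]
    rw [mul_inv_cancel_left₀ (by positivity)]
    exact h1
  have hper : Function.Periodic (fun θ => ‖h (circleMap z ρ θ)‖ ^ 2) (2 * π) := fun θ => by
    simp only [periodic_circleMap z ρ θ]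
  have hsh := hper.intervalIntegral_add_eq (-π) 0
  rw [zero_add, show -π + 2 * π = π by ring] at hsh
  rw [← hsh, intervalIntegral.integral_of_le (by linarith [pi_pos]), integral_Ioc_eq_integral_Ioo] at hle
  refine (ENNReal.ofReal_le_ofReal hle).trans ?_
  rw [ofReal_integral_eq_lintegral_ofReal]
  · simp only [hcm]; exact le_rfl
  · refine Continuous.integrableOn_Icc ?_ |>.mono_set Ioo_subset_Icc_self
    exact (hcont.norm).pow 2
  · exact Eventually.of_forall fun θ => by positivity

theorem norm_sq_le_lintegral_ball {h : ℂ → ℂ} {z : ℂ} {r : ℝ} (hd : DifferentiableOn ℂ h (ball z r))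
    (hr : 0 < r) :
    ENNReal.ofReal (π * r ^ 2 * ‖h z‖ ^ 2) ≤ ∫⁻ w in ball z r, ENNReal.ofReal (‖h w‖ ^ 2) := by
  classical
  set H : ℂ → ℝ≥0∞ := fun w => (ball (0:ℂ) r).indicator (fun w => ENNReal.ofReal (‖h (z + w)‖ ^ 2)) w
  have hco : ContinuousOn (fun w => h (z + w)) (ball (0:ℂ) r) := by
    refine hd.continuousOn.comp (by fun_prop) fun w hw => ?_
    simpa using hw
  have hH : Measurable H := by
    have hHe : H = (ball (0:ℂ) r).piecewise (fun w => ENNReal.ofReal (‖h (z + w)‖ ^ 2)) 0 :=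
      (piecewise_eq_indicator).symm
    rw [hHe]
    refine ContinuousOn.measurable_piecewise ?_ continuousOn_const measurableSet_ball
    exact ENNReal.continuous_ofReal.comp_continuousOn (hco.norm.pow 2)
  have e1 : ∫⁻ w in ball z r, ENNReal.ofReal (‖h w‖ ^ 2) = ∫⁻ w in {w : ℂ | ‖w‖ ∈ Iio r}, H w := by
    rw [← lintegral_indicator measurableSet_ball, ← lintegral_add_left_eq_self _ z]
    have : {w : ℂ | ‖w‖ ∈ Iio r} = ball 0 r := by ext; simp
    rw [this, setLIntegral_indicator measurableSet_ball, inter_self, ← lintegral_indicator measurableSet_ball]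
    refine lintegral_congr fun w => ?_
    simp only [indicator, mem_ball, dist_self_add_left, dist_zero_right]
  rw [e1, lintegral_polar hH measurableSet_Iio]
  have : Iio r ∩ Ioi 0 = Ioo 0 r := by ext x; simp [and_comm]
  rw [this]
  have e2 : ENNReal.ofReal (π * r ^ 2 * ‖h z‖ ^ 2) =
      ∫⁻ ρ in Ioo 0 r, ENNReal.ofReal (ρ * (2 * π * ‖h z‖ ^ 2)) := by
    rw [← ofReal_integral_eq_lintegral_ofReal]
    · congr 1
      rw [← integral_Ioc_eq_integral_Ioo, ← intervalIntegral.integral_of_le hr.le]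
      rw [intervalIntegral.integral_mul_const, integral_id]
      ring
    · refine Continuous.integrableOn_Icc ?_ |>.mono_set Ioo_subset_Icc_self
      fun_prop
    · refine (ae_restrict_iff' measurableSet_Ioo).2 (Eventually.of_forall fun ρ hρ => ?_)
      have := hρ.1
      show 0 ≤ ρ * (2 * π * ‖h z‖ ^ 2)
      positivity
  rw [e2]
  refine setLIntegral_mono' measurableSet_Ioo fun ρ hρ => ?_
  rw [lintegral_const_mul' _ _ ENNReal.ofReal_ne_top, ENNReal.ofReal_mul hρ.1.le]
  gcongr
  refine (norm_sq_le_integral_circle hd hρ.1 hρ.2).trans (le_of_eq ?_)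
  refine lintegral_congr fun θ => ?_
  simp only [H]
  rw [indicator_of_mem]
  simp [abs_of_pos hρ.1, hρ.2]

/-- The open annulus between the circles of radius `a` and `1`. -/
def collar (a : ℝ) : Set ℂ := {z | a < ‖z‖ ∧ ‖z‖ < 1}

theorem isOpen_collar (a : ℝ) : IsOpen (collar a) :=
  (isOpen_lt continuous_const continuous_norm).inter (isOpen_lt continuous_norm continuous_const)

theorem collar_subset {a b : ℝ} (h : a ≤ b) : collar b ⊆ collar a :=
  fun _ hz => ⟨h.trans_lt hz.1, hz.2⟩

theorem exists_collar_lintegral_lt {f : ℂ → ℝ≥0∞} {a : ℝ} (ha : a < 1)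
    (hf : ∫⁻ z in collar a, f z < ⊤) {ε : ℝ≥0∞} (hε : 0 < ε) :
    ∃ b, a ≤ b ∧ b < 1 ∧ ∫⁻ z in collar b, f z < ε := by
  set s : ℕ → Set ℂ := fun k => collar (1 - (1 - a) / (k + 1))
  have hb : ∀ k : ℕ, a ≤ 1 - (1 - a) / ((k:ℝ) + 1) := by
    intro k
    have : (1 - a) / ((k:ℝ) + 1) ≤ 1 - a := div_le_self (by linarith) (by linarith [k.cast_nonneg (α := ℝ)])
    linarith
  set ν := (volume.restrict (collar a)).withDensity f
  have hν : ∀ b, a ≤ b → ν (collar b) = ∫⁻ z in collar b, f z := by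
    intro b h
    rw [withDensity_apply _ (isOpen_collar b).measurableSet, Measure.restrict_restrict (isOpen_collar b).measurableSet,
      inter_eq_left.2 (collar_subset h)]
  have htop : ν (s 0) ≠ ⊤ := by
    have := hν (1 - (1-a)/((0:ℕ)+1)) (hb 0)
    simp only [s]
    rw [this]
    refine (lt_of_le_of_lt (lintegral_mono_set (collar_subset (hb 0))) hf).ne
  have hanti : Antitone s := by
    intro i j hij
    apply collar_subset
    have : (i:ℝ) ≤ j := by exact_mod_cast hij
    have : (1 - a) / ((j:ℝ) + 1) ≤ (1 - a) / ((i:ℝ) + 1) := by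
      apply div_le_div_of_nonneg_left <;> linarith [i.cast_nonneg (α := ℝ)]
    linarith
  have hemp : ⋂ k, s k = ∅ := by
    ext z
    simp only [mem_iInter, mem_empty_iff_false, iff_false, not_forall]
    by_cases hz : ‖z‖ < 1
    · obtain ⟨k, hk⟩ := exists_nat_gt ((1 - a) / (1 - ‖z‖))
      refine ⟨k, fun h => ?_⟩
      have h1 := h.1
      have : (1 - a) / ((k:ℝ) + 1) ≤ 1 - ‖z‖ := by
        rw [div_lt_iff₀ (by linarith)] at hk
        rw [div_le_iff₀ (by positivity)]
        nlinarith
      linarith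
    · exact ⟨0, fun h => hz h.2⟩
  have ht := tendsto_measure_iInter_atTop (μ := ν) (s := s)
    (fun k => (isOpen_collar _).measurableSet.nullMeasurableSet) hanti ⟨0, htop⟩
  rw [hemp, measure_empty] at ht
  obtain ⟨k, hk⟩ := (ht.eventually (gt_mem_nhds hε)).exists
  refine ⟨_, hb k, ?_, by rw [← hν _ (hb k)]; exact hk⟩
  have : 0 < (1 - a) / ((k:ℝ) + 1) := by apply div_pos (by linarith) (by positivity)
  linarith

/-- A holomorphic function on a collar with finite weighted square integral decays at the
unit circle. -/
theorem exists_collar_norm_le {h : ℂ → ℂ} {a : ℝ} (ha : a < 1) (n : ℕ)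
    (hd : DifferentiableOn ℂ h (collar a))
    (hf : ∫⁻ z in collar a, ENNReal.ofReal ((1 - ‖z‖) ^ (2 * n) * ‖h z‖ ^ 2) < ⊤) {ε : ℝ} (hε : 0 < ε) :
    ∃ b, a ≤ b ∧ b < 1 ∧ ∀ z ∈ collar b, (1 - ‖z‖) ^ (n + 1) * ‖h z‖ ≤ ε := by
  obtain ⟨b, hab, hb1, hb⟩ := exists_collar_lintegral_lt ha hf
    (ε := ENNReal.ofReal (π * ε ^ 2 / 2 ^ (2 * n + 2))) (ENNReal.ofReal_pos.2 (by positivity))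
  refine ⟨(1 + b) / 2, by linarith, by linarith, fun z hz => ?_⟩
  set t := 1 - ‖z‖ with ht
  have ht0 : 0 < t := by have := hz.2; linarith
  have ht1 : t < (1 - b) / 2 := by have := hz.1; linarith
  have hw : ∀ w ∈ ball z (t / 2), b < ‖w‖ ∧ ‖w‖ < 1 ∧ t / 2 ≤ 1 - ‖w‖ := by
    intro w hw
    rw [mem_ball, dist_eq_norm] at hw
    have h1 := norm_sub_norm_le w z
    have h2 := norm_sub_norm_le z w
    rw [norm_sub_rev] at h2
    refine ⟨by linarith, by linarith, by linarith⟩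
  have hsub : ball z (t / 2) ⊆ collar b := fun w h => ⟨(hw w h).1, (hw w h).2.1⟩
  have h1 := norm_sq_le_lintegral_ball (hd.mono (hsub.trans (collar_subset hab))) (half_pos ht0)
  have h2 : ENNReal.ofReal ((t / 2) ^ (2 * n)) * ∫⁻ w in ball z (t / 2), ENNReal.ofReal (‖h w‖ ^ 2) ≤
      ∫⁻ z in collar b, ENNReal.ofReal ((1 - ‖z‖) ^ (2 * n) * ‖h z‖ ^ 2) := by
    rw [← lintegral_const_mul' _ _ ENNReal.ofReal_ne_top]
    refine le_trans (setLIntegral_mono' measurableSet_ball fun w h => ?_) (lintegral_mono_set hsub)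
    rw [← ENNReal.ofReal_mul (by positivity)]
    refine ENNReal.ofReal_le_ofReal ?_
    gcongr
    exact (hw w h).2.2
  have h3 : ENNReal.ofReal ((t / 2) ^ (2 * n) * (π * (t / 2) ^ 2 * ‖h z‖ ^ 2)) ≤
      ENNReal.ofReal (π * ε ^ 2 / 2 ^ (2 * n + 2)) := by
    rw [ENNReal.ofReal_mul (by positivity)]
    refine le_trans ?_ hb.le
    refine le_trans ?_ h2
    gcongr
  rw [ENNReal.ofReal_le_ofReal_iff (by positivity), le_div_iff₀ (by positivity)] at h3
  have h4 : (t / 2) ^ (2 * n) * (π * (t / 2) ^ 2 * ‖h z‖ ^ 2) * 2 ^ (2 * n + 2) =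
      π * (t ^ (n + 1) * ‖h z‖) ^ 2 := by
    rw [div_pow, div_pow]
    field_simp
    ring
  rw [h4] at h3
  have h5 := le_of_mul_le_mul_left h3 pi_pos
  exact (pow_le_pow_iff_left₀ (by positivity) hε.le two_ne_zero).1 h5

end MeanValue

section Schwarzian
open Set Filter Topology
open scoped ENNReal

/-- The pre-Schwarzian derivative. -/
noncomputable def preSchwarzian (f : ℂ → ℂ) (z : ℂ) : ℂ := deriv (deriv f) z / deriv f z

/-- The Schwarzian derivative. -/
noncomputable def schwarzian (f : ℂ → ℂ) (z : ℂ) : ℂ :=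
  deriv (preSchwarzian f) z - preSchwarzian f z ^ 2 / 2

theorem differentiableOn_preSchwarzian {f : ℂ → ℂ} {U : Set ℂ} (hU : IsOpen U)
    (hf : DifferentiableOn ℂ f U) (h0 : ∀ z ∈ U, deriv f z ≠ 0) :
    DifferentiableOn ℂ (preSchwarzian f) U :=
  ((hf.deriv hU).deriv hU).div (hf.deriv hU) h0

theorem differentiableOn_schwarzian {f : ℂ → ℂ} {U : Set ℂ} (hU : IsOpen U)
    (hf : DifferentiableOn ℂ f U) (h0 : ∀ z ∈ U, deriv f z ≠ 0) :
    DifferentiableOn ℂ (schwarzian f) U :=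
  ((differentiableOn_preSchwarzian hU hf h0).deriv hU).sub
    (((differentiableOn_preSchwarzian hU hf h0).pow 2).div_const 2)

theorem measurable_preSchwarzian (f : ℂ → ℂ) : Measurable (preSchwarzian f) :=
  (measurable_deriv _).div (measurable_deriv _)

theorem measurable_schwarzian (f : ℂ → ℂ) : Measurable (schwarzian f) :=
  (measurable_deriv _).sub (((measurable_preSchwarzian f).pow_const 2).div_const 2)

theorem hasDerivAt_radial {h : ℂ → ℂ} {e : ℂ} {r : ℝ} (hd : DifferentiableAt ℂ h (r * e)) :
    HasDerivAt (fun s : ℝ => h (s * e)) (deriv h (r * e) * e) r := by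
  have h1 : HasDerivAt (fun s : ℝ => (s : ℂ) * e) e r := by
    simpa using (Complex.ofRealCLM.hasDerivAt (x := r)).mul_const e
  exact HasDerivAt.comp r hd.hasDerivAt h1

theorem norm_radial {e : ℂ} (he : ‖e‖ = 1) {r : ℝ} (hr : 0 ≤ r) : ‖(r : ℂ) * e‖ = r := by
  rw [norm_mul, he, mul_one, Complex.norm_real, Real.norm_eq_abs, abs_of_nonneg hr]

theorem hasDerivAt_norm_of_ne_zero {u : ℝ → ℂ} {u' : ℂ} {r : ℝ} (hu : HasDerivAt u u' r) (h0 : u r ≠ 0) :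
    HasDerivAt (fun s => ‖u s‖) (‖u r‖ * (u' / u r).re) r := by
  have h1 : HasDerivAt (fun s => (u s).re) u'.re r :=
    (Complex.reCLM.hasFDerivAt.comp_hasDerivAt r hu)
  have h2 : HasDerivAt (fun s => (u s).im) u'.im r :=
    (Complex.imCLM.hasFDerivAt.comp_hasDerivAt r hu)
  have h3 := ((h1.mul h1).add (h2.mul h2)).sqrt (by
    have := Complex.normSq_pos.2 h0
    rw [Complex.normSq_apply] at this
    exact this.ne')
  have e1 : (fun s => ‖u s‖) = fun s => √((u s).re * (u s).re + (u s).im * (u s).im) := by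
    ext s; rw [Complex.norm_def, Complex.normSq_apply]
  have e2 : √((u r).re * (u r).re + (u r).im * (u r).im) = ‖u r‖ := by
    rw [Complex.norm_def, Complex.normSq_apply]
  rw [e1]
  refine h3.congr_deriv ?_
  simp only [Pi.add_apply, Pi.mul_apply]
  rw [e2, Complex.div_re, Complex.normSq_eq_norm_sq]
  have : ‖u r‖ ≠ 0 := by simpa using h0
  field_simp
  ring

/-- The algebraic inequality behind the monotonicity along radii. -/
theorem riccati_ineq {a b s t v : ℝ} (hv : 0 < v) (hv1 : v ≤ 1 / 2)
    (hst : s ^ 2 + t ^ 2 ≤ (v ^ 2 / 8) ^ 2) :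
    2 * a * (a ^ 2 - b ^ 2 - a + s) + 2 * b * (2 * a * b - b + t)
      - v ^ 2 * (-2 * (1 - a) * (a ^ 2 - b ^ 2 - a + s) + 2 * b * (2 * a * b - b + t))
      ≤ (a ^ 2 + b ^ 2 - v ^ 2 * ((1 - a) ^ 2 + b ^ 2)) * (2 * a - 1) := by
  have hs : |s| ≤ v ^ 2 / 8 := abs_le_of_sq_le_sq (by nlinarith [sq_nonneg t]) (by positivity)
  have ht : |t| ≤ v ^ 2 / 8 := abs_le_of_sq_le_sq (by nlinarith [sq_nonneg s]) (by positivity)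
  have hvv : v ^ 2 ≤ 1 / 4 := by nlinarith
  suffices 2 * a * s + 2 * b * t - v ^ 2 * (-2 * (1 - a) * s + 2 * b * t) ≤
      a ^ 2 + b ^ 2 + v ^ 2 * ((1 - a) ^ 2 + b ^ 2) by nlinarith
  have key : (a + v ^ 2 * (1 - a)) * s + (1 - v ^ 2) * b * t ≤
      |a + v ^ 2 * (1 - a)| * (v ^ 2 / 8) + |(1 - v ^ 2) * b| * (v ^ 2 / 8) := by
    refine add_le_add ?_ ?_
    · refine (le_abs_self _).trans ?_
      rw [abs_mul]; gcongr
    · refine (le_abs_self _).trans ?_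
      rw [abs_mul]; gcongr
  have k1 : |a + v ^ 2 * (1 - a)| ≤ a ^ 2 + 1 := by
    rw [abs_le]; constructor <;> nlinarith [sq_nonneg (a - 1 / 2), sq_nonneg (a + 1 / 2)]
  have k2 : |(1 - v ^ 2) * b| ≤ b ^ 2 + 1 := by
    rw [abs_mul, abs_of_nonneg (by linarith)]
    have : |b| ≤ b ^ 2 + 1 := by
      rw [abs_le]; constructor <;> nlinarith [sq_nonneg (b - 1 / 2), sq_nonneg (b + 1 / 2)]
    nlinarith [abs_nonneg b]
  nlinarith [sq_nonneg (a - 1 / 2), sq_nonneg (b)]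

/-- The normalized radial pre-Schwarzian. -/
noncomputable def radialPre (g : ℂ → ℂ) (e : ℂ) (r : ℝ) : ℂ :=
  ((1 - r : ℝ) : ℂ) * preSchwarzian g (r * e) * e / 2

theorem hasDerivAt_radialPre {g : ℂ → ℂ} (hg : DifferentiableOn ℂ g (ball 0 1))
    (h0 : ∀ z ∈ ball (0 : ℂ) 1, deriv g z ≠ 0) {e : ℂ} (he : ‖e‖ = 1) {r : ℝ} (hr : 0 ≤ r) (hr1 : r < 1) :
    HasDerivAt (radialPre g e) ((radialPre g e r ^ 2 - radialPre g e r +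
      ((1 - r : ℝ) : ℂ) ^ 2 * schwarzian g (r * e) * e ^ 2 / 2) / ((1 - r : ℝ) : ℂ)) r := by
  have hmem : (r : ℂ) * e ∈ ball (0 : ℂ) 1 := by
    rw [mem_ball_zero_iff, norm_radial he hr]; exact hr1
  have hd := (differentiableOn_preSchwarzian isOpen_ball hg h0).differentiableAt (isOpen_ball.mem_nhds hmem)
  have h1 := hasDerivAt_radial hd
  have h2 : HasDerivAt (fun s : ℝ => ((1 - s : ℝ) : ℂ)) (-1) r := by
    simpa using ((hasDerivAt_const r (1 : ℝ)).sub (hasDerivAt_id r)).ofReal_comp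
  have h3 := (((h2.mul h1).mul_const e).div_const 2)
  refine h3.congr_deriv ?_
  have hne : ((1 - r : ℝ) : ℂ) ≠ 0 := by
    exact_mod_cast (by linarith : (1 - r) ≠ 0)
  rw [eq_div_iff hne, radialPre, schwarzian]
  ring

theorem antitoneOn_radial {g : ℂ → ℂ} (hg : DifferentiableOn ℂ g (ball 0 1))
    (h0 : ∀ z ∈ ball (0 : ℂ) 1, deriv g z ≠ 0) {v : ℝ} (hv : 0 < v) (hv1 : v ≤ 1 / 2) {b : ℝ} (hb0 : 0 ≤ b)
    (hS : ∀ z ∈ collar b, (1 - ‖z‖) ^ 2 * ‖schwarzian g z‖ ≤ v ^ 2 / 4) {e : ℂ} (he : ‖e‖ = 1)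
     :
    AntitoneOn (fun r => (‖radialPre g e r‖ ^ 2 - v ^ 2 * ‖1 - radialPre g e r‖ ^ 2) /
      (‖deriv g (r * e)‖ * (1 - r))) (Ioo b 1) := by
  set x := radialPre g e with hx
  have key : ∀ r ∈ Ioo b 1, ∃ D ≤ 0, HasDerivAt (fun r => (‖x r‖ ^ 2 - v ^ 2 * ‖1 - x r‖ ^ 2) /
      (‖deriv g (r * e)‖ * (1 - r))) D r := by
    intro r hr
    have hr0 : 0 ≤ r := by linarith [hr.1]
    have hh : 0 < 1 - r := by linarith [hr.2]
    have hmem : (r : ℂ) * e ∈ ball (0 : ℂ) 1 := by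
      rw [mem_ball_zero_iff, norm_radial he hr0]; exact hr.2
    have hcol : (r : ℂ) * e ∈ collar b := by
      simp only [collar, mem_ofPred_eq, norm_radial he hr0]; exact hr
    have hσ := hS _ hcol
    rw [norm_radial he hr0] at hσ
    have hxd := hasDerivAt_radialPre hg h0 he hr0 hr.2
    rw [← hx] at hxd
    set σ : ℂ := ((1 - r : ℝ) : ℂ) ^ 2 * schwarzian g (r * e) * e ^ 2 / 2 with hσd
    have hσn : ‖σ‖ ≤ v ^ 2 / 8 := by
      have : ‖σ‖ = (1 - r) ^ 2 * ‖schwarzian g (r * e)‖ / 2 := by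
        rw [hσd, norm_div, norm_mul, norm_mul, norm_pow, norm_pow, he, Complex.norm_real, Real.norm_eq_abs,
          abs_of_pos hh]
        simp
      linarith
    have hst : σ.re ^ 2 + σ.im ^ 2 ≤ (v ^ 2 / 8) ^ 2 := by
      have : σ.re ^ 2 + σ.im ^ 2 = ‖σ‖ ^ 2 := by
        rw [← Complex.normSq_eq_norm_sq, Complex.normSq_apply]; ring
      rw [this]; gcongr
    have h1 : HasDerivAt (fun s => (x s).re) (((x r).re ^ 2 - (x r).im ^ 2 - (x r).re + σ.re) / (1 - r)) r := by
      refine (Complex.reCLM.hasFDerivAt.comp_hasDerivAt r hxd).congr_deriv ?_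
      rw [Complex.reCLM_apply, Complex.div_ofReal_re]
      simp [pow_two]
    have h2 : HasDerivAt (fun s => (x s).im) ((2 * (x r).re * (x r).im - (x r).im + σ.im) / (1 - r)) r := by
      refine (Complex.imCLM.hasFDerivAt.comp_hasDerivAt r hxd).congr_deriv ?_
      rw [Complex.imCLM_apply, Complex.div_ofReal_im]
      simp [pow_two]
      ring
    have hG : HasDerivAt (fun s : ℝ => ‖deriv g (s * e)‖) (‖deriv g (r * e)‖ * (2 * (x r).re / (1 - r))) r := by
      have hd := (hg.deriv isOpen_ball).differentiableAt (isOpen_ball.mem_nhds hmem)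
      refine (hasDerivAt_norm_of_ne_zero (hasDerivAt_radial hd) (h0 _ hmem)).congr_deriv ?_
      congr 1
      have : x r = ((1 - r : ℝ) : ℂ) * (deriv (deriv g) (r * e) * e / deriv g (r * e)) / 2 := by
        rw [hx, radialPre, preSchwarzian]; ring
      rw [this, show (2:ℂ) = ((2:ℝ):ℂ) by norm_num, Complex.div_ofReal_re, Complex.re_ofReal_mul]
      field_simp
    have hq := ((h1.mul h1).add (h2.mul h2)).sub
      ((((((hasDerivAt_const r (1:ℝ)).sub h1).mul ((hasDerivAt_const r (1:ℝ)).sub h1)).add (h2.mul h2))).const_mul (v ^ 2))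
    have hgp : 0 < ‖deriv g (r * e)‖ := norm_pos_iff.2 (h0 _ hmem)
    have hden := hG.mul ((hasDerivAt_const r (1:ℝ)).sub (hasDerivAt_id r))
    have hW := hq.div hden (by simp only [Pi.mul_apply, Pi.sub_apply, id]; positivity)
    refine ⟨_, ?_, hW.congr_of_eventuallyEq (Eventually.of_forall fun s => ?_)⟩
    rotate_left
    · simp only [Pi.div_apply, Pi.sub_apply, Pi.add_apply, Pi.mul_apply, id]
      rw [← Complex.normSq_eq_norm_sq, ← Complex.normSq_eq_norm_sq, Complex.normSq_apply, Complex.normSq_apply]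
      simp
    apply div_nonpos_of_nonpos_of_nonneg _ (sq_nonneg _)
    simp only [Pi.sub_apply, Pi.add_apply, Pi.mul_apply, id]
    have hr2 := riccati_ineq (a := (x r).re) (b := (x r).im) hv hv1 hst
    set a := (x r).re
    set c := (x r).im
    set G := ‖deriv g (r * e)‖
    have hne := hh.ne'
    field_simp
    ring_nf at hr2 ⊢
    nlinarith
  intro r hr s hs hrs
  have hsub : Icc r s ⊆ Ioo b 1 := fun t ht => ⟨hr.1.trans_le ht.1, ht.2.trans_lt hs.2⟩
  choose! D hD hDd using key
  refine antitoneOn_of_hasDerivWithinAt_nonpos (convex_Icc r s)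
    (fun t ht => (hDd t (hsub ht)).continuousAt.continuousWithinAt)
    (f' := D) (fun t ht => (hDd t (hsub (interior_subset ht))).hasDerivWithinAt)
    (fun t ht => hD t (hsub (interior_subset ht))) (left_mem_Icc.2 hrs) (right_mem_Icc.2 hrs) hrs

end Schwarzian

section Schwarzian
open Set Filter Topology
open scoped ENNReal

theorem exists_collar_preSchwarzian_le {g : ℂ → ℂ} (hg : DifferentiableOn ℂ g (ball 0 1))
    (h0 : ∀ z ∈ ball (0 : ℂ) 1, deriv g z ≠ 0) {v : ℝ} (hv : 0 < v) (hv1 : v ≤ 1 / 2) {b : ℝ} (hb0 : 0 ≤ b)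
    (hb1 : b < 1) (hS : ∀ z ∈ collar b, (1 - ‖z‖) ^ 2 * ‖schwarzian g z‖ ≤ v ^ 2 / 4)
    (hG : ∀ ε > 0, ∃ c < 1, ∀ z ∈ collar c, (1 - ‖z‖) * ‖deriv g z‖ ≤ ε) :
    ∃ c, b ≤ c ∧ c < 1 ∧ ∀ z ∈ collar c, (1 - ‖z‖) * ‖preSchwarzian g z‖ ≤ 6 * v := by
  set r1 := (1 + b) / 2
  have hr1 : r1 ∈ Ioo b 1 := ⟨by simp only [r1]; linarith, by simp only [r1]; linarith⟩
  have hr10 : 0 ≤ r1 := hb0.trans hr1.1.le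
  have hsub : closedBall (0:ℂ) r1 ⊆ ball 0 1 := closedBall_subset_ball hr1.2
  obtain ⟨C1, hC1⟩ := (isCompact_closedBall (0:ℂ) r1).exists_bound_of_continuousOn
    ((differentiableOn_preSchwarzian isOpen_ball hg h0).continuousOn.mono hsub)
  obtain ⟨C2, hC2⟩ := (isCompact_closedBall (0:ℂ) r1).exists_bound_of_continuousOn
    (((hg.deriv isOpen_ball).inv h0).continuousOn.mono hsub)
  have hC1' := (norm_nonneg _).trans (hC1 0 (mem_closedBall_self hr10))
  have hC2' := (norm_nonneg _).trans (hC2 0 (mem_closedBall_self hr10))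
  set K := (C1 / 2) ^ 2 * C2 * (1 - r1)
  have hK : 0 ≤ K := by have := hr1.2; positivity
  obtain ⟨c, hc1, hc⟩ := hG (v ^ 2 / (K + 1)) (by positivity)
  refine ⟨max c r1, hr1.1.le.trans (le_max_right _ _), max_lt hc1 hr1.2, fun z hz => ?_⟩
  have hzc := hc z (collar_subset (le_max_left _ _) hz)
  have hz1 : r1 < ‖z‖ := (le_max_right _ _).trans_lt hz.1
  have hz2 := hz.2
  have hz0 : 0 < ‖z‖ := hr10.trans_lt hz1
  set e : ℂ := z / ‖z‖
  have he : ‖e‖ = 1 := by simp [e, hz0.ne']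
  have hze : ((‖z‖ : ℝ) : ℂ) * e = z := by
    simp only [e]; rw [mul_div_cancel₀]; exact_mod_cast hz0.ne'
  have hx : ∀ r : ℝ, 0 ≤ r → r < 1 → ‖radialPre g e r‖ = (1 - r) * ‖preSchwarzian g (r * e)‖ / 2 := by
    intro r h h'
    rw [radialPre, norm_div, norm_mul, norm_mul, he, Complex.norm_real, Real.norm_eq_abs, abs_of_pos (by linarith)]
    simp
  have hmono := antitoneOn_radial hg h0 hv hv1 hb0 hS he hr1 ⟨hr1.1.trans hz1, hz2⟩ hz1.le
  simp only [hze] at hmono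
  have hm1 : (r1 : ℂ) * e ∈ closedBall (0:ℂ) r1 := by simp [he, abs_of_nonneg hr10]
  have hb1' := hC1 _ hm1
  have hb2' := hC2 _ hm1
  have hL : (‖radialPre g e r1‖ ^ 2 - v ^ 2 * ‖1 - radialPre g e r1‖ ^ 2) / (‖deriv g (r1 * e)‖ * (1 - r1)) ≤ K := by
    have hgp : 0 < ‖deriv g (r1 * e)‖ := norm_pos_iff.2 (h0 _ (hsub hm1))
    have h1r : 0 < 1 - r1 := by linarith [hr1.2]
    have hxx := hx r1 hr10 hr1.2
    rw [div_le_iff₀ (by positivity)]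
    have h3 : 1 ≤ C2 * ‖deriv g (r1 * e)‖ := by
      simp only [Pi.inv_apply, norm_inv] at hb2'
      calc (1:ℝ) = ‖deriv g (r1 * e)‖⁻¹ * ‖deriv g (r1 * e)‖ := by field_simp
        _ ≤ _ := by gcongr
    have h4 : ‖radialPre g e r1‖ ^ 2 ≤ (C1 / 2) ^ 2 * (1 - r1) * (1 - r1) := by
      rw [hxx]
      have : (1 - r1) * ‖preSchwarzian g (r1 * e)‖ / 2 ≤ (1 - r1) * C1 / 2 := by gcongr
      calc _ ≤ ((1 - r1) * C1 / 2) ^ 2 := by gcongr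
        _ = _ := by ring
    have h5 : (C1 / 2) ^ 2 * (1 - r1) * (1 - r1) ≤ (C1 / 2) ^ 2 * (1 - r1) * (1 - r1) * (C2 * ‖deriv g (r1 * e)‖) :=
      le_mul_of_one_le_right (by positivity) h3
    have h6 : 0 ≤ v ^ 2 * ‖1 - radialPre g e r1‖ ^ 2 := by positivity
    calc _ ≤ (C1 / 2) ^ 2 * (1 - r1) * (1 - r1) * (C2 * ‖deriv g (r1 * e)‖) := by linarith
      _ = _ := by simp only [K]; ring
  have hgz : 0 < ‖deriv g z‖ := norm_pos_iff.2 (h0 _ (by simpa using hz2))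
  have hq := hmono.trans hL
  have h1z : 0 < 1 - ‖z‖ := by linarith
  rw [div_le_iff₀ (by positivity)] at hq
  have hq2 : ‖radialPre g e ‖z‖‖ ^ 2 - v ^ 2 * ‖1 - radialPre g e ‖z‖‖ ^ 2 ≤ v ^ 2 := by
    refine hq.trans ?_
    calc K * (‖deriv g z‖ * (1 - ‖z‖)) ≤ (K + 1) * (v ^ 2 / (K + 1)) := by
          gcongr
          · linarith
          · linarith
      _ = v ^ 2 := by field_simp
  have hx2 := hx ‖z‖ hz0.le hz2
  rw [hze] at hx2
  have htri : ‖1 - radialPre g e ‖z‖‖ ≤ 1 + ‖radialPre g e ‖z‖‖ := by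
    simpa using norm_sub_le (1:ℂ) (radialPre g e ‖z‖)
  set X := ‖radialPre g e ‖z‖‖
  have hX0 : 0 ≤ X := norm_nonneg _
  have h7 : ‖1 - radialPre g e ‖z‖‖ ^ 2 ≤ 2 + 2 * X ^ 2 := by
    calc _ ≤ (1 + X) ^ 2 := by gcongr
      _ ≤ _ := by nlinarith [sq_nonneg (1 - X)]
  have h8 : X ^ 2 ≤ (3 * v) ^ 2 := by
    have : v ^ 2 * ‖1 - radialPre g e ‖z‖‖ ^ 2 ≤ v ^ 2 * (2 + 2 * X ^ 2) := by gcongr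
    have hv2 : v ^ 2 ≤ 1 / 4 := by nlinarith
    nlinarith [mul_le_mul_of_nonneg_right hv2 (sq_nonneg X)]
  have h9 : X ≤ 3 * v := (pow_le_pow_iff_left₀ hX0 (by positivity) two_ne_zero).1 h8
  linarith

/-- Radial Hardy-type inequality. -/
theorem radial_hardy {F F' : ℝ → ℂ} {S : ℝ → ℝ} {a ρ : ℝ} (haρ : a ≤ ρ) (hρ : ρ < 1)
    (hF : ∀ r ∈ Icc a ρ, HasDerivAt F (F' r) r) (hF' : ContinuousOn F' (Icc a ρ)) (hSc : ContinuousOn S (Icc a ρ))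
    (hS0 : ∀ r ∈ Icc a ρ, 0 ≤ S r)
    (hS : ∀ r ∈ Icc a ρ, ‖F' r‖ ≤ S r + ‖F r‖ ^ 2 / 2)
    (hsm : ∀ r ∈ Icc a ρ, (1 - r) * ‖F r‖ ≤ 1 / 2) :
    ∫ r in a..ρ, ‖F r‖ ^ 2 ≤ 4 * ‖F a‖ ^ 2 * (1 - a) + 16 * ∫ r in a..ρ, (1 - r) ^ 2 * S r ^ 2 := by
  have hFc : ContinuousOn F (Icc a ρ) := fun r hr => (hF r hr).continuousAt.continuousWithinAt
  set D : ℝ → ℝ := fun r => -‖F r‖ ^ 2 + (ρ - r) * (2 * inner ℝ (F r) (F' r)) with hD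
  have hder : ∀ r ∈ uIcc a ρ, HasDerivAt (fun r => (ρ - r) * ‖F r‖ ^ 2) (D r) r := by
    intro r hr
    rw [uIcc_of_le haρ] at hr
    have := (((hasDerivAt_const r ρ).sub (hasDerivAt_id r)).mul (hF r hr).norm_sq)
    refine this.congr_deriv ?_
    simp only [hD, Pi.sub_apply, id]; ring
  have hDc : ContinuousOn D (Icc a ρ) := by
    refine ((hFc.norm.pow 2).neg).add (((continuousOn_const.sub continuousOn_id)).mul
      (continuousOn_const.mul ?_))
    exact ContinuousOn.inner (𝕜 := ℝ) hFc hF'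
  have hii : ∀ {f : ℝ → ℝ}, ContinuousOn f (Icc a ρ) → IntervalIntegrable f volume a ρ := fun h =>
    ContinuousOn.intervalIntegrable (by rwa [uIcc_of_le haρ])
  have hftc := intervalIntegral.integral_eq_sub_of_hasDerivAt hder (hii hDc)
  have hle : ∫ r in a..ρ, D r ≤ ∫ r in a..ρ, (-(1/4) * ‖F r‖ ^ 2 + 4 * ((1 - r) ^ 2 * S r ^ 2)) := by
    refine intervalIntegral.integral_mono_on haρ (hii hDc) (hii ?_) fun r hr => ?_
    · exact (continuousOn_const.mul (hFc.norm.pow 2)).add (continuousOn_const.mul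
        (((continuousOn_const.sub continuousOn_id).pow 2).mul (hSc.pow 2)))
    · have h1 : inner ℝ (F r) (F' r) ≤ ‖F r‖ * (S r + ‖F r‖ ^ 2 / 2) :=
        (real_inner_le_norm _ _).trans (by have := hS r hr; gcongr)
      have h0 : 0 ≤ ‖F r‖ * (S r + ‖F r‖ ^ 2 / 2) := by have := hS0 r hr; positivity
      have h2 := hsm r hr
      have h3 : (ρ - r) * (2 * inner ℝ (F r) (F' r)) ≤ (1 - r) * (2 * (‖F r‖ * (S r + ‖F r‖ ^ 2 / 2))) := by
        have hr2 := hr.2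
        calc _ ≤ (ρ - r) * (2 * (‖F r‖ * (S r + ‖F r‖ ^ 2 / 2))) := by gcongr
          _ ≤ _ := by gcongr
      simp only [hD]
      have h4 : (1 - r) * ‖F r‖ * ‖F r‖ ^ 2 ≤ 1 / 2 * ‖F r‖ ^ 2 := by gcongr
      nlinarith [sq_nonneg (‖F r‖ / 2 - 2 * ((1 - r) * S r))]
  rw [hftc, intervalIntegral.integral_add, intervalIntegral.integral_const_mul, intervalIntegral.integral_const_mul] at hle
  · have hsq : 0 ≤ ‖F a‖ ^ 2 := by positivity
    have hI : 0 ≤ ∫ r in a..ρ, (1 - r) ^ 2 * S r ^ 2 :=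
      intervalIntegral.integral_nonneg haρ fun r _ => by positivity
    have : (ρ - a) * ‖F a‖ ^ 2 ≤ (1 - a) * ‖F a‖ ^ 2 := by gcongr
    simp only [sub_self, zero_mul, zero_sub] at hle
    nlinarith
  · exact hii (continuousOn_const.mul (hFc.norm.pow 2))
  · exact hii (continuousOn_const.mul
        (((continuousOn_const.sub continuousOn_id).pow 2).mul (hSc.pow 2)))

theorem setLIntegral_Ioo_le_of_forall {f : ℝ → ℝ≥0∞} {a b : ℝ} (hab : a < b) {B : ℝ≥0∞}
    (h : ∀ ρ, a ≤ ρ → ρ < b → ∫⁻ r in Ioc a ρ, f r ≤ B) : ∫⁻ r in Ioo a b, f r ≤ B := by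
  set s : ℕ → Set ℝ := fun n => Ioc a (b - (b - a) / (n + 1))
  have hmono : Monotone s := by
    intro i j hij
    apply Ioc_subset_Ioc_right
    have : (i:ℝ) ≤ j := by exact_mod_cast hij
    have : (b - a) / ((j:ℝ) + 1) ≤ (b - a) / ((i:ℝ) + 1) := by
      apply div_le_div_of_nonneg_left <;> linarith [i.cast_nonneg (α := ℝ)]
    linarith
  have hU : Ioo a b ⊆ ⋃ n, s n := by
    intro r hr
    obtain ⟨k, hk⟩ := exists_nat_gt ((b - a) / (b - r))
    refine mem_iUnion.2 ⟨k, hr.1, ?_⟩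
    rw [div_lt_iff₀ (by linarith [hr.2])] at hk
    have : (b - a) / ((k:ℝ) + 1) ≤ b - r := by
      rw [div_le_iff₀ (by positivity)]
      nlinarith [hr.2]
    linarith
  refine (lintegral_mono_set hU).trans ?_
  rw [setLIntegral_iUnion_of_directed _ hmono.directed_le]
  refine iSup_le fun n => h _ ?_ ?_
  · have : (b - a) / ((n:ℝ) + 1) ≤ b - a := div_le_self (by linarith) (by linarith [n.cast_nonneg (α := ℝ)])
    linarith
  · have : 0 < (b - a) / ((n:ℝ) + 1) := by apply div_pos (by linarith) (by positivity)
    linarith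

/-- If the Schwarzian is square integrable with weight `(1-|z|)^2` and `(1-|z|)g'` tends to zero,
then the pre-Schwarzian is square integrable. -/
theorem lintegral_preSchwarzian_lt_top {g : ℂ → ℂ} (hg : DifferentiableOn ℂ g (ball 0 1))
    (h0 : ∀ z ∈ ball (0 : ℂ) 1, deriv g z ≠ 0) {b : ℝ} (hb1 : b < 1)
    (hS : ∫⁻ z in collar b, ENNReal.ofReal ((1 - ‖z‖) ^ 2 * ‖schwarzian g z‖ ^ 2) < ⊤)
    (hG : ∀ ε > 0, ∃ c < 1, ∀ z ∈ collar c, (1 - ‖z‖) * ‖deriv g z‖ ≤ ε) :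
    ∫⁻ z in ball (0 : ℂ) 1, ENNReal.ofReal (‖preSchwarzian g z‖ ^ 2) < ⊤ := by
  have hcb : ∀ a, collar a ⊆ ball (0:ℂ) 1 := fun a z hz => by simpa using hz.2
  have hφd := differentiableOn_preSchwarzian isOpen_ball hg h0
  have hSd := differentiableOn_schwarzian isOpen_ball hg h0
  obtain ⟨b1, hbb1, hb11, hS1⟩ := exists_collar_norm_le hb1 1 (hSd.mono (hcb b)) (by simpa using hS)
    (ε := (1 / 12) ^ 2 / 4) (by norm_num)
  obtain ⟨c, hbc, hc1, hc⟩ := exists_collar_preSchwarzian_le hg h0 (v := 1 / 12) (by norm_num) (by norm_num)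
    (b := max b1 0) (le_max_right _ _) (max_lt hb11 one_pos)
    (fun z hz => by simpa using hS1 z (collar_subset (le_max_left _ _) hz)) hG
  have hc0 : 0 ≤ c := (le_max_right _ _).trans hbc
  have hbc' : b ≤ c := hbb1.trans ((le_max_left _ _).trans hbc)
  set a := (1 + c) / 2 with ha
  have hca : c < a := by rw [ha]; linarith
  have ha1 : a < 1 := by rw [ha]; linarith
  have ha0 : 0 < a := hc0.trans_lt hca
  obtain ⟨C, hC⟩ := (isCompact_closedBall (0:ℂ) a).exists_bound_of_continuousOn
    (hφd.continuousOn.mono (closedBall_subset_ball ha1))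
  set T : ℝ≥0∞ := ∫⁻ z in collar a, ENNReal.ofReal ((1 - ‖z‖) ^ 2 * ‖schwarzian g z‖ ^ 2) with hT
  have hTlt : T < ⊤ := (lintegral_mono_set (collar_subset (hbc'.trans hca.le))).trans_lt hS
  have hray : ∀ θ : ℝ, ∫⁻ r in Ioo a 1, ENNReal.ofReal (‖preSchwarzian g (circleMap 0 r θ)‖ ^ 2) ≤
      ENNReal.ofReal (4 * C ^ 2) + ENNReal.ofReal (16 / a) * ∫⁻ r in Ioo a 1, ENNReal.ofReal r *
        ENNReal.ofReal ((1 - ‖circleMap 0 r θ‖) ^ 2 * ‖schwarzian g (circleMap 0 r θ)‖ ^ 2) := by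
    intro θ
    set e : ℂ := Complex.exp (θ * Complex.I) with he
    have hen : ‖e‖ = 1 := Complex.norm_exp_ofReal_mul_I θ
    have hcm : ∀ r : ℝ, circleMap 0 r θ = r * e := fun r => by simp [circleMap, he]
    simp only [hcm]
    refine setLIntegral_Ioo_le_of_forall ha1 fun ρ haρ hρ => ?_
    have hr : ∀ r ∈ Icc a ρ, (r : ℂ) * e ∈ ball (0:ℂ) 1 ∧ (r : ℂ) * e ∈ collar c := by
      intro r hr
      have hr0 : 0 ≤ r := ha0.le.trans hr.1
      simp only [mem_ball_zero_iff, collar, mem_ofPred_eq, norm_radial hen hr0]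
      exact ⟨hr.2.trans_lt hρ, hca.trans_le hr.1, hr.2.trans_lt hρ⟩
    have hcont : ContinuousOn (fun r : ℝ => (r : ℂ) * e) (Icc a ρ) := by fun_prop
    have hSc := (hSd.continuousOn.comp hcont fun r h => (hr r h).1).norm
    have hφc := (hφd.continuousOn.comp hcont fun r h => (hr r h).1).norm
    have hφ'c := ((hφd.deriv isOpen_ball).continuousOn.comp hcont fun r h => (hr r h).1)
    have hh := radial_hardy (F := fun r => preSchwarzian g (r * e))
      (F' := fun r => deriv (preSchwarzian g) (r * e) * e) (S := fun r => ‖schwarzian g (r * e)‖)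
      haρ hρ (fun r h => hasDerivAt_radial (hφd.differentiableAt (isOpen_ball.mem_nhds (hr r h).1)))
      (hφ'c.mul continuousOn_const) hSc (fun r _ => norm_nonneg _)
      (fun r h => by
        rw [norm_mul, hen, mul_one]
        have : deriv (preSchwarzian g) (r * e) = schwarzian g (r * e) + preSchwarzian g (r * e) ^ 2 / 2 := by
          rw [schwarzian]; ring
        rw [this]
        refine (norm_add_le _ _).trans (le_of_eq ?_)
        simp)
      (fun r h => by
        have := hc _ (hr r h).2
        rw [norm_radial hen (ha0.le.trans h.1)] at this
        linarith)
    have hi1 : IntegrableOn (fun r : ℝ => ‖preSchwarzian g (r * e)‖ ^ 2) (Ioc a ρ) :=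
      ((hφc.pow 2).integrableOn_Icc).mono_set Ioc_subset_Icc_self
    have hi2 : IntegrableOn (fun r : ℝ => (1 - r) ^ 2 * ‖schwarzian g (r * e)‖ ^ 2) (Ioc a ρ) :=
      ((((continuousOn_const.sub continuousOn_id).pow 2).mul (hSc.pow 2)).integrableOn_Icc).mono_set Ioc_subset_Icc_self
    rw [intervalIntegral.integral_of_le haρ, intervalIntegral.integral_of_le haρ] at hh
    rw [← ofReal_integral_eq_lintegral_ofReal hi1 (Eventually.of_forall fun r => by positivity)]
    refine (ENNReal.ofReal_le_ofReal hh).trans ?_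
    rw [ENNReal.ofReal_add]
    rotate_left
    · have : 0 < 1 - a := by linarith
      positivity
    · have : 0 ≤ ∫ r in Ioc a ρ, (1 - r) ^ 2 * ‖schwarzian g (r * e)‖ ^ 2 :=
        integral_nonneg fun r => by positivity
      positivity
    refine add_le_add (ENNReal.ofReal_le_ofReal ?_) ?_
    · have hca := hC (a * e) (by simp [hen, abs_of_pos ha0])
      have : ‖preSchwarzian g (a * e)‖ ^ 2 ≤ C ^ 2 := by gcongr
      nlinarith [sq_nonneg ‖preSchwarzian g (a * e)‖]
    · rw [ENNReal.ofReal_mul (by norm_num), ofReal_integral_eq_lintegral_ofReal hi2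
        (Eventually.of_forall fun r => by positivity), ← lintegral_const_mul' _ _ ENNReal.ofReal_ne_top,
        ← lintegral_const_mul' _ _ ENNReal.ofReal_ne_top]
      refine (setLIntegral_mono' measurableSet_Ioc fun r h => ?_).trans
        (lintegral_mono_set fun r (h : r ∈ Ioc a ρ) => (⟨h.1, h.2.trans_lt hρ⟩ : r ∈ Ioo a 1))
      have hr0 : 0 < r := ha0.trans h.1
      rw [norm_radial hen hr0.le, ← ENNReal.ofReal_mul (by norm_num), ← ENNReal.ofReal_mul hr0.le,
        ← ENNReal.ofReal_mul (by positivity)]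
      apply ENNReal.ofReal_le_ofReal
      have : 16 ≤ 16 / a * r := by
        rw [div_mul_eq_mul_div, le_div_iff₀ ha0]; nlinarith [h.1]
      calc _ ≤ (16 / a * r) * ((1 - r) ^ 2 * ‖schwarzian g (r * e)‖ ^ 2) := by gcongr
        _ = _ := by ring
  have hpol : ∀ f : ℂ → ℝ≥0∞, Measurable f → ∫⁻ z in collar a, f z =
      ∫⁻ θ in Ioo (-π) π, ∫⁻ r in Ioo a 1, ENNReal.ofReal r * f (circleMap 0 r θ) := by
    intro f hf
    have h1 := lintegral_polar hf (I := Ioo a 1) measurableSet_Ioo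
    rw [inter_eq_left.2 (show Ioo a 1 ⊆ Ioi 0 from fun x hx => ha0.trans hx.1)] at h1
    rw [← lintegral_lintegral_swap] at h1
    · exact h1
    · refine Measurable.aemeasurable ?_
      refine (ENNReal.measurable_ofReal.comp measurable_snd).mul (hf.comp ?_)
      simp only [circleMap]
      fun_prop
  have hcollar : ∫⁻ z in collar a, ENNReal.ofReal (‖preSchwarzian g z‖ ^ 2) < ⊤ := by
    rw [hpol _ (((measurable_preSchwarzian g).norm.pow_const 2).ennreal_ofReal)]
    have h1 : ∀ θ : ℝ, ∫⁻ r in Ioo a 1, ENNReal.ofReal r * ENNReal.ofReal (‖preSchwarzian g (circleMap 0 r θ)‖ ^ 2) ≤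
      ENNReal.ofReal (4 * C ^ 2) + ENNReal.ofReal (16 / a) * ∫⁻ r in Ioo a 1, ENNReal.ofReal r *
        ENNReal.ofReal ((1 - ‖circleMap 0 r θ‖) ^ 2 * ‖schwarzian g (circleMap 0 r θ)‖ ^ 2) := by
      intro θ
      refine le_trans (setLIntegral_mono' measurableSet_Ioo fun r h => ?_) (hray θ)
      refine mul_le_of_le_one_left' ?_
      exact ENNReal.ofReal_le_one.2 h.2.le
    refine (lintegral_mono h1).trans_lt ?_
    rw [lintegral_add_left measurable_const, lintegral_const_mul' _ _ ENNReal.ofReal_ne_top, ← hpol (fun z =>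
      ENNReal.ofReal ((1 - ‖z‖) ^ 2 * ‖schwarzian g z‖ ^ 2))]
    · refine ENNReal.add_lt_top.2 ⟨?_, ENNReal.mul_lt_top ENNReal.ofReal_lt_top hTlt⟩
      rw [setLIntegral_const]
      refine ENNReal.mul_lt_top ENNReal.ofReal_lt_top ?_
      rw [Real.volume_Ioo]; exact ENNReal.ofReal_lt_top
    · have := measurable_schwarzian g
      exact (((measurable_const.sub measurable_norm).pow_const 2).mul (this.norm.pow_const 2)).ennreal_ofReal
  have hcov : ball (0:ℂ) 1 ⊆ closedBall 0 a ∪ collar a := by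
    intro z hz
    rw [mem_ball_zero_iff] at hz
    rcases le_or_gt ‖z‖ a with h | h
    · left; simpa using h
    · right; exact ⟨h, hz⟩
  refine (lintegral_mono_set hcov).trans_lt ((lintegral_union_le _ _ _).trans_lt ?_)
  refine ENNReal.add_lt_top.2 ⟨?_, hcollar⟩
  refine lt_of_le_of_lt (setLIntegral_mono' (g := fun _ => ENNReal.ofReal (C ^ 2)) measurableSet_closedBall fun z hz => ?_) ?_
  · have := hC z hz
    gcongr
  · rw [setLIntegral_const]
    exact ENNReal.mul_lt_top ENNReal.ofReal_lt_top measure_closedBall_lt_top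

end Schwarzian

section Area
open Set Filter Topology
open scoped ENNReal ComplexConjugate

/-- The real-linear map `v ↦ α v + β v̄`. -/
noncomputable def wirtinger (α β : ℂ) : ℂ →L[ℝ] ℂ :=
  α • (1 : ℂ →L[ℝ] ℂ) + β • (Complex.conjCLE : ℂ →L[ℝ] ℂ)

@[simp] theorem wirtinger_apply (α β v : ℂ) : wirtinger α β v = α * v + β * conj v := by
  simp [wirtinger]

theorem det_wirtinger (α β : ℂ) : (wirtinger α β).det = ‖α‖ ^ 2 - ‖β‖ ^ 2 := by
  rw [ContinuousLinearMap.det, ← LinearMap.det_toMatrix Complex.basisOneI, Matrix.det_fin_two]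
  simp only [LinearMap.toMatrix_apply, Complex.coe_basisOneI_repr, Complex.coe_basisOneI,
    ContinuousLinearMap.coe_coe, wirtinger_apply]
  simp
  rw [← Complex.normSq_eq_norm_sq, ← Complex.normSq_eq_norm_sq, Complex.normSq_apply, Complex.normSq_apply]
  ring

theorem hasFDerivAt_wirtinger {f : ℂ → ℂ} {f' z : ℂ} (h : HasDerivAt f f' z) :
    HasFDerivAt f (wirtinger f' 0) z := by
  refine h.complexToReal_fderiv.congr_fderiv ?_
  ext
  simp

theorem lintegral_image_holomorphic {f : ℂ → ℂ} {U : Set ℂ} (hU : IsOpen U)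
    (hf : DifferentiableOn ℂ f U) (hi : InjOn f U) (F : ℂ → ℝ≥0∞) :
    ∫⁻ w in f '' U, F w = ∫⁻ z in U, ENNReal.ofReal (‖deriv f z‖ ^ 2) * F (f z) := by
  rw [lintegral_image_eq_lintegral_abs_det_fderiv_mul volume hU.measurableSet (f' := fun z => wirtinger (deriv f z) 0)
    (fun z hz => (hasFDerivAt_wirtinger (hf.differentiableAt (hU.mem_nhds hz)).hasDerivAt).hasFDerivWithinAt) hi]
  refine lintegral_congr fun z => ?_
  rw [det_wirtinger]
  simp

theorem lintegral_deriv_sq {f : ℂ → ℂ} {U : Set ℂ} (hU : IsOpen U)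
    (hf : DifferentiableOn ℂ f U) (hi : InjOn f U) :
    ∫⁻ z in U, ENNReal.ofReal (‖deriv f z‖ ^ 2) = volume (f '' U) := by
  rw [← setLIntegral_one, lintegral_image_holomorphic hU hf hi]
  simp

theorem one_sub_conj_mul_ne_zero {z w : ℂ} (hz : ‖z‖ < 1) (hw : ‖w‖ ≤ 1) : 1 - w * z ≠ 0 := by
  intro h
  have h1 : ‖w * z‖ = 1 := by rw [← sub_eq_zero.1 h]; simp
  rw [norm_mul] at h1
  nlinarith [norm_nonneg z, norm_nonneg w]

theorem one_sub_norm_le {z w : ℂ} (hw : ‖w‖ ≤ 1) : 1 - ‖z‖ ≤ ‖1 - w * z‖ := by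
  have h := norm_sub_norm_le (1:ℂ) (w * z)
  rw [norm_one, norm_mul] at h
  nlinarith [norm_nonneg z]

theorem lintegral_kernel_le {z : ℂ} (hz : ‖z‖ < 1) :
    ∫⁻ ξ in ball (0:ℂ) 1, ENNReal.ofReal ((1 / ‖1 - conj ξ * z‖ ^ 2) ^ 2) ≤
      ENNReal.ofReal (π / (1 - ‖z‖) ^ 2) := by
  have hcz : ‖conj z‖ < 1 := by simpa using hz
  have hne : ∀ ξ ∈ ball (0:ℂ) 1, 1 - ξ * conj z ≠ 0 := fun ξ hξ =>
    one_sub_conj_mul_ne_zero hcz (by simpa using (mem_ball_zero_iff.1 hξ).le)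
  have hd : ∀ ξ ∈ ball (0:ℂ) 1, HasDerivAt (fun ξ => ξ / (1 - ξ * conj z)) (1 / (1 - ξ * conj z) ^ 2) ξ := by
    intro ξ hξ
    have h1 := (hasDerivAt_id ξ).div ((hasDerivAt_const ξ (1:ℂ)).sub ((hasDerivAt_id ξ).mul_const (conj z))) (hne ξ hξ)
    refine h1.congr_deriv ?_
    have := hne ξ hξ
    simp only [Pi.sub_apply, id]
    congr 1
    ring
  have hinj : InjOn (fun ξ => ξ / (1 - ξ * conj z)) (ball (0:ℂ) 1) := by
    intro a ha b hb hab
    simp only at hab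
    rw [div_eq_div_iff (hne a ha) (hne b hb)] at hab
    linear_combination hab
  have hA := lintegral_deriv_sq isOpen_ball
    (fun ξ hξ => (hd ξ hξ).differentiableAt.differentiableWithinAt) hinj
  have h1z : 0 < 1 - ‖z‖ := by linarith
  calc _ = ∫⁻ ξ in ball (0:ℂ) 1, ENNReal.ofReal (‖deriv (fun ξ => ξ / (1 - ξ * conj z)) ξ‖ ^ 2) := by
        refine setLIntegral_congr_fun measurableSet_ball fun ξ hξ => ?_
        rw [(hd ξ hξ).deriv]
        have : 1 - conj ξ * z = conj (1 - ξ * conj z) := by simp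
        rw [this, Complex.norm_conj]
        simp
    _ ≤ volume (ball (0:ℂ) (1 / (1 - ‖z‖))) := by
        rw [hA]
        refine measure_mono ?_
        rintro _ ⟨ξ, hξ, rfl⟩
        rw [mem_ball_zero_iff] at hξ ⊢
        have h2 := one_sub_norm_le (z := conj z) hξ.le
        rw [Complex.norm_conj] at h2
        rw [norm_div]
        calc ‖ξ‖ / ‖1 - ξ * conj z‖ ≤ ‖ξ‖ / (1 - ‖z‖) := by gcongr
          _ < _ := by gcongr
    _ = _ := by
        rw [Complex.volume_ball]
        rw [← ENNReal.ofReal_pow (by positivity), ← ENNReal.ofReal_coe_nnreal, ← ENNReal.ofReal_mul (by positivity)]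
        congr 1
        simp [NNReal.coe_real_pi]
        ring

theorem lintegral_inv_norm_pow_four_le {c : ℂ} {d : ℝ} (hd : 0 < d) :
    ∫⁻ w in {w : ℂ | d ≤ ‖w - c‖}, ENNReal.ofReal ((1 / ‖w - c‖ ^ 2) ^ 2) ≤ ENNReal.ofReal (π / d ^ 2) := by
  have hm : MeasurableSet {w : ℂ | d ≤ ‖w - c‖} := measurableSet_le measurable_const (by fun_prop)
  rw [← lintegral_indicator hm, ← lintegral_add_left_eq_self _ c]
  have hm' : MeasurableSet {w : ℂ | ‖w‖ ∈ Ici d} := measurable_norm measurableSet_Ici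
  have e1 : ∀ w, indicator {w : ℂ | d ≤ ‖w - c‖} (fun w => ENNReal.ofReal ((1 / ‖w - c‖ ^ 2) ^ 2)) (c + w) =
      indicator {w : ℂ | ‖w‖ ∈ Ici d} (fun w => ENNReal.ofReal ((1 / ‖w‖ ^ 2) ^ 2)) w := by
    intro w
    simp [indicator]
  simp only [e1]
  rw [lintegral_indicator hm', lintegral_polar (by fun_prop) measurableSet_Ici, inter_eq_left.2
    (show Ici d ⊆ Ioi 0 from fun x hx => hd.trans_le hx)]
  have h_eqOn : IntegrableOn (fun r : ℝ => 2 * π * r ^ (-3 : ℝ)) (Ioi d) :=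
    (integrableOn_Ioi_rpow_of_lt (by norm_num) hd).const_mul _
  calc _ ≤ ∫⁻ r in Ici d, ENNReal.ofReal (2 * π * r ^ (-3 : ℝ)) := by
        refine setLIntegral_mono' measurableSet_Ici fun r hr => ?_
        have hr0 : 0 < r := hd.trans_le hr
        simp only [norm_circleMap_zero, abs_of_pos hr0]
        rw [setLIntegral_const, Real.volume_Ioo, ← ENNReal.ofReal_mul hr0.le, ← ENNReal.ofReal_mul (by positivity)]
        apply ENNReal.ofReal_le_ofReal
        rw [show (-3:ℝ) = ((-3:ℤ):ℝ) by norm_num, Real.rpow_intCast]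
        apply le_of_eq
        rw [show (-3:ℤ) = -(3:ℕ) by norm_num, zpow_neg, zpow_natCast]
        field_simp
        ring
    _ = ENNReal.ofReal (∫ r in Ioi d, 2 * π * r ^ (-3 : ℝ)) := by
        rw [setLIntegral_congr Ioi_ae_eq_Ici.symm, ofReal_integral_eq_lintegral_ofReal h_eqOn]
        refine (ae_restrict_iff' measurableSet_Ioi).2 (Eventually.of_forall fun r hr => ?_)
        have : 0 < r := hd.trans hr
        show 0 ≤ 2 * π * r ^ (-3 : ℝ)
        positivity
    _ = _ := by
        rw [integral_const_mul, integral_Ioi_rpow_of_lt (by norm_num) hd]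
        congr 1
        rw [show (-3 + 1:ℝ) = ((-2:ℤ):ℝ) by norm_num, Real.rpow_intCast]
        rw [show (-2:ℤ) = -(2:ℕ) by norm_num, zpow_neg, zpow_natCast]
        push_cast
        field_simp

end Area

section Residue
open Set Filter Topology
open scoped ENNReal ComplexConjugate

theorem deriv_of_eq_add_mul {f k : ℂ → ℂ} {U : Set ℂ} (hU : IsOpen U) (hk : DifferentiableOn ℂ k U) {c z₀ : ℂ}
    (h : ∀ z ∈ U, f z = c + (z - z₀) * k z) : ∀ z ∈ U, deriv f z = k z + (z - z₀) * deriv k z := by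
  intro z hz
  have h1 : f =ᶠ[𝓝 z] fun z => c + (z - z₀) * k z := by
    filter_upwards [hU.mem_nhds hz] with w hw using h w hw
  rw [h1.deriv_eq]
  have hd := (hk.differentiableAt (hU.mem_nhds hz)).hasDerivAt
  have := (((hasDerivAt_id z).sub_const z₀).mul hd).const_add c
  refine HasDerivAt.deriv (this.congr_deriv ?_)
  simp

theorem circleIntegral_schwarzian {g : ℂ → ℂ} (hg : DifferentiableOn ℂ g (ball 0 1))
    (hi : InjOn g (ball 0 1)) {z₀ : ℂ} {r : ℝ} (hz : ‖z₀‖ < r) (hr : r < 1) :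
    ∮ ξ in C(0, r), 1 / ((g z₀ - g ξ) * (ξ - z₀) ^ 2) =
      2 * π * Complex.I * (schwarzian g z₀ / (6 * deriv g z₀)) := by
  set U := ball (0:ℂ) 1
  have hU : IsOpen U := isOpen_ball
  have hz₀ : z₀ ∈ U := by simp only [U, mem_ball_zero_iff]; linarith
  have hUn : U ∈ 𝓝 z₀ := hU.mem_nhds hz₀
  have h0 : ∀ z ∈ U, deriv g z ≠ 0 := fun z => deriv_ne_zero_of_injOn hU hg hi
  set k := dslope g z₀
  have hk : DifferentiableOn ℂ k U := (Complex.differentiableOn_dslope hUn).2 hg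
  have hgk : ∀ z ∈ U, g z = g z₀ + (z - z₀) * k z := fun z _ => by
    have := sub_smul_dslope g z₀ z
    rw [smul_eq_mul] at this; rw [this]; ring
  have hk0 : ∀ z ∈ U, k z ≠ 0 := by
    intro z hzU hkz
    by_cases h : z = z₀
    · rw [h] at hkz
      exact h0 z₀ hz₀ (by simpa [k] using hkz)
    · have := hgk z hzU
      rw [hkz, mul_zero, add_zero] at this
      exact h (hi hzU hz₀ this)
  set F : ℂ → ℂ := fun z => (k z)⁻¹ with hF
  have hFd : DifferentiableOn ℂ F U := hk.inv hk0
  set F1 := dslope F z₀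
  have hF1 : DifferentiableOn ℂ F1 U := (Complex.differentiableOn_dslope hUn).2 hFd
  have hFF : ∀ z ∈ U, F z = F z₀ + (z - z₀) * F1 z := fun z _ => by
    have := sub_smul_dslope F z₀ z
    rw [smul_eq_mul] at this; rw [this]; ring
  -- derivatives at the base point
  have g1 := deriv_of_eq_add_mul hU hk hgk
  have g2 := deriv_of_eq_add_mul hU ((hk.deriv hU)) (f := fun z => deriv g z - k z) (c := 0) (z₀ := z₀)
    (fun z hz => by rw [g1 z hz]; ring)
  have g2' : ∀ z ∈ U, deriv (deriv g) z = 2 * deriv k z + (z - z₀) * deriv (deriv k) z := by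
    intro z hz
    have := g2 z hz
    rw [deriv_fun_sub ((hg.deriv hU).differentiableAt (hU.mem_nhds hz)) (hk.differentiableAt (hU.mem_nhds hz))] at this
    linear_combination this
  have g3 := deriv_of_eq_add_mul hU (((hk.deriv hU)).deriv hU) (f := fun z => deriv (deriv g) z - 2 * deriv k z)
    (c := 0) (z₀ := z₀) (fun z hz => by rw [g2' z hz]; ring) z₀ hz₀
  rw [deriv_fun_sub (((hg.deriv hU).deriv hU).differentiableAt hUn)
    (((hk.deriv hU).differentiableAt hUn).const_mul 2), deriv_const_mul _ ((hk.deriv hU).differentiableAt hUn)] at g3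
  have e1 : deriv g z₀ = k z₀ := by rw [g1 z₀ hz₀]; ring
  have e2 : deriv (deriv g) z₀ = 2 * deriv k z₀ := by rw [g2' z₀ hz₀]; ring
  have e3 : deriv (deriv (deriv g)) z₀ = 3 * deriv (deriv k) z₀ := by linear_combination g3
  have F1' := deriv_of_eq_add_mul hU hF1 hFF
  have F2 := deriv_of_eq_add_mul hU ((hF1.deriv hU)) (f := fun z => deriv F z - F1 z) (c := 0) (z₀ := z₀)
    (fun z hz => by rw [F1' z hz]; ring) z₀ hz₀
  rw [deriv_fun_sub ((hFd.deriv hU).differentiableAt hUn) (hF1.differentiableAt hUn)] at F2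
  have f2 : deriv (deriv F) z₀ = 2 * deriv F1 z₀ := by linear_combination F2
  have hkd : ∀ z ∈ U, HasDerivAt k (deriv k z) z := fun z hz => (hk.differentiableAt (hU.mem_nhds hz)).hasDerivAt
  have dF : deriv F =ᶠ[𝓝 z₀] fun z => -deriv k z / k z ^ 2 := by
    filter_upwards [hUn] with z hz
    exact ((hkd z hz).inv (hk0 z hz)).deriv
  have ddF : deriv (deriv F) z₀ =
      -deriv (deriv k) z₀ / k z₀ ^ 2 + 2 * deriv k z₀ ^ 2 / k z₀ ^ 3 := by
    rw [dF.deriv_eq]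
    have := (((hk.deriv hU).differentiableAt hUn).hasDerivAt.neg).div ((hkd z₀ hz₀).pow 2)
      (pow_ne_zero 2 (hk0 z₀ hz₀))
    have h := this.deriv
    have hk00 := hk0 z₀ hz₀
    refine Eq.trans h ?_
    simp only [Pi.pow_apply, Pi.neg_apply]
    field_simp
    push_cast
    ring
  have hS : schwarzian g z₀ / (6 * deriv g z₀) = - deriv F1 z₀ := by
    have hk00 := hk0 z₀ hz₀
    have h1 := (((hg.deriv hU).deriv hU).differentiableAt hUn).hasDerivAt.div
      ((hg.deriv hU).differentiableAt hUn).hasDerivAt (h0 z₀ hz₀)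
    have h2 : deriv (preSchwarzian g) z₀ = _ := h1.deriv
    have h3 : deriv F1 z₀ = deriv (deriv F) z₀ / 2 := by rw [f2]; ring
    rw [schwarzian, h2, h3, ddF, preSchwarzian, e1, e2, e3]
    field_simp
    ring
  rw [hS]
  have hr0 : 0 < r := (norm_nonneg _).trans_lt hz
  have hcl : closedBall (0:ℂ) r ⊆ U := closedBall_subset_ball hr
  have hC := Complex.two_pi_I_inv_smul_circleIntegral_sub_sq_inv_smul_of_differentiable hU hcl hF1
    (by simpa using hz : z₀ ∈ ball (0:ℂ) r)
  have hpi : (2 * π * Complex.I : ℂ) ≠ 0 := Complex.two_pi_I_ne_zero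
  rw [← hC, smul_eq_mul, mul_neg, mul_inv_cancel_left₀ hpi]
  have hne : ∀ ξ ∈ sphere (0:ℂ) r, ξ - z₀ ≠ 0 := by
    intro ξ hξ h
    rw [mem_sphere_zero_iff_norm] at hξ
    rw [sub_eq_zero.1 h] at hξ
    linarith
  have hsc : sphere (0:ℂ) r ⊆ U := sphere_subset_closedBall.trans hcl
  have h_eqOn : ∀ ξ ∈ sphere (0:ℂ) r, 1 / ((g z₀ - g ξ) * (ξ - z₀) ^ 2) =
      (-F z₀) * (ξ - z₀) ^ (-3 : ℤ) - ((ξ - z₀) ^ 2)⁻¹ • F1 ξ := by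
    intro ξ hξ
    have hU' := hsc hξ
    have h1 := hne ξ hξ
    have h2 := hk0 ξ hU'
    have h3 := hFF ξ hU'
    have h4 : g z₀ - g ξ = -((ξ - z₀) * k ξ) := by rw [hgk ξ hU']; ring
    have h5 : F1 ξ = (F ξ - F z₀) / (ξ - z₀) := by rw [h3]; field_simp; ring
    rw [h4, h5, smul_eq_mul, show (-3:ℤ) = -(3:ℕ) by norm_num, zpow_neg, zpow_natCast]
    simp only [hF]
    have h6 := hk0 z₀ hz₀
    field_simp
    ring
  rw [circleIntegral.integral_congr hr0.le h_eqOn, circleIntegral.integral_sub, circleIntegral.integral_const_mul,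
    circleIntegral.integral_sub_zpow_of_ne (by norm_num), mul_zero, zero_sub]
  · refine ContinuousOn.circleIntegrable hr0.le ?_
    refine continuousOn_const.mul ?_
    exact (continuousOn_id.sub continuousOn_const).zpow₀ _ fun ξ hξ => Or.inl (hne ξ hξ)
  · refine ContinuousOn.circleIntegrable hr0.le ?_
    refine ContinuousOn.smul (ContinuousOn.inv₀ (by fun_prop) fun ξ hξ => pow_ne_zero 2 (hne ξ hξ)) ?_
    exact hF1.continuousOn.mono hsc

end Residue

section Green
open Set Filter Topology
open scoped ENNReal ComplexConjugate

/-- The coefficient of `dz` of a real-linear map `ℂ → ℂ`. -/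
noncomputable def dz (L : ℂ →L[ℝ] ℂ) : ℂ := (L 1 - Complex.I * L Complex.I) / 2

theorem real_linear_apply (L : ℂ →L[ℝ] ℂ) (v : ℂ) : L v = v.re * L 1 + v.im * L Complex.I := by
  have h : v = v.re • (1 : ℂ) + v.im • Complex.I := by
    apply Complex.ext <;> simp
  conv_lhs => rw [h]
  rw [map_add, map_smul, map_smul]
  simp

theorem sub_I_mul_eq_dz (L : ℂ →L[ℝ] ℂ) (e : ℂ) :
    L e - Complex.I * L (Complex.I * e) = 2 * dz L * e := by
  rw [real_linear_apply L e, real_linear_apply L (Complex.I * e), dz]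
  conv_rhs => rw [← Complex.re_add_im e]
  simp only [Complex.mul_re, Complex.I_re, Complex.I_im, Complex.mul_im]
  push_cast
  linear_combination (L Complex.I * e.im)* Complex.I_sq

theorem dz_wirtinger (α β : ℂ) : dz (wirtinger α β) = α := by
  rw [dz, wirtinger_apply, wirtinger_apply]
  simp only [map_one, Complex.conj_I]
  linear_combination (β - α) / 2 * Complex.I_sq

theorem continuous_dz : Continuous dz := by
  unfold dz; fun_prop

theorem hasFDerivAt_circleMap (r θ : ℝ) :
    ∃ L : ℝ × ℝ →L[ℝ] ℂ, HasFDerivAt (fun p : ℝ × ℝ => circleMap 0 p.1 p.2) L (r, θ) ∧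
      L (1, 0) = circleMap 0 1 θ ∧ L (0, 1) = r * (Complex.I * circleMap 0 1 θ) := by
  have hf : HasFDerivAt (fun p : ℝ × ℝ => ((p.1 : ℝ) : ℂ)) (Complex.ofRealCLM.comp (ContinuousLinearMap.fst ℝ ℝ ℝ)) (r, θ) :=
    (Complex.ofRealCLM.comp (ContinuousLinearMap.fst ℝ ℝ ℝ)).hasFDerivAt
  have hs : HasFDerivAt (fun p : ℝ × ℝ => ((p.2 : ℝ) : ℂ)) (Complex.ofRealCLM.comp (ContinuousLinearMap.snd ℝ ℝ ℝ)) (r, θ) :=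
    (Complex.ofRealCLM.comp (ContinuousLinearMap.snd ℝ ℝ ℝ)).hasFDerivAt
  have he := (hs.mul_const Complex.I).cexp
  have h := hf.mul he
  refine ⟨_, h.congr_of_eventuallyEq (Eventually.of_forall fun p => ?_), ?_, ?_⟩
  · simp [circleMap]
  · simp [circleMap]
  · simp [circleMap, mul_comm]

theorem norm_circleMap_one (θ : ℝ) : ‖circleMap 0 1 θ‖ = 1 := by simp [circleMap]

theorem circle_green {V : ℂ → ℂ} {R r₁ r₂ : ℝ} (hV : ∀ z ∈ collar R, DifferentiableAt ℝ V z)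
    (hc : ContinuousOn (fderiv ℝ V) (collar R)) (h1 : R < r₁) (h0 : 0 < r₁) (h12 : r₁ ≤ r₂) (h2 : r₂ < 1) :
    ∫ r in r₁..r₂, ∫ θ in (-π)..π, 2 * dz (fderiv ℝ V (circleMap 0 r θ)) * circleMap 0 1 θ =
      (∫ θ in (-π)..π, V (circleMap 0 r₂ θ)) - ∫ θ in (-π)..π, V (circleMap 0 r₁ θ) := by
  choose L hL hL1 hL2 using hasFDerivAt_circleMap
  have hmem : ∀ p ∈ (uIcc r₁ r₂) ×ˢ (uIcc (-π) π), circleMap 0 p.1 p.2 ∈ collar R := by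
    rintro ⟨r, θ⟩ ⟨hr, -⟩
    rw [uIcc_of_le h12] at hr
    have : ‖circleMap 0 r θ‖ = r := by simp [abs_of_pos (h0.trans_le hr.1)]
    exact ⟨by rw [this]; exact h1.trans_le hr.1, by rw [this]; exact hr.2.trans_lt h2⟩
  have hcm : Continuous fun p : ℝ × ℝ => circleMap 0 p.1 p.2 := by
    unfold circleMap; fun_prop
  have hVc : ContinuousOn V (collar R) := fun z hz => (hV z hz).continuousAt.continuousWithinAt
  have hsub : ∀ x ∈ Ioo (min r₁ r₂) (max r₁ r₂) ×ˢ Ioo (min (-π) π) (max (-π) π), x ∈ (uIcc r₁ r₂) ×ˢ (uIcc (-π) π) := by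
    rintro x ⟨hx, hx'⟩
    exact ⟨Ioo_subset_Icc_self hx, Ioo_subset_Icc_self hx'⟩
  have hpos : ∀ x ∈ (uIcc r₁ r₂) ×ˢ (uIcc (-π) π), 0 < x.1 := by
    rintro x ⟨hx, -⟩
    rw [uIcc_of_le h12] at hx
    exact h0.trans_le hx.1
  have hfd : ∀ x ∈ (uIcc r₁ r₂) ×ˢ (uIcc (-π) π), HasFDerivAt (fun p : ℝ × ℝ => V (circleMap 0 p.1 p.2))
      ((fderiv ℝ V (circleMap 0 x.1 x.2)).comp (L x.1 x.2)) x := fun x hx =>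
    (hV _ (hmem x hx)).hasFDerivAt.comp x (hL x.1 x.2)
  have hinv : ∀ x ∈ (uIcc r₁ r₂) ×ˢ (uIcc (-π) π), HasFDerivAt (fun p : ℝ × ℝ => -Complex.I * (((p.1)⁻¹ : ℝ) : ℂ))
      ((-Complex.I) • Complex.ofRealCLM.comp ((-(x.1 ^ 2)⁻¹) • (ContinuousLinearMap.fst ℝ ℝ ℝ))) x := fun x hx => by
    have h := (hasDerivAt_inv (hpos x hx).ne').comp_hasFDerivAt x (ContinuousLinearMap.fst ℝ ℝ ℝ).hasFDerivAt
    exact (Complex.ofRealCLM.hasFDerivAt.comp x h).const_mul (-Complex.I)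
  have hcont1 : ContinuousOn (fun p : ℝ × ℝ => V (circleMap 0 p.1 p.2)) ((uIcc r₁ r₂) ×ˢ (uIcc (-π) π)) :=
    fun x hx => (hfd x hx).continuousAt.continuousWithinAt
  have hgd : ∀ x ∈ (uIcc r₁ r₂) ×ˢ (uIcc (-π) π), HasFDerivAt (fun p : ℝ × ℝ => -Complex.I * (((p.1)⁻¹ : ℝ) : ℂ) * V (circleMap 0 p.1 p.2))
      _ x := fun x hx => (hinv x hx).mul (hfd x hx)
  have hcont2 : ContinuousOn (fun p : ℝ × ℝ => -Complex.I * (((p.1)⁻¹ : ℝ) : ℂ) * V (circleMap 0 p.1 p.2)) ((uIcc r₁ r₂) ×ˢ (uIcc (-π) π)) :=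
    fun x hx => (hgd x hx).continuousAt.continuousWithinAt
  have hval : ∀ x ∈ (uIcc r₁ r₂) ×ˢ (uIcc (-π) π),
      ((fderiv ℝ V (circleMap 0 x.1 x.2)).comp (L x.1 x.2)) (1, 0) +
      ((-Complex.I * (((x.1)⁻¹ : ℝ) : ℂ)) • ((fderiv ℝ V (circleMap 0 x.1 x.2)).comp (L x.1 x.2)) +
        (V (circleMap 0 x.1 x.2)) • ((-Complex.I) • Complex.ofRealCLM.comp ((-(x.1 ^ 2)⁻¹) • (ContinuousLinearMap.fst ℝ ℝ ℝ)))) (0, 1) =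
      2 * dz (fderiv ℝ V (circleMap 0 x.1 x.2)) * circleMap 0 1 x.2 := by
    intro x hx
    have hx0 : (x.1 : ℂ) ≠ 0 := by exact_mod_cast (hpos x hx).ne'
    rw [← sub_I_mul_eq_dz]
    simp only [ContinuousLinearMap.comp_apply, _root_.add_apply, _root_.smul_apply, hL1, hL2,
      ContinuousLinearMap.coe_fst', smul_eq_mul, mul_zero, map_zero, add_zero]
    have : fderiv ℝ V (circleMap 0 x.1 x.2) (x.1 * (Complex.I * circleMap 0 1 x.2)) =
        x.1 * fderiv ℝ V (circleMap 0 x.1 x.2) (Complex.I * circleMap 0 1 x.2) := by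
      rw [← Complex.real_smul, map_smul, Complex.real_smul]
    rw [this]
    push_cast
    field_simp
    ring
  have hInt : IntegrableOn (fun x : ℝ × ℝ => 2 * dz (fderiv ℝ V (circleMap 0 x.1 x.2)) * circleMap 0 1 x.2) ((uIcc r₁ r₂) ×ˢ (uIcc (-π) π)) := by
    refine ContinuousOn.integrableOn_compact (isCompact_uIcc.prod isCompact_uIcc) ?_
    refine ContinuousOn.mul (continuousOn_const.mul ?_) ?_
    · exact continuous_dz.comp_continuousOn (hc.comp hcm.continuousOn hmem)
    · exact ((continuous_circleMap 0 1).comp continuous_snd).continuousOn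
  have key := integral2_divergence_prod_of_hasFDerivAt _ _ _ _ r₁ (-π) r₂ π hcont1 hcont2
    (fun x hx => hfd x (hsub x hx)) (fun x hx => hgd x (hsub x hx))
    (hInt.congr_fun (fun x hx => (hval x hx).symm) (measurableSet_uIcc.prod measurableSet_uIcc))
  have hper : ∀ r : ℝ, circleMap 0 r (-π) = circleMap 0 r π := fun r => by
    have := periodic_circleMap 0 r (-π)
    rw [← this]; congr 1; ring
  simp only [hper, sub_self, zero_add] at key
  rw [← key]
  refine intervalIntegral.integral_congr fun r hr => ?_
  refine intervalIntegral.integral_congr fun θ hθ => ?_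
  exact (hval (r, θ) ⟨hr, hθ⟩).symm

theorem norm_circle_integral_le {V : ℂ → ℂ} {R r₁ r₂ : ℝ} (hV : ∀ z ∈ collar R, DifferentiableAt ℝ V z)
    (hc : ContinuousOn (fderiv ℝ V) (collar R)) (h1 : R < r₁) (h0 : 0 < r₁) (h12 : r₁ ≤ r₂) (h2 : r₂ < 1) :
    ENNReal.ofReal ‖∫ θ in (-π)..π, V (circleMap 0 r₂ θ)‖ ≤
      ENNReal.ofReal ‖∫ θ in (-π)..π, V (circleMap 0 r₁ θ)‖ +
        ∫⁻ z in collar r₁, ENNReal.ofReal (2 * ‖dz (fderiv ℝ V z)‖ / ‖z‖) := by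
  have hg := circle_green hV hc h1 h0 h12 h2
  have hm : Measurable fun z => ENNReal.ofReal (2 * ‖dz (fderiv ℝ V z)‖ / ‖z‖) := by
    have h1 := measurable_fderiv ℝ V
    have h2 := continuous_dz.measurable.comp h1
    exact (((h2.norm.const_mul 2).div measurable_norm)).ennreal_ofReal
  have heq : (∫ θ in (-π)..π, V (circleMap 0 r₂ θ)) = (∫ θ in (-π)..π, V (circleMap 0 r₁ θ)) +
    ∫ r in r₁..r₂, ∫ θ in (-π)..π, 2 * dz (fderiv ℝ V (circleMap 0 r θ)) * circleMap 0 1 θ := by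
    rw [hg]; ring
  have hpi : -π ≤ π := by linarith [pi_pos]
  rw [heq]
  simp only [ofReal_norm]
  refine (enorm_add_le _ _).trans (add_le_add le_rfl ?_)
  have hcol : collar r₁ = {z : ℂ | ‖z‖ ∈ Ioo r₁ 1} := rfl
  rw [hcol, lintegral_polar hm measurableSet_Ioo]
  rw [intervalIntegral.integral_of_le h12]
  refine (enorm_integral_le_lintegral_enorm _).trans ?_
  have hss : Ioc r₁ r₂ ⊆ Ioo r₁ 1 ∩ Ioi 0 := fun r hr => ⟨⟨hr.1, hr.2.trans_lt h2⟩, h0.trans hr.1⟩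
  refine le_trans ?_ (lintegral_mono_set hss)
  refine setLIntegral_mono' measurableSet_Ioc fun r hr => ?_
  have hr0 : 0 < r := h0.trans hr.1
  rw [intervalIntegral.integral_of_le hpi]
  refine (enorm_integral_le_lintegral_enorm _).trans ?_
  rw [setLIntegral_congr (Ioo_ae_eq_Ioc (α := ℝ) (μ := volume)).symm]
  refine le_of_eq (lintegral_congr fun θ => ?_)
  rw [← ofReal_norm, ← ENNReal.ofReal_mul hr0.le]
  congr 1
  rw [norm_mul, norm_mul, norm_circleMap_one]
  simp [abs_of_pos hr0]
  field_simp

end Green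

section SchwarzianFormula
open Set Filter Topology
open scoped ENNReal ComplexConjugate

theorem dz_fderiv_mul_conj {h k : ℂ → ℂ} {w z : ℂ} (hh : DifferentiableAt ℝ h z) (hw : w - h z ≠ 0)
    (hk : DifferentiableAt ℂ k (conj z)) :
    dz (fderiv ℝ (fun z => (w - h z)⁻¹ * k (conj z)) z) =
      k (conj z) * (dz (fderiv ℝ h z) / (w - h z) ^ 2) := by
  have h1 : HasFDerivAt (fun z => (w - h z)⁻¹) ((((w - h z) ^ 2)⁻¹ : ℂ) • fderiv ℝ h z) z := by
    have := ((hasFDerivAt_wirtinger (hasDerivAt_inv hw)).comp z (hh.hasFDerivAt.const_sub w))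
    refine this.congr_fderiv ?_
    ext v
    simp [wirtinger_apply]
  have h2 : HasFDerivAt (fun z => k (conj z)) (wirtinger 0 (deriv k (conj z))) z := by
    have := ((hasFDerivAt_wirtinger hk.hasDerivAt).comp z (Complex.conjCLE : ℂ →L[ℝ] ℂ).hasFDerivAt)
    refine this.congr_fderiv ?_
    ext v
    simp [wirtinger_apply]
  have h3 := h1.mul h2
  have h4 : fderiv ℝ (fun z => (w - h z)⁻¹ * k (conj z)) z = _ := h3.fderiv
  rw [h4]
  have e := dz_wirtinger 0 (deriv k (conj z))
  rw [dz] at e ⊢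
  simp only [_root_.add_apply, _root_.smul_apply, smul_eq_mul]
  rw [dz]
  linear_combination (w - h z)⁻¹ * e

theorem circle_integral_limit_formula {g : ℂ → ℂ} (hg : DifferentiableOn ℂ g (ball 0 1))
    (hi : InjOn g (ball 0 1)) {z₀ : ℂ} {r : ℝ} (hz : ‖z₀‖ < r) (hr : r < 1) :
    ‖∫ θ in (-π)..π, (g z₀ - g (circleMap 0 r θ))⁻¹ *
      ((circleMap 0 r θ)⁻¹ / (1 - (circleMap 0 r θ)⁻¹ * z₀) ^ 2)‖ =
      π / 3 * (‖schwarzian g z₀‖ / ‖deriv g z₀‖) := by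
  have h := circleIntegral_schwarzian hg hi hz hr
  rw [circleIntegral] at h
  have hr0 : 0 < r := (norm_nonneg _).trans_lt hz
  set Φ : ℂ → ℂ := fun ξ => (g z₀ - g ξ)⁻¹ * (ξ⁻¹ / (1 - ξ⁻¹ * z₀) ^ 2)
  have e : ∀ θ, deriv (circleMap 0 r) θ • (1 / ((g z₀ - g (circleMap 0 r θ)) * (circleMap 0 r θ - z₀) ^ 2)) =
      Complex.I * Φ (circleMap 0 r θ) := by
    intro θ
    have hne : circleMap 0 r θ ≠ 0 := by simp [hr0.ne']
    rw [deriv_circleMap]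
    simp only [Φ, smul_eq_mul]
    generalize circleMap 0 r θ = ξ at *
    have : ξ⁻¹ / (1 - ξ⁻¹ * z₀) ^ 2 = ξ / (ξ - z₀) ^ 2 := by
      have : 1 - ξ⁻¹ * z₀ = (ξ - z₀) / ξ := by field_simp
      rw [this, div_pow]
      by_cases h : ξ - z₀ = 0
      · simp [h]
      field_simp
    rw [this, one_div, mul_inv]
    ring
  simp only [e] at h
  rw [intervalIntegral.integral_const_mul] at h
  have hper : Function.Periodic (fun θ => Φ (circleMap 0 r θ)) (2 * π) := fun θ => by
    simp only [periodic_circleMap 0 r θ]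
  have hsh := hper.intervalIntegral_add_eq (-π) 0
  rw [show -π + 2 * π = π by ring, zero_add] at hsh
  rw [show (∫ θ in (-π)..π, (g z₀ - g (circleMap 0 r θ))⁻¹ *
      ((circleMap 0 r θ)⁻¹ / (1 - (circleMap 0 r θ)⁻¹ * z₀) ^ 2)) = ∫ θ in (-π)..π, Φ (circleMap 0 r θ) from rfl, hsh]
  have h5 := congrArg norm h
  rw [norm_mul, Complex.norm_I, one_mul] at h5
  rw [h5]
  simp [abs_of_pos pi_pos]
  by_cases hd : ‖deriv g z₀‖ = 0
  · simp [hd]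
  field_simp
  ring

theorem schwarzian_le {g h : ℂ → ℂ} {R ρ : ℝ} (hg : DifferentiableOn ℂ g (ball 0 1))
    (hi : InjOn g (ball 0 1)) (hh : ContDiffOn ℝ 1 h (collar R)) (hdis : ∀ ξ ∈ collar R, h ξ ∉ g '' ball 0 1)
    (hlim : ∀ ε > 0, ∃ b < 1, ∀ ξ ∈ collar b, ‖h ξ - g ξ‖ ≤ ε) (hRρ : R < ρ) (h0 : 0 < ρ) (h1 : ρ < 1)
    {z₀ : ℂ} (hz : ‖z₀‖ < 1) :
    ENNReal.ofReal (π / 3 * (‖schwarzian g z₀‖ / ‖deriv g z₀‖)) ≤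
      ENNReal.ofReal ‖∫ θ in (-π)..π, (g z₀ - h (circleMap 0 ρ θ))⁻¹ *
        (conj (circleMap 0 ρ θ) / (1 - conj (circleMap 0 ρ θ) * z₀) ^ 2)‖ +
      ∫⁻ ξ in collar ρ, ENNReal.ofReal
        (2 * ‖dz (fderiv ℝ h ξ)‖ / ‖g z₀ - h ξ‖ ^ 2 / ‖1 - conj ξ * z₀‖ ^ 2) := by
  set k : ℂ → ℂ := fun η => η / (1 - η * z₀) ^ 2 with hk
  set w := g z₀ with hw
  have hz₀ : z₀ ∈ ball (0 : ℂ) 1 := by simpa using hz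
  have hopen : IsOpen (collar R) := isOpen_collar R
  have hhd : ∀ z ∈ collar R, DifferentiableAt ℝ h z := fun z hz =>
    (hh.differentiableOn one_ne_zero).differentiableAt (hopen.mem_nhds hz)
  have hne : ∀ z ∈ collar R, w - h z ≠ 0 := fun z hz e =>
    hdis z hz ⟨z₀, hz₀, by rw [← hw]; exact sub_eq_zero.1 e⟩
  have hkd : ∀ η : ℂ, ‖η‖ < 1 → DifferentiableAt ℂ k η := fun η hη => by
    have : 1 - η * z₀ ≠ 0 := one_sub_conj_mul_ne_zero hz hη.le
    refine DifferentiableAt.div (by fun_prop) (by fun_prop) (pow_ne_zero 2 this)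
  set V : ℂ → ℂ := fun z => (w - h z)⁻¹ * k (conj z) with hV
  have hVs : ContDiffOn ℝ 1 V (collar R) := by
    refine ContDiffOn.mul (ContDiffOn.inv (contDiffOn_const.sub hh) hne) ?_
    have hc : ContDiffOn ℝ 1 (fun z : ℂ => conj z) (collar R) := (Complex.conjCLE : ℂ →L[ℝ] ℂ).contDiff.contDiffOn
    simp only [hk, div_eq_mul_inv]
    refine hc.mul (((contDiffOn_const.sub (hc.mul contDiffOn_const)).pow 2).inv fun z hz' => ?_)
    exact pow_ne_zero 2 (one_sub_conj_mul_ne_zero hz (by rw [RCLike.norm_conj]; exact hz'.2.le))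
  have hVd : ∀ z ∈ collar R, DifferentiableAt ℝ V z := fun z hz =>
    (hVs.differentiableOn one_ne_zero).differentiableAt (hopen.mem_nhds hz)
  have hVc : ContinuousOn (fderiv ℝ V) (collar R) := hVs.continuousOn_fderiv_of_isOpen hopen le_rfl
  have hbound : ∀ r ∈ Ioo ρ 1, ENNReal.ofReal ‖∫ θ in (-π)..π, V (circleMap 0 r θ)‖ ≤
      ENNReal.ofReal ‖∫ θ in (-π)..π, V (circleMap 0 ρ θ)‖ + ∫⁻ ξ in collar ρ, ENNReal.ofReal
        (2 * ‖dz (fderiv ℝ h ξ)‖ / ‖w - h ξ‖ ^ 2 / ‖1 - conj ξ * z₀‖ ^ 2) := by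
    intro r hr
    refine (norm_circle_integral_le hVd hVc hRρ h0 hr.1.le hr.2).trans (add_le_add le_rfl ?_)
    refine setLIntegral_mono' (isOpen_collar ρ).measurableSet fun ξ hξ => ENNReal.ofReal_le_ofReal ?_
    have hξR : ξ ∈ collar R := collar_subset hRρ.le hξ
    have hξ0 : 0 < ‖ξ‖ := h0.trans hξ.1
    rw [dz_fderiv_mul_conj (hhd ξ hξR) (hne ξ hξR) (hkd _ (by rw [RCLike.norm_conj]; exact hξ.2))]
    simp only [hk, norm_mul, norm_div, norm_pow, RCLike.norm_conj]
    refine le_of_eq ?_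
    field_simp
  -- lower bound for the denominators
  obtain ⟨δ, hδ, hδb⟩ : ∃ δ > 0, ball w δ ⊆ g '' ball z₀ ((1 - ‖z₀‖) / 2) := by
    have hsub : ball z₀ ((1 - ‖z₀‖) / 2) ⊆ ball 0 1 := ball_subset_ball' (by rw [dist_zero_right]; linarith)
    have ho := isOpen_image_of_injOn isOpen_ball (hg.mono hsub) (hi.mono hsub)
    exact Metric.isOpen_iff.1 ho w ⟨z₀, mem_ball_self (by linarith), rfl⟩
  set s := max ρ ((1 + ‖z₀‖) / 2) with hs
  have hs1 : s < 1 := max_lt h1 (by linarith)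
  have hzs : ‖z₀‖ < s := lt_of_lt_of_le (by linarith) (le_max_right _ _)
  have hgδ : ∀ ξ ∈ collar s, δ ≤ ‖w - g ξ‖ := by
    intro ξ hξ
    by_contra! hlt
    obtain ⟨y, hy, hgy⟩ := hδb (show g ξ ∈ ball w δ by rwa [mem_ball', dist_eq_norm])
    have hyb : y ∈ ball (0:ℂ) 1 := ball_subset_ball' (by rw [dist_zero_right]; linarith) hy
    have := hi hyb (by simpa using hξ.2) hgy
    subst this
    have h3 : ‖y‖ ≤ ‖z₀‖ + dist y z₀ := by
      rw [dist_eq_norm]; simpa using norm_add_le z₀ (y - z₀)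
    have h4 : (1 + ‖z₀‖) / 2 < ‖y‖ := (le_max_right _ _).trans_lt hξ.1
    rw [mem_ball] at hy
    linarith
  have hhδ : ∀ ξ ∈ collar s, δ ≤ ‖w - h ξ‖ := by
    intro ξ hξ
    by_contra! hlt
    have := hδb (show h ξ ∈ ball w δ by rwa [mem_ball', dist_eq_norm])
    refine hdis ξ (collar_subset (hRρ.le.trans (le_max_left _ _)) hξ) (image_mono ?_ this)
    exact ball_subset_ball' (by rw [dist_zero_right]; linarith)
  have hcirc : ∀ r ∈ Ioo s 1, ∀ θ, circleMap 0 r θ ∈ collar s := fun r hr θ => by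
    have : ‖circleMap 0 r θ‖ = r := by simp [abs_of_pos (((norm_nonneg _).trans_lt hzs).trans hr.1)]
    exact ⟨by rw [this]; exact hr.1, by rw [this]; exact hr.2⟩
  set N : ℂ → ℂ := fun ξ => (w - g ξ)⁻¹ * k ξ⁻¹ with hN
  set κ := (1 - ‖z₀‖ / s) with hκ
  have hs0 : 0 < s := (norm_nonneg _).trans_lt hzs
  have hκ0 : 0 < κ := by
    rw [hκ, sub_pos, div_lt_one hs0]; exact hzs
  have hkb : ∀ η : ℂ, ‖η‖ ≤ 1 / s → ‖k η‖ ≤ 1 / s / κ ^ 2 := by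
    intro η hη
    have : κ ≤ ‖1 - η * z₀‖ := by
      have h3 : ‖η * z₀‖ ≤ ‖z₀‖ / s := by
        rw [norm_mul, div_eq_inv_mul, ← one_div]
        exact mul_le_mul_of_nonneg_right hη (norm_nonneg _)
      have h4 := norm_sub_norm_le (1:ℂ) (η * z₀)
      rw [norm_one] at h4
      linarith
    simp only [hk, norm_div, norm_pow]
    gcongr
  have hinv : ∀ ξ ∈ collar s, ‖ξ⁻¹‖ ≤ 1 / s := fun ξ hξ => by
    rw [norm_inv, ← one_div]; exact one_div_le_one_div_of_le hs0 hξ.1.le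
  have hconj : ∀ ξ ∈ collar s, ‖conj ξ‖ ≤ 1 / s := fun ξ hξ => by
    rw [RCLike.norm_conj]; exact hξ.2.le.trans (by rw [le_div_iff₀ hs0]; linarith)
  have hgb : ∀ ξ ∈ collar s, ‖(w - g ξ)⁻¹‖ ≤ 1 / δ := fun ξ hξ => by
    rw [norm_inv, ← one_div]; exact one_div_le_one_div_of_le hδ (hgδ ξ hξ)
  have hhb : ∀ ξ ∈ collar s, ‖(w - h ξ)⁻¹‖ ≤ 1 / δ := fun ξ hξ => by
    rw [norm_inv, ← one_div]; exact one_div_le_one_div_of_le hδ (hhδ ξ hξ)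
  have hsR : collar s ⊆ collar R := collar_subset (hRρ.le.trans (le_max_left _ _))
  have hVcont : ContinuousOn V (collar s) := hVs.continuousOn.mono hsR
  have hNcont : ContinuousOn N (collar s) := by
    have hgc : ContinuousOn g (collar s) := hg.continuousOn.mono fun ξ hξ => by simpa using hξ.2
    have hic : ContinuousOn (fun ξ : ℂ => ξ⁻¹) (collar s) := continuousOn_id.inv₀ fun ξ hξ h => by
      have := hξ.1; simp only [id] at h; rw [h, norm_zero] at this; linarith
    refine ContinuousOn.mul (ContinuousOn.inv₀ (continuousOn_const.sub hgc) fun ξ hξ h => ?_) ?_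
    · have := hgδ ξ hξ; rw [h, norm_zero] at this; linarith
    · refine ContinuousOn.div hic ((continuousOn_const.sub (hic.mul continuousOn_const)).pow 2) fun ξ hξ => ?_
      refine pow_ne_zero 2 fun h => ?_
      have h3 : ξ⁻¹ * z₀ = 1 := (sub_eq_zero.1 h).symm
      have h4 := congrArg norm h3
      rw [norm_mul, norm_one] at h4
      have h5 := mul_le_mul_of_nonneg_right (hinv ξ hξ) (norm_nonneg z₀)
      rw [h4, one_div_mul_eq_div, le_div_iff₀ hs0] at h5
      linarith
  have hev : ∀ᶠ r in 𝓝[<] (1:ℝ), r ∈ Ioo s 1 := Ioo_mem_nhdsLT hs1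
  have hnorm : ∀ ξ ∈ collar s, ‖V ξ - N ξ‖ ≤ 1 / δ * ‖k (conj ξ) - k ξ⁻¹‖ +
      ‖h ξ - g ξ‖ / δ ^ 2 * (1 / s / κ ^ 2) := by
    intro ξ hξ
    have e1 : V ξ - N ξ = (w - h ξ)⁻¹ * (k (conj ξ) - k ξ⁻¹) + ((w - h ξ)⁻¹ - (w - g ξ)⁻¹) * k ξ⁻¹ := by
      simp only [hV, hN]; ring
    rw [e1]
    refine (norm_add_le _ _).trans (add_le_add ?_ ?_)
    · rw [norm_mul]; exact mul_le_mul_of_nonneg_right (hhb ξ hξ) (norm_nonneg _)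
    · rw [norm_mul]
      refine mul_le_mul ?_ (hkb _ (hinv ξ hξ)) (norm_nonneg _) (by positivity)
      have n1 : w - h ξ ≠ 0 := hne ξ (hsR hξ)
      have n2 : w - g ξ ≠ 0 := fun h => by have := hgδ ξ hξ; rw [h, norm_zero] at this; linarith
      have : (w - h ξ)⁻¹ - (w - g ξ)⁻¹ = (h ξ - g ξ) / ((w - h ξ) * (w - g ξ)) := by
        field_simp; ring
      rw [this, norm_div, norm_mul, sq]
      have := hhδ ξ hξ
      have := hgδ ξ hξ
      gcongr
  have hlim0 : Tendsto (fun r => ∫ θ in (-π)..π, (V (circleMap 0 r θ) - N (circleMap 0 r θ))) (𝓝[<] 1) (𝓝 0) := by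
    have hz0 : ∫ θ in (-π)..π, (fun _ => (0 : ℂ)) θ = 0 := by simp
    refine le_trans (b := 𝓝 (∫ θ in (-π)..π, (fun _ => (0 : ℂ)) θ)) ?_ (le_of_eq (congrArg 𝓝 hz0))
    refine intervalIntegral.tendsto_integral_filter_of_dominated_convergence
      (fun _ => 2 * (1 / δ * (1 / s / κ ^ 2))) ?_ ?_ ?_ ?_
    · filter_upwards [hev] with r hr
      refine Continuous.aestronglyMeasurable ?_
      exact (hVcont.sub hNcont).comp_continuous (continuous_circleMap 0 r) (hcirc r hr)
    · filter_upwards [hev] with r hr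
      refine Eventually.of_forall fun θ _ => ?_
      have hξ := hcirc r hr θ
      refine (norm_sub_le _ _).trans ?_
      rw [two_mul]
      simp only [hV, hN, norm_mul]
      refine add_le_add (mul_le_mul (hhb _ hξ) (hkb _ (hconj _ hξ)) (norm_nonneg _) (by positivity))
        (mul_le_mul (hgb _ hξ) (hkb _ (hinv _ hξ)) (norm_nonneg _) (by positivity))
    · exact intervalIntegrable_const
    · refine Eventually.of_forall fun θ _ => ?_
      have hξ1 : Tendsto (fun r => circleMap 0 r θ) (𝓝[<] 1) (𝓝 (circleMap 0 1 θ)) := by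
        have : Continuous fun r => circleMap 0 r θ := by unfold circleMap; fun_prop
        exact (this.tendsto 1).mono_left nhdsWithin_le_nhds
      have hu : ‖circleMap 0 1 θ‖ = 1 := norm_circleMap_one θ
      have hu0 : circleMap 0 1 θ ≠ 0 := by intro h; rw [h, norm_zero] at hu; linarith
      have hinveq : (circleMap 0 1 θ)⁻¹ = conj (circleMap 0 1 θ) := by
        rw [Complex.inv_def, Complex.normSq_eq_norm_sq, hu]; simp
      have hkc : ContinuousAt k (conj (circleMap 0 1 θ)) := by
        refine ContinuousAt.div (by fun_prop) (by fun_prop) (pow_ne_zero 2 ?_)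
        exact one_sub_conj_mul_ne_zero hz (by rw [RCLike.norm_conj, hu])
      have t1 : Tendsto (fun r => k (conj (circleMap 0 r θ)) - k (circleMap 0 r θ)⁻¹) (𝓝[<] 1) (𝓝 0) := by
        have a1 := hkc.tendsto.comp ((Complex.continuous_conj.tendsto _).comp hξ1)
        have a2 : Tendsto (fun r => k (circleMap 0 r θ)⁻¹) (𝓝[<] 1) (𝓝 (k (conj (circleMap 0 1 θ)))) := by
          refine hkc.tendsto.comp ?_
          rw [← hinveq]
          exact hξ1.inv₀ hu0
        have := a1.sub a2
        rwa [sub_self] at this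
      have t2 : Tendsto (fun r => ‖h (circleMap 0 r θ) - g (circleMap 0 r θ)‖) (𝓝[<] 1) (𝓝 0) := by
        rw [Metric.tendsto_nhds]
        intro ε hε
        obtain ⟨b, hb, hbb⟩ := hlim (ε / 2) (half_pos hε)
        have hm : max b s < 1 := max_lt hb hs1
        filter_upwards [Ioo_mem_nhdsLT hm] with r hr
        have hξ := hcirc r ⟨(le_max_right _ _).trans_lt hr.1, hr.2⟩ θ
        have hn : ‖circleMap 0 r θ‖ = r := by simp [abs_of_pos (hs0.trans ((le_max_right _ _).trans_lt hr.1))]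
        have := hbb (circleMap 0 r θ) ⟨by rw [hn]; exact (le_max_left _ _).trans_lt hr.1, hξ.2⟩
        rw [Real.dist_eq, sub_zero, abs_of_nonneg (norm_nonneg _)]
        linarith
      rw [tendsto_zero_iff_norm_tendsto_zero]
      have t3 := (t1.norm.const_mul (1 / δ)).add ((t2.div_const (δ ^ 2)).mul_const (1 / s / κ ^ 2))
      simp only [norm_zero, mul_zero, zero_div, zero_mul, add_zero] at t3
      refine squeeze_zero' (Eventually.of_forall fun r => norm_nonneg _) ?_ t3
      filter_upwards [hev] with r hr using hnorm _ (hcirc r hr θ)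
  have hlimn : Tendsto (fun r => ‖∫ θ in (-π)..π, V (circleMap 0 r θ)‖) (𝓝[<] 1)
      (𝓝 (π / 3 * (‖schwarzian g z₀‖ / ‖deriv g z₀‖))) := by
    have hNn : ∀ r ∈ Ioo s 1, ‖∫ θ in (-π)..π, N (circleMap 0 r θ)‖ = π / 3 * (‖schwarzian g z₀‖ / ‖deriv g z₀‖) :=
      fun r hr => circle_integral_limit_formula hg hi (hzs.trans hr.1) hr.2
    rw [tendsto_iff_norm_sub_tendsto_zero]
    refine squeeze_zero' (Eventually.of_forall fun r => norm_nonneg _) ?_ (by simpa using hlim0.norm)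
    filter_upwards [hev] with r hr
    rw [← hNn r hr, intervalIntegral.integral_sub]
    · exact abs_norm_sub_norm_le _ _
    · exact (hVcont.comp_continuous (continuous_circleMap 0 r) (hcirc r hr)).intervalIntegrable _ _
    · exact (hNcont.comp_continuous (continuous_circleMap 0 r) (hcirc r hr)).intervalIntegrable _ _
  refine le_of_tendsto ((ENNReal.continuous_ofReal.tendsto _).comp hlimn) ?_
  filter_upwards [Ioo_mem_nhdsLT h1] with r hr using hbound r hr

end SchwarzianFormula

section SchwarzianIntegral
open Set Filter Topology
open scoped ENNReal ComplexConjugate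

theorem lintegral_mul_sq_le {α : Type*} [MeasurableSpace α] {μ : Measure α} {f g : α → ℝ≥0∞}
    (hf : AEMeasurable f μ) (hg : AEMeasurable g μ) :
    (∫⁻ x, f x * g x ∂μ) ^ 2 ≤ (∫⁻ x, f x ^ 2 ∂μ) * ∫⁻ x, g x ^ 2 ∂μ := by
  have h := ENNReal.lintegral_mul_le_Lp_mul_Lq μ Real.HolderConjugate.two_two hf hg
  have h2 := pow_le_pow_left' h 2
  refine h2.trans (le_of_eq ?_)
  rw [mul_pow, ← ENNReal.rpow_natCast, ← ENNReal.rpow_natCast, ← ENNReal.rpow_mul, ← ENNReal.rpow_mul]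
  simp

theorem add_sq_le_two_mul (a b : ℝ≥0∞) : (a + b) ^ 2 ≤ 2 * a ^ 2 + 2 * b ^ 2 := by
  have h := ENNReal.rpow_add_le_mul_rpow_add_rpow a b (p := 2) (by norm_num)
  have e : (2 : ℝ≥0∞) ^ ((2 : ℝ) - 1) = 2 := by norm_num
  rw [e] at h
  simpa [mul_add] using h

theorem lintegral_schwarzian_lt_top {g h : ℂ → ℂ} {R : ℝ} (hR : R < 1) (hg : DifferentiableOn ℂ g (ball 0 1))
    (hi : InjOn g (ball 0 1)) (hh : ContDiffOn ℝ 1 h (collar R))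
    (hdis : ∀ ξ ∈ collar R, h ξ ∉ closure (g '' ball 0 1))
    (hlim : ∀ ε > 0, ∃ b < 1, ∀ ξ ∈ collar b, ‖h ξ - g ξ‖ ≤ ε)
    (hb : Bornology.IsBounded (g '' ball 0 1))
    (hI : ∫⁻ ξ in collar R, ENNReal.ofReal ((‖dz (fderiv ℝ h ξ)‖ / infDist (h ξ) (g '' ball 0 1)) ^ 2) < ⊤) :
    ∫⁻ z in ball 0 1, ENNReal.ofReal ((1 - ‖z‖) ^ 2 * ‖schwarzian g z‖ ^ 2) < ⊤ := by
  set Ω := g '' ball 0 1 with hΩ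
  have hΩne : Ω.Nonempty := ⟨g 0, 0, by simp, rfl⟩
  obtain ⟨ρ, hρ1, hρ2⟩ := exists_between (max_lt hR one_pos)
  have hRρ : R < ρ := (le_max_left _ _).trans_lt hρ1
  have hρ0 : 0 < ρ := (le_max_right _ _).trans_lt hρ1
  have hsub : collar ρ ⊆ collar R := collar_subset hRρ.le
  have hcm : MeasurableSet (collar ρ) := (isOpen_collar ρ).measurableSet
  have hdpos : ∀ ξ ∈ collar R, 0 < infDist (h ξ) Ω := fun ξ hξ => by
    rw [← infDist_closure]
    exact (isClosed_closure.notMem_iff_infDist_pos hΩne.closure).1 (hdis ξ hξ)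
  have hdis' : ∀ ξ ∈ collar R, h ξ ∉ Ω := fun ξ hξ h' => hdis ξ hξ (subset_closure h')
  have hsph : sphere (0:ℂ) ρ ⊆ collar R := fun ξ hξ => by
    have : ‖ξ‖ = ρ := by simpa using hξ
    exact ⟨by rw [this]; exact hRρ, by rw [this]; exact hρ2⟩
  obtain ⟨c, hc0, hc⟩ : ∃ c > 0, ∀ ξ ∈ sphere (0:ℂ) ρ, c ≤ infDist (h ξ) Ω := by
    have hcont : ContinuousOn (fun ξ => infDist (h ξ) Ω) (sphere (0:ℂ) ρ) :=
      (continuous_infDist_pt Ω).comp_continuousOn (hh.continuousOn.mono hsph)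
    obtain ⟨ξ, hξ, hmin⟩ := (isCompact_sphere (0:ℂ) ρ).exists_isMinOn (NormedSpace.sphere_nonempty.2 hρ0.le) hcont
    exact ⟨_, hdpos ξ (hsph hξ), fun η hη => hmin hη⟩
  set M : ℝ := 1 / c * (1 / (1 - ρ) ^ 2) * |π - -π| with hM
  have hρ' : 0 < 1 - ρ := by linarith
  have hMb : ∀ z ∈ ball (0:ℂ) 1, ‖∫ θ in (-π)..π, (g z - h (circleMap 0 ρ θ))⁻¹ *
        (conj (circleMap 0 ρ θ) / (1 - conj (circleMap 0 ρ θ) * z) ^ 2)‖ ≤ M := by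
    intro z hz
    refine intervalIntegral.norm_integral_le_of_norm_le_const fun θ _ => ?_
    have hξ : circleMap 0 ρ θ ∈ sphere (0:ℂ) ρ := circleMap_mem_sphere 0 hρ0.le θ
    have hn : ‖circleMap 0 ρ θ‖ = ρ := by simpa using hξ
    rw [norm_mul, norm_div, norm_pow, norm_inv, ← one_div, RCLike.norm_conj, hn]
    have h1 : c ≤ ‖g z - h (circleMap 0 ρ θ)‖ := by
      refine (hc _ hξ).trans ?_
      rw [← dist_eq_norm, dist_comm]
      exact infDist_le_dist_of_mem ⟨z, hz, rfl⟩
    have h2 : 1 - ρ ≤ ‖1 - conj (circleMap 0 ρ θ) * z‖ := by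
      have h3 := norm_sub_norm_le (1:ℂ) (conj (circleMap 0 ρ θ) * z)
      rw [norm_one, norm_mul, RCLike.norm_conj, hn] at h3
      have : ‖z‖ < 1 := by simpa using hz
      nlinarith
    gcongr
  set A : ℂ → ℝ≥0∞ := fun z => ∫⁻ ξ in collar ρ, ENNReal.ofReal ((‖dz (fderiv ℝ h ξ)‖ / ‖g z - h ξ‖ ^ 2) ^ 2) with hA
  have hdzm : Measurable fun ξ => dz (fderiv ℝ h ξ) := continuous_dz.measurable.comp (measurable_fderiv ℝ h)
  have hhm : AEMeasurable h (volume.restrict (collar ρ)) := (hh.continuousOn.mono hsub).aemeasurable hcm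
  have hgm : AEMeasurable g (volume.restrict (ball 0 1)) := hg.continuousOn.aemeasurable measurableSet_ball
  have hpt : ∀ z ∈ ball (0:ℂ) 1, ENNReal.ofReal ((π / 3) ^ 2 * ((1 - ‖z‖) ^ 2 * ‖schwarzian g z‖ ^ 2)) ≤
      ENNReal.ofReal (2 * M ^ 2) * ENNReal.ofReal (‖deriv g z‖ ^ 2) +
        ENNReal.ofReal (8 * π) * (ENNReal.ofReal (‖deriv g z‖ ^ 2) * A z) := by
    intro z hz
    have hz1 : ‖z‖ < 1 := by simpa using hz
    have ht : 0 < 1 - ‖z‖ := by linarith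
    have hgd : deriv g z ≠ 0 := deriv_ne_zero_of_injOn isOpen_ball hg hi hz
    have hgn : 0 < ‖deriv g z‖ := norm_pos_iff.2 hgd
    have h1 := schwarzian_le hg hi hh hdis' hlim hRρ hρ0 hρ2 hz1
    have hCS : (∫⁻ ξ in collar ρ, ENNReal.ofReal
        (2 * ‖dz (fderiv ℝ h ξ)‖ / ‖g z - h ξ‖ ^ 2 / ‖1 - conj ξ * z‖ ^ 2)) ^ 2 ≤
        ENNReal.ofReal 4 * A z * ENNReal.ofReal (π / (1 - ‖z‖) ^ 2) := by
      have e : ∀ ξ, ENNReal.ofReal (2 * ‖dz (fderiv ℝ h ξ)‖ / ‖g z - h ξ‖ ^ 2 / ‖1 - conj ξ * z‖ ^ 2) =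
          ENNReal.ofReal (2 * (‖dz (fderiv ℝ h ξ)‖ / ‖g z - h ξ‖ ^ 2)) * ENNReal.ofReal (1 / ‖1 - conj ξ * z‖ ^ 2) := by
        intro ξ
        rw [← ENNReal.ofReal_mul (by positivity)]
        congr 1; ring
      simp only [e]
      refine (lintegral_mul_sq_le ?_ ?_).trans (mul_le_mul' ?_ ?_)
      · refine AEMeasurable.ennreal_ofReal (AEMeasurable.const_mul (AEMeasurable.div hdzm.norm.aemeasurable ?_) 2)
        exact (hhm.const_sub (g z)).norm.pow_const 2
      · refine Measurable.aemeasurable ?_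
        have : Measurable fun ξ : ℂ => conj ξ := Complex.continuous_conj.measurable
        fun_prop
      · rw [hA, ← lintegral_const_mul' _ _ ENNReal.ofReal_ne_top]
        refine le_of_eq (lintegral_congr fun ξ => ?_)
        rw [← ENNReal.ofReal_pow (by positivity), ← ENNReal.ofReal_mul (by norm_num)]
        congr 1; ring
      · refine le_trans ?_ (lintegral_kernel_le hz1)
        have : collar ρ ⊆ ball (0:ℂ) 1 := fun ξ hξ => by simpa using hξ.2
        refine le_trans (le_of_eq (lintegral_congr fun ξ => ?_)) (lintegral_mono_set this)
        rw [← ENNReal.ofReal_pow (by positivity)]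
    have h2 := pow_le_pow_left' (h1.trans (add_le_add (ENNReal.ofReal_le_ofReal (hMb z hz)) le_rfl)) 2
    have h3 := (h2.trans (add_sq_le_two_mul _ _)).trans (add_le_add le_rfl (mul_le_mul_right hCS 2))
    have h4 := mul_le_mul_right h3 (ENNReal.ofReal ((1 - ‖z‖) ^ 2 * ‖deriv g z‖ ^ 2))
    have e1 : ENNReal.ofReal ((π / 3) ^ 2 * ((1 - ‖z‖) ^ 2 * ‖schwarzian g z‖ ^ 2)) =
        ENNReal.ofReal ((1 - ‖z‖) ^ 2 * ‖deriv g z‖ ^ 2) * ENNReal.ofReal (π / 3 * (‖schwarzian g z‖ / ‖deriv g z‖)) ^ 2 := by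
      rw [← ENNReal.ofReal_pow (by positivity), ← ENNReal.ofReal_mul (by positivity)]
      congr 1; field_simp
    rw [e1]
    refine h4.trans ?_
    rw [mul_add]
    have hM0 : 0 ≤ M := by positivity
    refine add_le_add ?_ (le_of_eq ?_)
    · rw [← ENNReal.ofReal_pow hM0, show (2 : ℝ≥0∞) = ENNReal.ofReal 2 by norm_num,
        ← ENNReal.ofReal_mul (by norm_num), ← ENNReal.ofReal_mul (by positivity), ← ENNReal.ofReal_mul (by positivity)]
      refine ENNReal.ofReal_le_ofReal ?_
      have : (1 - ‖z‖) ^ 2 ≤ 1 := by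
        have := norm_nonneg z
        nlinarith
      have h5 : 0 ≤ ‖deriv g z‖ ^ 2 * (2 * M ^ 2) := by positivity
      nlinarith
    · have e2 : ENNReal.ofReal ((1 - ‖z‖) ^ 2 * ‖deriv g z‖ ^ 2) * (ENNReal.ofReal 2 *
          (ENNReal.ofReal 4 * ENNReal.ofReal (π / (1 - ‖z‖) ^ 2))) =
        ENNReal.ofReal (8 * π) * ENNReal.ofReal (‖deriv g z‖ ^ 2) := by
        rw [← ENNReal.ofReal_mul (by norm_num), ← ENNReal.ofReal_mul (by norm_num), ← ENNReal.ofReal_mul (by positivity), ← ENNReal.ofReal_mul (by positivity)]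
        congr 1; field_simp; norm_num
      rw [← mul_assoc (ENNReal.ofReal (8 * π)), ← e2]
      rw [show (2 : ℝ≥0∞) = ENNReal.ofReal 2 by norm_num]
      ring
  have hvol : ∫⁻ z in ball (0:ℂ) 1, ENNReal.ofReal (‖deriv g z‖ ^ 2) < ⊤ := by
    rw [lintegral_deriv_sq isOpen_ball hg hi]
    exact hb.measure_lt_top
  have hton : ∫⁻ z in ball (0:ℂ) 1, ENNReal.ofReal (‖deriv g z‖ ^ 2) * A z < ⊤ := by
    have e1 : ∀ z, ENNReal.ofReal (‖deriv g z‖ ^ 2) * A z = ∫⁻ ξ in collar ρ, ENNReal.ofReal (‖deriv g z‖ ^ 2) *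
        ENNReal.ofReal ((‖dz (fderiv ℝ h ξ)‖ / ‖g z - h ξ‖ ^ 2) ^ 2) := fun z => by
      rw [lintegral_const_mul' _ _ ENNReal.ofReal_ne_top]
    simp only [e1]
    rw [lintegral_lintegral_swap]
    · refine lt_of_le_of_lt ?_ (ENNReal.mul_lt_top (a := ENNReal.ofReal π) ENNReal.ofReal_lt_top hI)
      rw [← lintegral_const_mul' _ _ ENNReal.ofReal_ne_top]
      refine le_trans ?_ (lintegral_mono_set hsub)
      refine setLIntegral_mono' hcm fun ξ hξ => ?_
      have hd := hdpos ξ (hsub hξ)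
      have e2 : ∀ z, ENNReal.ofReal (‖deriv g z‖ ^ 2) * ENNReal.ofReal ((‖dz (fderiv ℝ h ξ)‖ / ‖g z - h ξ‖ ^ 2) ^ 2) =
          ENNReal.ofReal (‖dz (fderiv ℝ h ξ)‖ ^ 2) * (ENNReal.ofReal (‖deriv g z‖ ^ 2) *
            ENNReal.ofReal ((1 / ‖g z - h ξ‖ ^ 2) ^ 2)) := fun z => by
        rw [← ENNReal.ofReal_mul (by positivity), ← ENNReal.ofReal_mul (by positivity), ← ENNReal.ofReal_mul (by positivity)]
        congr 1; ring
      simp only [e2]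
      rw [lintegral_const_mul' _ _ ENNReal.ofReal_ne_top,
        ← lintegral_image_holomorphic isOpen_ball hg hi fun w => ENNReal.ofReal ((1 / ‖w - h ξ‖ ^ 2) ^ 2)]
      have hss : Ω ⊆ {w | infDist (h ξ) Ω ≤ ‖w - h ξ‖} := fun w hw => by
        rw [mem_ofPred_eq, ← dist_eq_norm, dist_comm]
        exact infDist_le_dist_of_mem hw
      refine (mul_le_mul_right ((lintegral_mono_set hss).trans (lintegral_inv_norm_pow_four_le hd)) _).trans ?_
      rw [← ENNReal.ofReal_mul (by positivity), ← ENNReal.ofReal_mul (by positivity)]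
      refine le_of_eq (congrArg _ ?_)
      field_simp
    · simp only [Function.uncurry_def]
      refine AEMeasurable.fun_mul ?_ ?_
      · exact ((measurable_deriv g).norm.pow_const 2).ennreal_ofReal.comp measurable_fst |>.aemeasurable
      · refine AEMeasurable.ennreal_ofReal (AEMeasurable.pow_const (AEMeasurable.div ?_ ?_) 2)
        · exact (hdzm.norm.comp measurable_snd).aemeasurable
        · exact ((hgm.comp_fst).sub (hhm.comp_snd)).norm.pow_const 2
  have hfin : ∫⁻ z in ball (0:ℂ) 1, ENNReal.ofReal ((π / 3) ^ 2 * ((1 - ‖z‖) ^ 2 * ‖schwarzian g z‖ ^ 2)) < ⊤ := by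
    refine (setLIntegral_mono' measurableSet_ball hpt).trans_lt ?_
    rw [lintegral_add_left' ?_, lintegral_const_mul' _ _ ENNReal.ofReal_ne_top, lintegral_const_mul' _ _ ENNReal.ofReal_ne_top]
    · exact ENNReal.add_lt_top.2 ⟨ENNReal.mul_lt_top ENNReal.ofReal_lt_top hvol,
        ENNReal.mul_lt_top ENNReal.ofReal_lt_top hton⟩
    · exact (((measurable_deriv g).norm.pow_const 2).ennreal_ofReal.const_mul _).aemeasurable
  simp only [ENNReal.ofReal_mul (sq_nonneg (π / 3))] at hfin
  rw [lintegral_const_mul' _ _ ENNReal.ofReal_ne_top] at hfin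
  by_contra! htop
  rw [top_le_iff.1 htop, ENNReal.mul_top] at hfin
  · exact absurd hfin (lt_irrefl _)
  · simp [pi_ne_zero]

end SchwarzianIntegral

section NearAffine
open Set Filter Topology
open scoped ENNReal ComplexConjugate

/-- An injective holomorphic map of a collar whose pre-Schwarzian is small in the hyperbolic norm. -/
structure IsFlatOn (f : ℂ → ℂ) (a ε : ℝ) : Prop where
  diff : DifferentiableOn ℂ f (collar a)
  inj : InjOn f (collar a)
  bound : ∀ z ∈ collar a, (1 - ‖z‖) * ‖deriv (deriv f) z‖ ≤ ε * ‖deriv f z‖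

variable {f : ℂ → ℂ} {a ε M : ℝ} {ζ u : ℂ}

theorem IsFlatOn.deriv_ne_zero (hf : IsFlatOn f a ε) {z : ℂ} (hz : z ∈ collar a) : deriv f z ≠ 0 :=
  deriv_ne_zero_of_injOn (isOpen_collar a) hf.diff hf.inj hz

theorem IsFlatOn.mono {b : ℝ} (hf : IsFlatOn f a ε) (hab : a ≤ b) : IsFlatOn f b ε :=
  ⟨hf.diff.mono (collar_subset hab), hf.inj.mono (collar_subset hab), fun z hz => hf.bound z (collar_subset hab hz)⟩

theorem IsFlatOn.differentiableAt (hf : IsFlatOn f a ε) {z : ℂ} (hz : z ∈ collar a) : DifferentiableAt ℂ f z :=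
  hf.diff.differentiableAt ((isOpen_collar a).mem_nhds hz)

theorem IsFlatOn.differentiableAt_deriv (hf : IsFlatOn f a ε) {z : ℂ} (hz : z ∈ collar a) :
    DifferentiableAt ℂ (deriv f) z :=
  (hf.diff.deriv (isOpen_collar a)).differentiableAt ((isOpen_collar a).mem_nhds hz)

theorem segment_mem_collar (hζ : ‖ζ‖ < 1) (hu : ‖u‖ ≤ 1) (huζ : ‖u - ζ‖ ≤ M * (1 - ‖ζ‖))
    (ha : a < ‖ζ‖ - M * (1 - ‖ζ‖)) {s : ℝ} (hs : s ∈ Ico (0:ℝ) 1) :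
    ζ + s * (u - ζ) ∈ collar a ∧ (1 - s) * (1 - ‖ζ‖) ≤ 1 - ‖ζ + s * (u - ζ)‖ := by
  have h1 : ‖ζ + s * (u - ζ)‖ ≤ (1 - s) * ‖ζ‖ + s := by
    have : ζ + s * (u - ζ) = (1 - s : ℝ) * ζ + s * u := by push_cast; ring
    rw [this]
    refine (norm_add_le _ _).trans ?_
    rw [norm_mul, norm_mul, Complex.norm_real, Complex.norm_real, Real.norm_of_nonneg hs.1,
      Real.norm_of_nonneg (by linarith [hs.2])]
    have := mul_le_mul_of_nonneg_left hu hs.1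
    linarith
  have h2 : ‖ζ‖ - M * (1 - ‖ζ‖) ≤ ‖ζ + s * (u - ζ)‖ := by
    have h3 : ‖(s:ℂ) * (u - ζ)‖ ≤ M * (1 - ‖ζ‖) := by
      rw [norm_mul, Complex.norm_real, Real.norm_of_nonneg hs.1]
      have := mul_le_mul_of_nonneg_right hs.2.le (norm_nonneg (u - ζ))
      linarith
    have h4 := norm_sub_norm_le ζ (-((s:ℂ) * (u - ζ)))
    rw [norm_neg, sub_neg_eq_add] at h4
    linarith
  have h5 : 0 < (1 - s) * (1 - ‖ζ‖) := mul_pos (by linarith [hs.2]) (by linarith)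
  have h6 : (1 - s) * (1 - ‖ζ‖) = 1 - ((1 - s) * ‖ζ‖ + s) := by ring
  exact ⟨⟨by linarith, by linarith⟩, by linarith⟩

theorem hasDerivAt_segment {h : ℂ → ℂ} {s : ℝ} (hd : DifferentiableAt ℂ h (ζ + s * (u - ζ))) :
    HasDerivAt (fun s : ℝ => h (ζ + s * (u - ζ))) (deriv h (ζ + s * (u - ζ)) * (u - ζ)) s := by
  have h1 : HasDerivAt (fun s : ℝ => ζ + (s : ℂ) * (u - ζ)) (u - ζ) s := by
    simpa using ((Complex.ofRealCLM.hasDerivAt (x := s)).mul_const (u - ζ)).const_add ζ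
  exact HasDerivAt.comp s hd.hasDerivAt h1

theorem hasDerivAt_one_sub_rpow {s p : ℝ} (hs : s < 1) :
    HasDerivAt (fun s : ℝ => (1 - s) ^ p) (-(p * (1 - s) ^ (p - 1))) s := by
  have h1 : HasDerivAt (fun s : ℝ => 1 - s) (-1) s := by
    simpa using (hasDerivAt_id s).const_sub 1
  refine (h1.rpow_const (p := p) (Or.inl (by linarith : (1 - s) ≠ 0 ))).congr_deriv (by ring)

theorem IsFlatOn.norm_deriv_le (hf : IsFlatOn f a ε) (hε : 0 ≤ ε) (hM : 0 ≤ M) (hζ : ‖ζ‖ < 1) (hu : ‖u‖ ≤ 1)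
    (huζ : ‖u - ζ‖ ≤ M * (1 - ‖ζ‖)) (ha : a < ‖ζ‖ - M * (1 - ‖ζ‖)) {s : ℝ} (hs : s ∈ Ico (0:ℝ) 1) :
    ‖deriv f (ζ + s * (u - ζ))‖ ≤ ‖deriv f ζ‖ * (1 - s) ^ (-(ε * M)) ∧
    ‖deriv (deriv f) (ζ + s * (u - ζ)) * (u - ζ)‖ ≤ ε * M * (1 - s) ^ (-(ε * M) - 1) * ‖deriv f ζ‖ := by
  set k := ε * M with hk
  have hseg := fun s hs => segment_mem_collar (s := s) hζ hu huζ ha hs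
  have h2 : ∀ s ∈ Ico (0:ℝ) 1, ‖deriv (deriv f) (ζ + s * (u - ζ)) * (u - ζ)‖ ≤
      k / (1 - s) * ‖deriv f (ζ + s * (u - ζ))‖ := by
    intro s hs
    obtain ⟨h3, h4⟩ := hseg s hs
    have h5 := hf.bound _ h3
    have hs1 : 0 < 1 - s := by linarith [hs.2]
    have hz1 : 0 < 1 - ‖ζ‖ := by linarith
    rw [norm_mul, div_mul_eq_mul_div, le_div_iff₀ hs1]
    have h6 := mul_le_mul_of_nonneg_right h4 (norm_nonneg (deriv (deriv f) (ζ + s * (u - ζ))))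
    have h7 : (1 - s) * (1 - ‖ζ‖) * ‖deriv (deriv f) (ζ + s * (u - ζ))‖ ≤ ε * ‖deriv f (ζ + s * (u - ζ))‖ := h6.trans h5
    have h8 := mul_le_mul_of_nonneg_left huζ (mul_nonneg hs1.le (norm_nonneg (deriv (deriv f) (ζ + s * (u - ζ)))))
    have h9 := mul_le_mul_of_nonneg_left h7 hM
    rw [hk]
    nlinarith
  have hd : ∀ s ∈ Ico (0:ℝ) 1, HasDerivAt (fun s : ℝ => ‖deriv f (ζ + s * (u - ζ))‖ * (1 - s) ^ k) _ s := fun s hs =>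
    (hasDerivAt_norm_of_ne_zero (hasDerivAt_segment (hf.differentiableAt_deriv (hseg s hs).1))
      (hf.deriv_ne_zero (hseg s hs).1)).mul (hasDerivAt_one_sub_rpow hs.2)
  have hanti : AntitoneOn (fun s : ℝ => ‖deriv f (ζ + s * (u - ζ))‖ * (1 - s) ^ k) (Ico (0:ℝ) 1) := by
    refine antitoneOn_of_deriv_nonpos (convex_Ico 0 1) (fun s hs => (hd s hs).continuousAt.continuousWithinAt)
      (fun s hs => (hd s (interior_subset hs)).differentiableAt.differentiableWithinAt) fun s hs => ?_
    have hs' := interior_subset hs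
    have hs1 : 0 < 1 - s := by linarith [hs'.2]
    rw [(hd s hs').deriv]
    have e1 : (1 - s) ^ (k - 1) = (1 - s) ^ k / (1 - s) := by rw [rpow_sub hs1, rpow_one]
    rw [e1]
    have h0 : 0 < ‖deriv f (ζ + s * (u - ζ))‖ := norm_pos_iff.2 (hf.deriv_ne_zero (hseg s hs').1)
    have h3 : (deriv (deriv f) (ζ + s * (u - ζ)) * (u - ζ) / deriv f (ζ + s * (u - ζ))).re ≤ k / (1 - s) := by
      refine (Complex.re_le_norm _).trans ?_
      rw [norm_div, div_le_iff₀ h0]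
      exact h2 s hs'
    have h4 : 0 < (1 - s) ^ k := rpow_pos_of_pos hs1 k
    have h5 := mul_le_mul_of_nonneg_left h3 (mul_pos h0 h4).le
    have e2 : ‖deriv f (ζ + s * (u - ζ))‖ * (1 - s) ^ k * (k / (1 - s)) = ‖deriv f (ζ + s * (u - ζ))‖ * (k * ((1 - s) ^ k / (1 - s))) := by ring
    linarith
  have h1 : ∀ s ∈ Ico (0:ℝ) 1, ‖deriv f (ζ + s * (u - ζ))‖ ≤ ‖deriv f ζ‖ * (1 - s) ^ (-k) := by
    intro s hs
    have h := hanti (left_mem_Ico.2 one_pos) hs hs.1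
    simp only [Complex.ofReal_zero, zero_mul, add_zero, sub_zero, one_rpow, mul_one] at h
    have hs1 : 0 < 1 - s := by linarith [hs.2]
    rw [rpow_neg hs1.le, ← div_eq_mul_inv, le_div_iff₀ (rpow_pos_of_pos hs1 k)]
    exact h
  refine ⟨h1 s hs, (h2 s hs).trans ?_⟩
  have hs1 : 0 < 1 - s := by linarith [hs.2]
  rw [rpow_sub hs1, rpow_one]
  have hk0 : 0 ≤ k := mul_nonneg hε hM
  have := mul_le_mul_of_nonneg_left (h1 s hs) (div_nonneg hk0 hs1.le)
  refine this.trans (le_of_eq ?_)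
  ring

theorem IsFlatOn.norm_deriv_sub_le (hf : IsFlatOn f a ε) (hε : 0 ≤ ε) (hM : 0 ≤ M) (hζ : ‖ζ‖ < 1) (hu : ‖u‖ ≤ 1)
    (huζ : ‖u - ζ‖ ≤ M * (1 - ‖ζ‖)) (ha : a < ‖ζ‖ - M * (1 - ‖ζ‖)) {s : ℝ} (hs : s ∈ Ico (0:ℝ) 1) :
    ‖deriv f (ζ + s * (u - ζ)) - deriv f ζ‖ ≤ ‖deriv f ζ‖ * ((1 - s) ^ (-(ε * M)) - 1) := by
  set k := ε * M with hk
  have hseg := fun s hs => segment_mem_collar (s := s) hζ hu huζ ha hs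
  have hd : ∀ x ∈ Ico (0:ℝ) 1, HasDerivAt (fun s : ℝ => deriv f (ζ + s * (u - ζ)) - deriv f ζ) _ x := fun x hx =>
    (hasDerivAt_segment (hf.differentiableAt_deriv (hseg x hx).1)).sub_const _
  have hB : ∀ x ∈ Ico (0:ℝ) 1, HasDerivAt (fun s : ℝ => ‖deriv f ζ‖ * ((1 - s) ^ (-k) - 1)) _ x := fun x hx =>
    ((hasDerivAt_one_sub_rpow (p := -k) hx.2).sub_const 1).const_mul _
  have hsub : Icc 0 s ⊆ Ico (0:ℝ) 1 := fun x hx => ⟨hx.1, hx.2.trans_lt hs.2⟩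
  refine image_norm_le_of_norm_deriv_right_le_deriv_boundary' (a := 0) (b := s)
    (fun x hx => (hd x (hsub hx)).continuousAt.continuousWithinAt)
    (fun x hx => (hd x (hsub (Ico_subset_Icc_self hx))).hasDerivWithinAt) ?_
    (fun x hx => (hB x (hsub hx)).continuousAt.continuousWithinAt)
    (fun x hx => (hB x (hsub (Ico_subset_Icc_self hx))).hasDerivWithinAt) ?_ ⟨hs.1, le_rfl⟩
  · simp
  · intro x hx
    refine (hf.norm_deriv_le hε hM hζ hu huζ ha (hsub (Ico_subset_Icc_self hx))).2.trans (le_of_eq ?_)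
    ring

theorem IsFlatOn.norm_sub_affine_le (hf : IsFlatOn f a ε) (hε : 0 ≤ ε) (hM : 0 ≤ M) (hk : ε * M ≤ 1 / 2) (hζ : ‖ζ‖ < 1) (hu : ‖u‖ ≤ 1)
    (huζ : ‖u - ζ‖ ≤ M * (1 - ‖ζ‖)) (ha : a < ‖ζ‖ - M * (1 - ‖ζ‖)) {s : ℝ} (hs : s ∈ Ico (0:ℝ) 1) :
    ‖f (ζ + s * (u - ζ)) - f ζ - s * (deriv f ζ * (u - ζ))‖ ≤ 2 * (ε * M) * (‖deriv f ζ‖ * ‖u - ζ‖) := by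
  set k := ε * M with hk'
  have hk0 : 0 ≤ k := mul_nonneg hε hM
  have hseg := fun s hs => segment_mem_collar (s := s) hζ hu huζ ha hs
  have hd : ∀ x ∈ Ico (0:ℝ) 1, HasDerivAt (fun s : ℝ => f (ζ + s * (u - ζ)) - f ζ - s * (deriv f ζ * (u - ζ)))
      (deriv f (ζ + x * (u - ζ)) * (u - ζ) - deriv f ζ * (u - ζ)) x := fun x hx => by
    have h2 : HasDerivAt (fun s : ℝ => (s:ℂ) * (deriv f ζ * (u - ζ))) (deriv f ζ * (u - ζ)) x := by
      simpa using (Complex.ofRealCLM.hasDerivAt (x := x)).mul_const (deriv f ζ * (u - ζ))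
    exact ((hasDerivAt_segment (hf.differentiableAt (hseg x hx).1)).sub_const (f ζ)).sub h2
  have h1k : 0 < 1 - k := by linarith
  have hB : ∀ x ∈ Ico (0:ℝ) 1, HasDerivAt (fun s : ℝ => ‖deriv f ζ‖ * ‖u - ζ‖ * ((1 - (1 - s) ^ (1 - k)) / (1 - k) - s))
      (‖deriv f ζ‖ * ‖u - ζ‖ * ((1 - x) ^ (-k) - 1)) x := fun x hx => by
    refine (((((hasDerivAt_one_sub_rpow (p := 1 - k) hx.2).const_sub 1).div_const (1 - k)).sub (hasDerivAt_id x)).const_mul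
      (‖deriv f ζ‖ * ‖u - ζ‖)).congr_deriv ?_
    have : 1 - k - 1 = -k := by ring
    rw [this]
    field_simp
  have hsub : Icc 0 s ⊆ Ico (0:ℝ) 1 := fun x hx => ⟨hx.1, hx.2.trans_lt hs.2⟩
  have key := image_norm_le_of_norm_deriv_right_le_deriv_boundary' (a := 0) (b := s)
    (fun x hx => (hd x (hsub hx)).continuousAt.continuousWithinAt)
    (fun x hx => (hd x (hsub (Ico_subset_Icc_self hx))).hasDerivWithinAt) (by simp)
    (fun x hx => (hB x (hsub hx)).continuousAt.continuousWithinAt)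
    (fun x hx => (hB x (hsub (Ico_subset_Icc_self hx))).hasDerivWithinAt) (fun x hx => ?_) (⟨hs.1, le_rfl⟩ : s ∈ Icc 0 s)
  · refine key.trans ?_
    rw [mul_comm (2 * k)]
    refine mul_le_mul_of_nonneg_left ?_ (by positivity)
    have hs1 : 0 < 1 - s := by linarith [hs.2]
    have h3 : 1 - s ≤ (1 - s) ^ (1 - k) := by
      conv_lhs => rw [← rpow_one (1 - s)]
      exact rpow_le_rpow_of_exponent_ge hs1 (by linarith [hs.1]) (by linarith)
    rw [sub_le_iff_le_add, div_le_iff₀ h1k]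
    nlinarith [hs.1, mul_nonneg hk0 hs.1, mul_nonneg hk0 h1k.le]
  · rw [← sub_mul, norm_mul]
    have := mul_le_mul_of_nonneg_right (hf.norm_deriv_sub_le hε hM hζ hu huζ ha (hsub (Ico_subset_Icc_self hx))) (norm_nonneg (u - ζ))
    refine this.trans (le_of_eq ?_)
    ring

end NearAffine

section Boundary
open Set Filter Topology
open scoped ENNReal ComplexConjugate

variable {f : ℂ → ℂ} {a ε M : ℝ} {z ζ u : ℂ}

/-- The half-open annulus `a < ‖z‖ ≤ 1`. -/
def closedCollar (a : ℝ) : Set ℂ := {z | a < ‖z‖ ∧ ‖z‖ ≤ 1}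

theorem collar_subset_closedCollar : collar a ⊆ closedCollar a := fun _ hz => ⟨hz.1, hz.2.le⟩

theorem closedCollar_subset {b : ℝ} (h : a ≤ b) : closedCollar b ⊆ closedCollar a :=
  fun _ hz => ⟨h.trans_lt hz.1, hz.2⟩

theorem IsFlatOn.congr {F : ℂ → ℂ} (hf : IsFlatOn f a ε) (h : EqOn F f (collar a)) : IsFlatOn F a ε := by
  have h1 : EqOn (deriv F) (deriv f) (collar a) := fun z hz =>
    (h.eventuallyEq_of_mem ((isOpen_collar a).mem_nhds hz)).deriv_eq
  have h2 : EqOn (deriv (deriv F)) (deriv (deriv f)) (collar a) := fun z hz =>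
    (h1.eventuallyEq_of_mem ((isOpen_collar a).mem_nhds hz)).deriv_eq
  refine ⟨hf.diff.congr h, hf.inj.congr h.symm, fun z hz => ?_⟩
  rw [h1 hz, h2 hz]
  exact hf.bound z hz

theorem IsFlatOn.norm_sub_affine_le_of_continuousWithinAt (hf : IsFlatOn f a ε) (hε : 0 ≤ ε) (hM : 0 ≤ M)
    (hk : ε * M ≤ 1 / 2) (hζ : ‖ζ‖ < 1) (hu : ‖u‖ ≤ 1)
    (hc : ContinuousWithinAt f (collar a) u)
    (huζ : ‖u - ζ‖ ≤ M * (1 - ‖ζ‖)) (ha : a < ‖ζ‖ - M * (1 - ‖ζ‖)) :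
    ‖f u - f ζ - deriv f ζ * (u - ζ)‖ ≤ 2 * (ε * M) * (‖deriv f ζ‖ * ‖u - ζ‖) := by
  have hs : ∀ᶠ s : ℝ in 𝓝[<] 1, s ∈ Ico (0:ℝ) 1 := by
    filter_upwards [Ioo_mem_nhdsLT (zero_lt_one' ℝ)] with s hs using ⟨hs.1.le, hs.2⟩
  have h1 : Tendsto (fun s : ℝ => ζ + (s:ℂ) * (u - ζ)) (𝓝[<] 1) (𝓝 u) := by
    have : Continuous (fun s : ℝ => ζ + (s:ℂ) * (u - ζ)) := by fun_prop
    have h := (this.tendsto 1).mono_left (nhdsWithin_le_nhds (s := Iio 1))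
    simpa using h
  have h2 : Tendsto (fun s : ℝ => ζ + (s:ℂ) * (u - ζ)) (𝓝[<] 1) (𝓝[collar a] u) :=
    tendsto_nhdsWithin_iff.2 ⟨h1, hs.mono fun s hs => (segment_mem_collar hζ hu huζ ha hs).1⟩
  have h3 : Tendsto (fun s : ℝ => (s:ℂ) * (deriv f ζ * (u - ζ))) (𝓝[<] 1) (𝓝 (deriv f ζ * (u - ζ))) := by
    have : Continuous (fun s : ℝ => (s:ℂ) * (deriv f ζ * (u - ζ))) := by fun_prop
    have h := (this.tendsto 1).mono_left (nhdsWithin_le_nhds (s := Iio 1))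
    simpa using h
  exact le_of_tendsto ((((hc.tendsto.comp h2).sub_const (f ζ)).sub h3).norm)
    (hs.mono fun s hs => hf.norm_sub_affine_le hε hM hk hζ hu huζ ha hs)

theorem mem_closure_collar (ha : a < 1) (hu : u ∈ closedCollar a) : u ∈ closure (collar a) := by
  rcases hu.2.lt_or_eq with h | h
  · exact subset_closure ⟨hu.1, h⟩
  have h1 : Tendsto (fun s : ℝ => (s:ℂ) * u) (𝓝[<] 1) (𝓝 u) := by
    have : Continuous (fun s : ℝ => (s:ℂ) * u) := by fun_prop
    have h := (this.tendsto 1).mono_left (nhdsWithin_le_nhds (s := Iio 1))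
    simpa using h
  refine mem_closure_of_tendsto h1 ?_
  filter_upwards [Ioo_mem_nhdsLT (max_lt ha one_pos)] with s hs
  have hs0 : 0 < s := (le_max_right _ _).trans_lt hs.1
  have : ‖(s:ℂ) * u‖ = s := by rw [norm_mul, h, Complex.norm_real, Real.norm_of_nonneg hs0.le, mul_one]
  exact ⟨by rw [this]; exact (le_max_left _ _).trans_lt hs.1, by rw [this]; exact hs.2⟩

theorem IsFlatOn.exists_extension (hf : IsFlatOn f a ε) (hε : 0 ≤ ε) (hε' : ε ≤ 1 / 4) (ha : a < 1)
    (hdec : ∀ η > 0, ∃ b < 1, ∀ z ∈ collar b, (1 - ‖z‖) * ‖deriv f z‖ ≤ η) :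
    ∃ F : ℂ → ℂ, EqOn F f (collar a) ∧ ContinuousOn F (closedCollar a) := by
  have hlim : ∀ u ∈ closedCollar a, ∃ y, Tendsto f (𝓝[collar a] u) (𝓝 y) := by
    intro u hu
    rcases hu.2.lt_or_eq with h | h
    · exact ⟨f u, (hf.differentiableAt ⟨hu.1, h⟩).continuousAt.continuousWithinAt⟩
    have : NeBot (𝓝[collar a] u) := mem_closure_iff_nhdsWithin_neBot.1 (mem_closure_collar ha hu)
    refine cauchy_map_iff_exists_tendsto.1 ?_
    refine Metric.cauchy_iff.2 ⟨inferInstance, fun η hη => ?_⟩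
    obtain ⟨b, hb1, hb⟩ := hdec (η / 9) (by positivity)
    obtain ⟨t, ht0, ht⟩ := exists_between (show (0:ℝ) < min ((1 - b)) (min ((1 - a) / 4) 1) from
      lt_min (by linarith) (lt_min (by linarith) one_pos))
    rw [lt_min_iff, lt_min_iff] at ht
    have hn : ‖((1 - t : ℝ) : ℂ) * u‖ = 1 - t := by
      rw [norm_mul, h, Complex.norm_real, Real.norm_of_nonneg (by linarith), mul_one]
    set ζ := ((1 - t : ℝ) : ℂ) * u with hζ
    have hdz := hb ζ ⟨by rw [hn]; linarith, by rw [hn]; linarith⟩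
    rw [hn] at hdz
    have key : ∀ v ∈ collar a, dist v u < t → ‖f v - f ζ‖ < η / 2 := by
      intro v hv hvu
      have e1 : ‖v - ζ‖ ≤ 2 * (1 - ‖ζ‖) := by
        have e2 : v - ζ = (v - u) + (t:ℂ) * u := by rw [hζ]; push_cast; ring
        rw [e2, hn]
        refine (norm_add_le _ _).trans ?_
        rw [norm_mul, h, Complex.norm_real, Real.norm_of_nonneg ht0.le]
        rw [dist_eq_norm] at hvu
        linarith
      have h1 := hf.norm_sub_affine_le_of_continuousWithinAt hε (M := 2) (by norm_num) (by linarith)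
        (show ‖ζ‖ < 1 by rw [hn]; linarith) hv.2.le
        (hf.differentiableAt hv).continuousAt.continuousWithinAt e1 (by rw [hn]; linarith)
      have h2 : f v - f ζ = (f v - f ζ - deriv f ζ * (v - ζ)) + deriv f ζ * (v - ζ) := by ring
      rw [h2]
      refine (norm_add_le _ _).trans_lt ?_
      rw [norm_mul]
      rw [hn] at e1
      have h3 := mul_le_mul_of_nonneg_left e1 (norm_nonneg (deriv f ζ))
      have h4 : 0 ≤ ‖deriv f ζ‖ * ‖v - ζ‖ := by positivity
      nlinarith
    refine ⟨f '' (collar a ∩ ball u t), ?_, ?_⟩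
    · exact image_mem_map (inter_mem self_mem_nhdsWithin (mem_nhdsWithin_of_mem_nhds (ball_mem_nhds u ht0)))
    · rintro _ ⟨v, hv, rfl⟩ _ ⟨w, hw, rfl⟩
      have h1 := key v hv.1 hv.2
      have h2 := key w hw.1 hw.2
      calc dist (f v) (f w) ≤ dist (f v) (f ζ) + dist (f w) (f ζ) := dist_triangle_right _ _ _
        _ < η := by rw [dist_eq_norm, dist_eq_norm]; linarith
  refine ⟨extendFrom (collar a) f, fun z hz => ?_, continuousOn_extendFrom (fun u hu => mem_closure_collar ha hu) hlim⟩
  exact extendFrom_eq (subset_closure hz) (hf.differentiableAt hz).continuousAt.continuousWithinAt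

theorem IsFlatOn.box (hf : IsFlatOn f a (1 / 10000)) (hc : ContinuousOn f (closedCollar a))
    (hζ : ‖ζ‖ < 1) (ha : a < 1 - 4 * (1 - ‖ζ‖)) (hu : ‖u‖ ≤ 1) (huζ : ‖u - ζ‖ ≤ 3 * (1 - ‖ζ‖)) :
    ‖f u - f ζ - deriv f ζ * (u - ζ)‖ ≤ 18 / 10000 * ((1 - ‖ζ‖) * ‖deriv f ζ‖) := by
  have h1 : a < ‖u‖ := by
    have := norm_sub_norm_le ζ u
    rw [norm_sub_rev] at this
    linarith
  have h2 := hf.norm_sub_affine_le_of_continuousWithinAt (by norm_num) (M := 3) (by norm_num) (by norm_num) hζ hu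
    ((hc u ⟨h1, hu⟩).mono collar_subset_closedCollar) huζ (by linarith)
  have h3 := mul_le_mul_of_nonneg_left huζ (norm_nonneg (deriv f ζ))
  linarith

theorem IsFlatOn.box_deriv (hf : IsFlatOn f a (1 / 10000)) (hc : ContinuousOn f (closedCollar a))
    (hζ : ‖ζ‖ < 1) (ha : a < 1 - 4 * (1 - ‖ζ‖)) {ρ : ℝ} (hρ : 0 < ρ) (hu : ρ ≤ 1 - ‖u‖)
    (huζ : ‖u - ζ‖ + ρ ≤ 3 * (1 - ‖ζ‖)) :
    ρ * ‖deriv f u - deriv f ζ‖ ≤ 18 / 10000 * ((1 - ‖ζ‖) * ‖deriv f ζ‖) := by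
  have hb : ∀ v ∈ ball u ρ, ‖v‖ < 1 ∧ ‖v - ζ‖ ≤ 3 * (1 - ‖ζ‖) := by
    intro v hv
    rw [mem_ball, dist_eq_norm] at hv
    have h1 := norm_sub_norm_le v u
    have h2 := norm_sub_le_norm_sub_add_norm_sub v u ζ
    exact ⟨by linarith, by linarith⟩
  have hcol : ∀ v ∈ ball u ρ, v ∈ collar a := by
    intro v hv
    obtain ⟨h1, h2⟩ := hb v hv
    have := norm_sub_norm_le ζ v
    rw [norm_sub_rev] at this
    exact ⟨by linarith, h1⟩
  have hd : ∀ v ∈ ball u ρ, HasDerivAt (fun v => f v - f ζ - deriv f ζ * (v - ζ)) (deriv f v - deriv f ζ) v := by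
    intro v hv
    have h2 : HasDerivAt (fun v => deriv f ζ * (v - ζ)) (deriv f ζ) v := by
      simpa using ((hasDerivAt_id v).sub_const ζ).const_mul (deriv f ζ)
    exact ((hf.differentiableAt (hcol v hv)).hasDerivAt.sub_const (f ζ)).sub h2
  have hD : DifferentiableOn ℂ (fun v => f v - f ζ - deriv f ζ * (v - ζ)) (ball u ρ) :=
    fun v hv => (hd v hv).differentiableAt.differentiableWithinAt
  have hu0 : u ∈ ball u ρ := mem_ball_self hρ
  have key : ∀ r, 0 < r → r < ρ → r * ‖deriv f u - deriv f ζ‖ ≤ 18 / 10000 * ((1 - ‖ζ‖) * ‖deriv f ζ‖) := by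
    intro r hr hrρ
    have h1 := Complex.norm_deriv_le_of_forall_mem_sphere_norm_le (c := u) (R := r) (C := 18 / 10000 * ((1 - ‖ζ‖) * ‖deriv f ζ‖))
      (f := fun v => f v - f ζ - deriv f ζ * (v - ζ)) hr (hD.diffContOnCl_ball (closedBall_subset_ball hrρ))
      (fun v hv => ?_)
    · rw [(hd u hu0).deriv, le_div_iff₀ hr] at h1
      linarith
    · obtain ⟨h2, h3⟩ := hb v (sphere_subset_closedBall.trans (closedBall_subset_ball hrρ) hv)
      exact hf.box hc hζ ha h2.le h3
  have ht : Tendsto (fun r : ℝ => r * ‖deriv f u - deriv f ζ‖) (𝓝[<] ρ) (𝓝 (ρ * ‖deriv f u - deriv f ζ‖)) :=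
    ((continuous_id.mul continuous_const).tendsto ρ).mono_left nhdsWithin_le_nhds
  refine le_of_tendsto ht ?_
  filter_upwards [Ioo_mem_nhdsLT hρ] with r hr using key r hr.1 hr.2

/-- The Ahlfors–Weill type reflection across the image of the unit circle. -/
noncomputable def reflection (f : ℂ → ℂ) (z : ℂ) : ℂ := f z + ((conj z)⁻¹ - z) * deriv f z

theorem inv_conj_sub (hz : z ≠ 0) : (conj z)⁻¹ - z = ((1 - ‖z‖ ^ 2 : ℝ) : ℂ) * (conj z)⁻¹ := by
  have : conj z ≠ 0 := by simpa using hz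
  field_simp
  rw [mul_comm, Complex.mul_conj, Complex.normSq_eq_norm_sq]
  push_cast; ring

theorem norm_inv_conj_sub_le (hz : 1 / 2 ≤ ‖z‖) (hz1 : ‖z‖ ≤ 1) : ‖(conj z)⁻¹ - z‖ ≤ 3 * (1 - ‖z‖) := by
  have h0 : 0 < ‖z‖ := by linarith
  rw [inv_conj_sub (norm_pos_iff.1 h0), norm_mul, norm_inv, Complex.norm_conj, Complex.norm_real,
    Real.norm_of_nonneg (by nlinarith), ← div_eq_mul_inv, div_le_iff₀ h0]
  nlinarith

theorem reflection_eq_of_norm_eq_one (hz : ‖z‖ = 1) : reflection f z = f z := by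
  have h0 : z ≠ 0 := by rw [← norm_pos_iff, hz]; exact one_pos
  simp [reflection, inv_conj_sub h0, hz]

theorem IsFlatOn.reflection_sub_le (hf : IsFlatOn f a (1 / 10000)) (hc : ContinuousOn f (closedCollar a))
    (hζ : ‖ζ‖ < 1) (ha : a < 1 - 4 * (1 - ‖ζ‖)) (hu2 : 1 / 2 ≤ ‖u‖) (hu : ‖u‖ ≤ 1) (huζ : ‖u - ζ‖ ≤ 2 * (1 - ‖ζ‖))
    (hm : 1 - ‖u‖ ≤ 1 - ‖ζ‖) :
    ‖reflection f u - f ζ - deriv f ζ * ((conj u)⁻¹ - ζ)‖ ≤ 72 / 10000 * ((1 - ‖ζ‖) * ‖deriv f ζ‖) := by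
  have h1 := hf.box hc hζ ha hu (by linarith)
  have h2 : ‖((conj u)⁻¹ - u) * (deriv f u - deriv f ζ)‖ ≤ 54 / 10000 * ((1 - ‖ζ‖) * ‖deriv f ζ‖) := by
    rcases hu.lt_or_eq with h | h
    · have h3 := hf.box_deriv hc hζ ha (ρ := 1 - ‖u‖) (by linarith) le_rfl (by linarith)
      rw [norm_mul]
      have := mul_le_mul_of_nonneg_right (norm_inv_conj_sub_le hu2 hu) (norm_nonneg (deriv f u - deriv f ζ))
      linarith
    · have := norm_inv_conj_sub_le hu2 hu
      rw [h, sub_self, mul_zero] at this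
      rw [norm_mul, le_antisymm this (norm_nonneg _), zero_mul]
      have : 0 ≤ 1 - ‖ζ‖ := by linarith
      positivity
  have e : reflection f u - f ζ - deriv f ζ * ((conj u)⁻¹ - ζ) =
    (f u - f ζ - deriv f ζ * (u - ζ)) + ((conj u)⁻¹ - u) * (deriv f u - deriv f ζ) := by
    rw [reflection]; ring
  rw [e]
  exact (norm_add_le _ _).trans (by linarith)

end Boundary

section ReflectionInjective
open Set Filter Topology
open scoped ENNReal ComplexConjugate

variable {f : ℂ → ℂ} {a ε M : ℝ} {z w ζ u : ℂ}

theorem exists_radial_center {m : ℝ} (hz0 : z ≠ 0) (hz : 1 - ‖z‖ ≤ m) (hm : m ≤ 1) (hz1 : ‖z‖ ≤ 1) :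
    ∃ ζ : ℂ, 1 - ‖ζ‖ = m ∧ ‖z - ζ‖ ≤ m := by
  have h0 : (0:ℝ) < ‖z‖ := norm_pos_iff.2 hz0
  refine ⟨((1 - m) / ‖z‖ : ℝ) * z, ?_, ?_⟩
  · rw [norm_mul, Complex.norm_real, Real.norm_of_nonneg (div_nonneg (by linarith) h0.le), div_mul_cancel₀ _ h0.ne']
    ring
  · have e : z - ((1 - m) / ‖z‖ : ℝ) * z = ((1 - (1 - m) / ‖z‖ : ℝ) : ℂ) * z := by push_cast; ring
    rw [e, norm_mul, Complex.norm_real]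
    have h1 : 0 ≤ 1 - (1 - m) / ‖z‖ := by rw [sub_nonneg, div_le_one h0]; linarith
    rw [Real.norm_of_nonneg h1, sub_mul, one_mul, div_mul_cancel₀ _ h0.ne']
    linarith

theorem norm_sub_le_inv_conj_sub_inv_conj (hz0 : z ≠ 0) (hw0 : w ≠ 0) (hz : ‖z‖ ≤ 1) (hw : ‖w‖ ≤ 1) :
    ‖z - w‖ ≤ ‖(conj z)⁻¹ - (conj w)⁻¹‖ := by
  have e : (conj z)⁻¹ - (conj w)⁻¹ = conj (w - z) * ((conj z)⁻¹ * (conj w)⁻¹) := by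
    have h1 : conj z ≠ 0 := by simpa using hz0
    have h2 : conj w ≠ 0 := by simpa using hw0
    rw [map_sub]
    field_simp
  rw [e, norm_mul, norm_mul, norm_inv, norm_inv, Complex.norm_conj, Complex.norm_conj, Complex.norm_conj, norm_sub_rev]
  have h1 : 1 ≤ ‖z‖⁻¹ := (one_le_inv₀ (norm_pos_iff.2 hz0)).2 hz
  have h2 : 1 ≤ ‖w‖⁻¹ := (one_le_inv₀ (norm_pos_iff.2 hw0)).2 hw
  exact le_mul_of_one_le_right (norm_nonneg _) (one_le_mul_of_one_le_of_one_le h1 h2)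

theorem max_le_norm_inv_conj_sub (hz0 : z ≠ 0) (hz : ‖z‖ ≤ 1) (hw : ‖w‖ ≤ 1) :
    max ‖z - w‖ (max (1 - ‖z‖) (1 - ‖w‖)) ≤ ‖(conj z)⁻¹ - w‖ := by
  have hcz : conj z ≠ 0 := by simpa using hz0
  have e : (conj z)⁻¹ - w = (1 - conj z * w) * (conj z)⁻¹ := by field_simp
  have h1 : ‖1 - conj z * w‖ ≤ ‖(conj z)⁻¹ - w‖ := by
    rw [e, norm_mul, norm_inv, Complex.norm_conj]
    exact le_mul_of_one_le_right (norm_nonneg _) ((one_le_inv₀ (norm_pos_iff.2 hz0)).2 hz)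
  have h2 : 1 - ‖w‖ ≤ ‖1 - conj z * w‖ := one_sub_norm_le (by simpa using hz)
  have h3 : 1 - ‖z‖ ≤ ‖1 - conj z * w‖ := by
    have := one_sub_norm_le (z := conj z) hw
    rwa [Complex.norm_conj, mul_comm w] at this
  have h4 : ‖z - w‖ ≤ ‖1 - conj z * w‖ := by
    refine (sq_le_sq₀ (norm_nonneg _) (norm_nonneg _)).1 ?_
    have h5 : ‖1 - conj z * w‖ ^ 2 - ‖z - w‖ ^ 2 = (1 - ‖z‖ ^ 2) * (1 - ‖w‖ ^ 2) := by
      rw [← Complex.normSq_eq_norm_sq, ← Complex.normSq_eq_norm_sq, ← Complex.normSq_eq_norm_sq, ← Complex.normSq_eq_norm_sq]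
      simp only [Complex.normSq_apply, Complex.sub_re, Complex.sub_im, Complex.mul_re, Complex.mul_im, Complex.conj_re,
        Complex.conj_im, Complex.one_re, Complex.one_im]
      ring
    have h6 : 0 ≤ (1 - ‖z‖ ^ 2) * (1 - ‖w‖ ^ 2) :=
      mul_nonneg (by nlinarith [norm_nonneg z]) (by nlinarith [norm_nonneg w])
    linarith
  exact (max_le h4 (max_le h3 h2)).trans h1

theorem IsFlatOn.reflection_ne_of_le (hf : IsFlatOn f a (1 / 10000)) (hc : ContinuousOn f (closedCollar a))
    (hz2 : 1 / 2 ≤ ‖z‖) (hw2 : 1 / 2 ≤ ‖w‖) (hz : ‖z‖ ≤ 1) (hw : ‖w‖ ≤ 1) {m : ℝ} (hm : 0 < m) (hm1 : m ≤ 1 / 2)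
    (ha : a < 1 - 4 * m) (hzm : 1 - ‖z‖ ≤ m) (hwm : 1 - ‖w‖ ≤ m) (hzw : ‖z - w‖ ≤ m) (hzw' : m ≤ 50 * ‖z - w‖) :
    reflection f z ≠ reflection f w := by
  have hz0 : z ≠ 0 := norm_pos_iff.1 (by linarith)
  have hw0 : w ≠ 0 := norm_pos_iff.1 (by linarith)
  obtain ⟨ζ, rfl, hζ⟩ := exists_radial_center hz0 hzm (by linarith) hz
  have h1 := hf.reflection_sub_le hc (by linarith) ha hz2 hz (by linarith) hzm
  have h2 := hf.reflection_sub_le hc (by linarith) ha hw2 hw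
    (by have := norm_sub_le_norm_sub_add_norm_sub w z ζ; rw [norm_sub_rev w z] at this; linarith) hwm
  intro h
  have e : deriv f ζ * ((conj z)⁻¹ - (conj w)⁻¹) =
    (reflection f w - f ζ - deriv f ζ * ((conj w)⁻¹ - ζ)) - (reflection f z - f ζ - deriv f ζ * ((conj z)⁻¹ - ζ)) := by
    rw [h]; ring
  have h3 := norm_sub_le (reflection f w - f ζ - deriv f ζ * ((conj w)⁻¹ - ζ)) (reflection f z - f ζ - deriv f ζ * ((conj z)⁻¹ - ζ))
  rw [← e, norm_mul] at h3
  have h0 : 0 < ‖deriv f ζ‖ := norm_pos_iff.2 (hf.deriv_ne_zero ⟨by linarith, by linarith⟩)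
  have h4 := mul_le_mul_of_nonneg_left (norm_sub_le_inv_conj_sub_inv_conj hz0 hw0 hz hw) h0.le
  have h5 := mul_le_mul_of_nonneg_left hzw' h0.le
  have h6 := mul_pos hm h0
  nlinarith

theorem IsFlatOn.reflection_ne_of_near (hf : IsFlatOn f a (1 / 10000)) (hc : ContinuousOn f (closedCollar a))
    (hz2 : 1 / 2 ≤ ‖z‖) (hz : ‖z‖ < 1) (hw : ‖w‖ < 1) (hne : z ≠ w)
    (ha : a < 1 - 4 * (1 - ‖z‖)) (hwm : 1 - ‖w‖ ≤ 1 - ‖z‖) (hzw : ‖z - w‖ < (1 - ‖z‖) / 2) :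
    reflection f w ≠ reflection f z := by
  have hz0 : z ≠ 0 := norm_pos_iff.1 (by linarith)
  have hw0 : w ≠ 0 := norm_pos_iff.1 (by linarith)
  set m := 1 - ‖z‖ with hm
  have hm0 : 0 < m := by linarith
  have hD : 0 < ‖deriv f z‖ := norm_pos_iff.2 (hf.deriv_ne_zero ⟨by linarith, by linarith⟩)
  have hb : ∀ v ∈ ball z (m / 2), m / 2 ≤ 1 - ‖v‖ ∧ v ∈ collar a := by
    intro v hv
    rw [mem_ball, dist_eq_norm] at hv
    have h1 := norm_sub_norm_le v z
    have h2 := norm_sub_norm_le z v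
    rw [norm_sub_rev] at h2
    exact ⟨by linarith, by linarith, by linarith⟩
  have hf1 : ∀ v ∈ ball z (m / 2), ‖deriv f v - deriv f z‖ ≤ 36 / 10000 * ‖deriv f z‖ := by
    intro v hv
    have h1 := hf.box_deriv hc hz ha (ρ := m / 2) (u := v) (by linarith) (hb v hv).1
      (by rw [mem_ball, dist_eq_norm] at hv; linarith)
    rw [← hm] at h1
    nlinarith
  have hf2 : ∀ v ∈ ball z (m / 2), ‖deriv (deriv f) v‖ ≤ 3 / 10000 / m * ‖deriv f z‖ := by
    intro v hv
    have h1 := hf.bound v (hb v hv).2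
    have h2 := mul_le_mul_of_nonneg_right (hb v hv).1 (norm_nonneg (deriv (deriv f) v))
    have h3 := hf1 v hv
    have h4 := norm_sub_norm_le (deriv f v) (deriv f z)
    rw [div_mul_eq_mul_div, le_div_iff₀ hm0]
    nlinarith
  have hwb : w ∈ ball z (m / 2) := by rwa [mem_ball, dist_eq_norm, norm_sub_rev]
  have hzb : z ∈ ball z (m / 2) := mem_ball_self (by linarith)
  have k1 := (convex_ball z (m / 2)).norm_image_sub_le_of_norm_hasDerivWithin_le (f := fun v => f v - deriv f z * v)
    (f' := fun v => deriv f v - deriv f z)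
    (fun v hv => by
      have h2 : HasDerivAt (fun v => deriv f z * v) (deriv f z) v := by
        simpa using (hasDerivAt_id v).const_mul (deriv f z)
      exact ((hf.differentiableAt (hb v hv).2).hasDerivAt.sub h2).hasDerivWithinAt) hf1 hzb hwb
  have k2 := (convex_ball z (m / 2)).norm_image_sub_le_of_norm_hasDerivWithin_le (f := deriv f) (f' := deriv (deriv f))
    (fun v hv => (hf.differentiableAt_deriv (hb v hv).2).hasDerivAt.hasDerivWithinAt) hf2 hzb hwb
  intro h
  have e : deriv f z * ((conj w)⁻¹ - (conj z)⁻¹) =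
    -((f w - deriv f z * w - (f z - deriv f z * z)) + ((conj w)⁻¹ - w) * (deriv f w - deriv f z)) := by
    have h' : reflection f w - reflection f z = 0 := sub_eq_zero.2 h
    rw [reflection, reflection] at h'
    linear_combination h'
  have h3 := congrArg norm e
  rw [norm_mul, norm_neg] at h3
  have h4 := norm_add_le (f w - deriv f z * w - (f z - deriv f z * z)) (((conj w)⁻¹ - w) * (deriv f w - deriv f z))
  rw [← h3, norm_mul] at h4
  have h5 := norm_sub_le_inv_conj_sub_inv_conj hw0 hz0 hw.le hz.le
  have h6 : 0 < ‖w - z‖ := norm_pos_iff.2 (sub_ne_zero.2 hne.symm)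
  have h7 : ‖(conj w)⁻¹ - w‖ ≤ 3 * m := (norm_inv_conj_sub_le (by linarith) hw.le).trans (by linarith)
  have h8 := mul_le_mul h7 k2 (norm_nonneg _) (by positivity)
  have e2 : 3 * m * (3 / 10000 / m * ‖deriv f z‖ * ‖w - z‖) = 9 / 10000 * (‖deriv f z‖ * ‖w - z‖) := by
    field_simp; ring
  have h9 := mul_le_mul_of_nonneg_left h5 hD.le
  have h10 := mul_pos hD h6
  linarith

theorem IsFlatOn.reflection_ne (hf : IsFlatOn f a (1 / 10000)) (hc : ContinuousOn f (closedCollar a)) {m : ℝ}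
    (hm1 : m ≤ 1 / 2) (ha : a ≤ 1 - 4 * m) (hz : z ∈ closedCollar (1 - m)) (hw : w ∈ closedCollar (1 - m))
    (hzw : ‖z - w‖ < m) (hne : z ≠ w) : reflection f z ≠ reflection f w := by
  set n := max ‖z - w‖ (max (1 - ‖z‖) (1 - ‖w‖)) with hn
  have h1 : ‖z - w‖ ≤ n := le_max_left _ _
  have h2 : 1 - ‖z‖ ≤ n := (le_max_left _ _).trans (le_max_right _ _)
  have h3 : 1 - ‖w‖ ≤ n := (le_max_right _ _).trans (le_max_right _ _)
  have h4 : n < m := max_lt hzw (max_lt (by linarith [hz.1]) (by linarith [hw.1]))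
  have h5 : 0 < ‖z - w‖ := norm_pos_iff.2 (sub_ne_zero.2 hne)
  rcases le_or_gt n (50 * ‖z - w‖) with h6 | h6
  · exact hf.reflection_ne_of_le hc (by linarith [hz.1]) (by linarith [hw.1]) hz.2 hw.2 (h5.trans_le h1) (by linarith)
      (by linarith) h2 h3 h1 h6
  · have h7 : n = max (1 - ‖z‖) (1 - ‖w‖) := by
      rcases max_choice ‖z - w‖ (max (1 - ‖z‖) (1 - ‖w‖)) with h | h
      · rw [← hn] at h; linarith
      · exact h
    have h9 := norm_sub_norm_le z w
    have h10 := norm_sub_norm_le w z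
    rw [norm_sub_rev] at h10
    rcases max_choice (1 - ‖z‖) (1 - ‖w‖) with h | h <;> rw [h] at h7
    · exact (hf.reflection_ne_of_near hc (by linarith) (by linarith) (by linarith) hne (by linarith) (by linarith) (by linarith)).symm
    · rw [norm_sub_rev] at *
      exact hf.reflection_ne_of_near hc (by linarith) (by linarith) (by linarith) hne.symm (by linarith) (by linarith) (by linarith)

theorem IsFlatOn.reflection_ne_self (hf : IsFlatOn f a (1 / 10000)) (hc : ContinuousOn f (closedCollar a)) {m : ℝ}
    (hm1 : m ≤ 1 / 2) (ha : a ≤ 1 - 4 * m) (hz : z ∈ collar (1 - m)) (hw : w ∈ collar (1 - m))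
    (hzw : ‖z - w‖ < m) : reflection f z ≠ f w := by
  set n := max ‖z - w‖ (max (1 - ‖z‖) (1 - ‖w‖)) with hn
  have h1 : ‖z - w‖ ≤ n := le_max_left _ _
  have h2 : 1 - ‖z‖ ≤ n := (le_max_left _ _).trans (le_max_right _ _)
  have h3 : 1 - ‖w‖ ≤ n := (le_max_right _ _).trans (le_max_right _ _)
  have h4 : n < m := max_lt hzw (max_lt (by linarith [hz.1]) (by linarith [hw.1]))
  have hn0 : 0 < n := by linarith [hz.2]
  have hz2 : 1 / 2 ≤ ‖z‖ := by linarith [hz.1]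
  have hz0 : z ≠ 0 := norm_pos_iff.1 (by linarith)
  have hk := max_le_norm_inv_conj_sub hz0 hz.2.le hw.2.le
  rw [← hn] at hk
  clear_value n
  obtain ⟨ζ, rfl, hζ⟩ := exists_radial_center hz0 h2 (by linarith) hz.2.le
  have k1 := hf.reflection_sub_le hc (by linarith) (by linarith) hz2 hz.2.le (by linarith) h2
  have k2 := hf.box (ζ := ζ) hc (by linarith) (by linarith) hw.2.le
    (by have := norm_sub_le_norm_sub_add_norm_sub w z ζ; rw [norm_sub_rev w z] at this; linarith)
  intro h
  have e : deriv f ζ * ((conj z)⁻¹ - w) =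
    (f w - f ζ - deriv f ζ * (w - ζ)) - (reflection f z - f ζ - deriv f ζ * ((conj z)⁻¹ - ζ)) := by
    rw [h]; ring
  have h3 := norm_sub_le (f w - f ζ - deriv f ζ * (w - ζ)) (reflection f z - f ζ - deriv f ζ * ((conj z)⁻¹ - ζ))
  rw [← e, norm_mul] at h3
  have h0 : 0 < ‖deriv f ζ‖ := norm_pos_iff.2 (hf.deriv_ne_zero ⟨by linarith, by linarith⟩)
  have h5 := mul_le_mul_of_nonneg_left hk h0.le
  have h6 := mul_pos hn0 h0
  nlinarith

theorem exists_forall_closedCollar_ne {F₁ F₂ : ℂ → ℂ} (ha : a < 1) (h₁ : ContinuousOn F₁ (closedCollar a))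
    (h₂ : ContinuousOn F₂ (closedCollar a)) (hne : ∀ z w, ‖z‖ = 1 → ‖w‖ = 1 → z ≠ w → F₁ z ≠ F₂ w) {r : ℝ} (hr : 0 < r) :
    ∃ b < 1, a ≤ b ∧ ∀ z ∈ closedCollar b, ∀ w ∈ closedCollar b, r ≤ ‖z - w‖ → F₁ z ≠ F₂ w := by
  obtain ⟨c, hac, hc1⟩ := exists_between ha
  set C : Set (ℂ × ℂ) := (closedBall 0 1 ×ˢ closedBall 0 1) ∩ {p | c ≤ ‖p.1‖ ∧ c ≤ ‖p.2‖ ∧ r ≤ ‖p.1 - p.2‖} with hC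
  have hCc : IsCompact C := by
    refine ((isCompact_closedBall _ _).prod (isCompact_closedBall _ _)).inter_right ?_
    have c1 : Continuous fun p : ℂ × ℂ => ‖p.1‖ := by fun_prop
    have c2 : Continuous fun p : ℂ × ℂ => ‖p.2‖ := by fun_prop
    have c3 : Continuous fun p : ℂ × ℂ => ‖p.1 - p.2‖ := by fun_prop
    exact (isClosed_le continuous_const c1).inter ((isClosed_le continuous_const c2).inter
      (isClosed_le continuous_const c3))
  have hm1 : ∀ p ∈ C, p.1 ∈ closedCollar a := fun p hp => ⟨hac.trans_le hp.2.1, by simpa using hp.1.1⟩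
  have hm2 : ∀ p ∈ C, p.2 ∈ closedCollar a := fun p hp => ⟨hac.trans_le hp.2.2.1, by simpa using hp.1.2⟩
  have hcont : ContinuousOn (fun p : ℂ × ℂ => F₁ p.1 - F₂ p.2) C :=
    (h₁.comp continuousOn_fst hm1).sub (h₂.comp continuousOn_snd hm2)
  set K := C ∩ (fun p : ℂ × ℂ => F₁ p.1 - F₂ p.2) ⁻¹' {0} with hK
  have hKc : IsCompact K := by
    obtain ⟨u, hu, h⟩ := continuousOn_iff_isClosed.1 hcont {0} isClosed_singleton
    rw [hK, inter_comm, h, inter_comm]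
    exact hCc.inter_right hu
  rcases K.eq_empty_or_nonempty with h0 | h0
  · refine ⟨c, hc1, hac.le, fun z hz w hw hzw h => ?_⟩
    have : (z, w) ∈ K := ⟨⟨⟨by simpa using hz.2, by simpa using hw.2⟩, hz.1.le, hw.1.le, hzw⟩, sub_eq_zero.2 h⟩
    rw [h0] at this
    exact this
  · obtain ⟨p, hp, hmax⟩ := hKc.exists_isMaxOn h0 (f := fun p : ℂ × ℂ => min ‖p.1‖ ‖p.2‖) (by fun_prop)
    have hp1 : ‖p.1‖ ≤ 1 := by simpa using hp.1.1.1
    have hp2 : ‖p.2‖ ≤ 1 := by simpa using hp.1.1.2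
    have hlt : min ‖p.1‖ ‖p.2‖ < 1 := by
      by_contra h
      rw [not_lt, le_min_iff] at h
      refine hne p.1 p.2 (le_antisymm hp1 h.1) (le_antisymm hp2 h.2) ?_ (sub_eq_zero.1 hp.2)
      intro he
      have := hp.1.2.2.2
      rw [he, sub_self, norm_zero] at this
      linarith
    refine ⟨max c (min ‖p.1‖ ‖p.2‖), max_lt hc1 hlt, hac.le.trans (le_max_left _ _), fun z hz w hw hzw h => ?_⟩
    have hmem : (z, w) ∈ K := ⟨⟨⟨by simpa using hz.2, by simpa using hw.2⟩, ((le_max_left _ _).trans_lt hz.1).le,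
      ((le_max_left _ _).trans_lt hw.1).le, hzw⟩, sub_eq_zero.2 h⟩
    have h1 : min ‖z‖ ‖w‖ ≤ min ‖p.1‖ ‖p.2‖ := hmax hmem
    have h2 := lt_min ((le_max_right c (min ‖p.1‖ ‖p.2‖)).trans_lt hz.1) ((le_max_right c (min ‖p.1‖ ‖p.2‖)).trans_lt hw.1)
    linarith

theorem IsFlatOn.continuousOn_reflection (hf : IsFlatOn f a ε) (ha : 1 / 2 ≤ a) (hc : ContinuousOn f (closedCollar a))
    (hdec : ∀ η > 0, ∃ b < 1, ∀ z ∈ collar b, (1 - ‖z‖) * ‖deriv f z‖ ≤ η) :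
    ContinuousOn (reflection f) (closedCollar a) := by
  refine hc.add fun u hu => ?_
  have hu0 : conj u ≠ 0 := by
    have : u ≠ 0 := norm_pos_iff.1 (by linarith [hu.1])
    simpa using this
  rcases hu.2.lt_or_eq with h | h
  · refine ContinuousAt.continuousWithinAt ?_
    refine (ContinuousAt.sub (Complex.continuous_conj.continuousAt.inv₀ hu0) continuousAt_id).mul
      (hf.differentiableAt_deriv ⟨hu.1, h⟩).continuousAt
  · have h0 : ((conj u)⁻¹ - u) * deriv f u = 0 := by
      rw [inv_conj_sub (by simpa using hu0), h]; simp
    rw [ContinuousWithinAt, h0, Metric.tendsto_nhds]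
    intro η hη
    obtain ⟨b, hb1, hb⟩ := hdec (η / 6) (by positivity)
    have h1 : ∀ᶠ z in 𝓝 u, b < ‖z‖ := continuous_norm.continuousAt.eventually (lt_mem_nhds (hb1.trans_eq h.symm))
    filter_upwards [self_mem_nhdsWithin, mem_nhdsWithin_of_mem_nhds h1] with z hz hbz
    rw [dist_zero_right, norm_mul]
    have h2 := norm_inv_conj_sub_le (by linarith [hz.1]) hz.2
    have h3 := mul_le_mul_of_nonneg_right h2 (norm_nonneg (deriv f z))
    rcases hz.2.lt_or_eq with h4 | h4
    · have := hb z ⟨hbz, h4⟩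
      linarith
    · rw [h4] at h3
      linarith

theorem IsFlatOn.le_infDist (hf : IsFlatOn f a (1 / 10000)) (hc : ContinuousOn f (closedCollar a)) {S : Set ℂ}
    (hS : S.Nonempty) (hd : Disjoint (f '' collar a) S) (hz : ‖z‖ < 1) (ha : a < 1 - 4 * (1 - ‖z‖)) :
    (1 - ‖z‖) * ‖deriv f z‖ / 8 ≤ infDist (f z) S := by
  set m := 1 - ‖z‖ with hm
  have hm0 : 0 < m := by linarith
  have hzc : z ∈ collar a := ⟨by linarith, hz⟩
  have hD : 0 < ‖deriv f z‖ := norm_pos_iff.2 (hf.deriv_ne_zero hzc)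
  have hb : ∀ v ∈ closedBall z (m / 2), ‖v - z‖ ≤ m / 2 ∧ v ∈ collar a := by
    intro v hv
    rw [mem_closedBall, dist_eq_norm] at hv
    have h1 := norm_sub_norm_le v z
    have h2 := norm_sub_norm_le z v
    rw [norm_sub_rev] at h2
    exact ⟨hv, by linarith, by linarith⟩
  have hsub := DiffContOnCl.ball_subset_image_closedBall (f := f) (z₀ := z) (r := m / 2) (ε := m * ‖deriv f z‖ / 4)
    (hf.diff.diffContOnCl_ball fun v hv => (hb v hv).2) (by linarith) (fun v hv => ?_) ?_
  · refine (Metric.le_infDist hS).2 fun y hy => ?_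
    by_contra h
    rw [not_le] at h
    have h1 : y ∈ ball (f z) (m * ‖deriv f z‖ / 4 / 2) := by rw [mem_ball, dist_comm]; linarith
    obtain ⟨v, hv, rfl⟩ := hsub h1
    exact disjoint_left.1 hd (mem_image_of_mem f (hb v hv).2) hy
  · have h1 := hb v (sphere_subset_closedBall hv)
    have h2 := hf.box hc hz ha h1.2.2.le (by linarith)
    rw [mem_sphere, dist_eq_norm] at hv
    have h3 := norm_sub_norm_le (deriv f z * (v - z)) (-(f v - f z - deriv f z * (v - z)))
    rw [norm_neg, norm_mul, hv, sub_neg_eq_add] at h3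
    have e : deriv f z * (v - z) + (f v - f z - deriv f z * (v - z)) = f v - f z := by ring
    rw [e] at h3
    have := mul_pos hm0 hD
    linarith
  · have h1 : ∀ᶠ v in 𝓝[≠] z, f v ≠ f z := by
      filter_upwards [self_mem_nhdsWithin, mem_nhdsWithin_of_mem_nhds ((isOpen_collar a).mem_nhds hzc)] with v hv hv2
      exact fun h => hv (hf.inj hv2 hzc h)
    exact h1.frequently.filter_mono nhdsWithin_le_nhds

end ReflectionInjective

section BoundaryInjective
open Set Filter Topology
open scoped ENNReal ComplexConjugate

theorem isSimplyConnected_of_convex {E : Type*} [AddCommGroup E] [Module ℝ E] [TopologicalSpace E] [ContinuousAdd E]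
    [ContinuousSMul ℝ E] {s : Set E} (hs : Convex ℝ s) (hne : s.Nonempty) : IsSimplyConnected s := by
  have := hs.contractibleSpace hne
  unfold IsSimplyConnected
  infer_instance

theorem exists_continuous_log {c : ℝ → ℂ} (hc : Continuous c) (h0 : ∀ t, c t ≠ 0) :
    ∃ L : ℝ → ℂ, Continuous L ∧ ∀ t, Complex.exp (L t) = c t := by
  obtain ⟨L, h1, h2⟩ := Complex.exists_continuousOn_eqOn_exp_comp (isSimplyConnected_of_convex (convex_univ (𝕜 := ℝ) (E := ℝ)) univ_nonempty)
    isOpen_univ (g := c) hc.continuousOn (by simpa using h0)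
  exact ⟨L, continuousOn_univ.1 h1, fun t => h2 (mem_univ t)⟩

theorem eq_of_continuous_of_int {f : ℝ → ℝ} (hf : Continuous f) (h : ∀ x, ∃ n : ℤ, f x = n) (x y : ℝ) : f x = f y := by
  choose n hn using h
  have h1 : Continuous n := by
    rw [Int.isClosedEmbedding_coe_real.isEmbedding.continuous_iff]
    exact hf.congr hn
  rw [hn, hn, PreconnectedSpace.constant inferInstance h1 (x := x) (y := y)]

theorem exists_int_of_exp_eq {L₁ L₂ : ℝ → ℂ} (h₁ : Continuous L₁) (h₂ : Continuous L₂)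
    (h : ∀ t, Complex.exp (L₁ t) = Complex.exp (L₂ t)) : ∃ n : ℤ, ∀ t, L₁ t = L₂ t + n * (2 * π * Complex.I) := by
  have h3 : ∀ t, ∃ n : ℤ, L₁ t = L₂ t + n * (2 * π * Complex.I) := fun t => Complex.exp_eq_exp_iff_exists_int.1 (h t)
  choose n hn using h3
  have hc : Continuous fun t => ((L₁ t - L₂ t) / (2 * π * Complex.I)).re := by fun_prop
  have e : ∀ t, ((L₁ t - L₂ t) / (2 * π * Complex.I)).re = n t := by
    intro t
    rw [hn t, add_sub_cancel_left, mul_div_cancel_right₀ _ Complex.two_pi_I_ne_zero]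
    simp
  refine ⟨n 0, fun t => ?_⟩
  have := eq_of_continuous_of_int hc (fun t => ⟨n t, e t⟩) t 0
  rw [e, e] at this
  rw [hn t, Int.cast_inj.1 this]

theorem injective_of_locally_injective {τ : ℝ → ℝ} (hτ : Continuous τ) {r : ℝ} (hr : 0 < r)
    (h : ∀ x y, |x - y| < r → τ x = τ y → x = y) : Function.Injective τ := by
  have key : ∀ x y, x < y → τ x ≠ τ y := by
    intro x y hxy he
    obtain ⟨c, -, hc⟩ := exists_isLocalExtr_Ioo hxy hτ.continuousOn he
    wlog hmax : IsLocalMax τ c generalizing τ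
    · have hmin : IsLocalMin τ c := hc.resolve_right hmax
      refine this (τ := fun x => -τ x) hτ.neg (fun x y hxy h' => h x y hxy (neg_injective h')) (by simp [he]) ?_ ?_
      · exact Or.inr hmin.neg
      · exact hmin.neg
    obtain ⟨δ, hδ, hball⟩ := Metric.eventually_nhds_iff.1 hmax
    set s := min δ r / 4 with hs
    have hs0 : 0 < s := by have := lt_min hδ hr; positivity
    have hsδ : s < δ := by have := min_le_left δ r; linarith
    have hsr : 4 * s ≤ r := by have := min_le_right δ r; linarith
    have h1 : τ (c - s) ≤ τ c := hball (by rw [Real.dist_eq, abs_lt]; constructor <;> linarith)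
    have h2 : τ (c + s) ≤ τ c := hball (by rw [Real.dist_eq, abs_lt]; constructor <;> linarith)
    rcases le_total (τ (c - s)) (τ (c + s)) with h3 | h3
    · obtain ⟨x, hx, hx'⟩ := intermediate_value_Icc (show c - s ≤ c by linarith) hτ.continuousOn ⟨h3, h2⟩
      have := h x (c + s) (by rw [abs_lt]; constructor <;> linarith [hx.1, hx.2]) hx'
      linarith [hx.2]
    · obtain ⟨x, hx, hx'⟩ := intermediate_value_Icc' (show c ≤ c + s by linarith) hτ.continuousOn ⟨h3, h1⟩
      have := h x (c - s) (by rw [abs_lt]; constructor <;> linarith [hx.1, hx.2]) hx'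
      linarith [hx.1]
  intro x y hxy
  rcases lt_trichotomy x y with h1 | h1 | h1
  · exact absurd hxy (key x y h1)
  · exact h1
  · exact absurd hxy.symm (key y x h1)

variable {γ : ℝ → ℂ} {f k : ℂ → ℂ} {a : ℝ} {q : ℂ}

theorem exp_add_int_mul_two_pi (t : ℝ) (n : ℤ) :
    Complex.exp ((t + n • (2 * π) : ℝ) * Complex.I) = Complex.exp (t * Complex.I) := by
  rw [Complex.exp_eq_exp_iff_exists_int]
  exact ⟨n, by push_cast [zsmul_eq_mul]; ring⟩

theorem exists_circle_chart (hγc : Continuous γ) (hγp : ∀ θ, γ (θ + 2 * π) = γ θ) (hγi : InjOn γ (Ico 0 (2 * π))) :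
    ∃ Φ : ℂ → ℂ, ContinuousOn Φ (range γ) ∧ ∀ t : ℝ, Φ (γ t) = Complex.exp (t * Complex.I) := by
  have hp : Function.Periodic γ (2 * π) := hγp
  have hred : ∀ t : ℝ, ∃ n : ℤ, t + n • (2 * π) ∈ Ico (0:ℝ) (2 * π) := fun t => by
    obtain ⟨n, hn, -⟩ := existsUnique_add_zsmul_mem_Ico two_pi_pos t 0
    exact ⟨n, by simpa using hn⟩
  set Φ : ℂ → ℂ := fun p => Complex.exp (Function.invFunOn γ (Ico 0 (2 * π)) p * Complex.I) with hΦ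
  have hΦγ : ∀ t : ℝ, Φ (γ t) = Complex.exp (t * Complex.I) := by
    intro t
    obtain ⟨n, hn⟩ := hred t
    rw [← (hp.zsmul n) t, hΦ]
    simp only
    rw [hγi.leftInvOn_invFunOn hn, exp_add_int_mul_two_pi]
  refine ⟨Φ, continuousOn_iff_isClosed.2 fun C hC => ?_, hΦγ⟩
  refine ⟨γ '' (Icc 0 (2 * π) ∩ (fun t : ℝ => Complex.exp (t * Complex.I)) ⁻¹' C), ?_, ?_⟩
  · exact ((isCompact_Icc.inter_right (hC.preimage (by fun_prop))).image hγc).isClosed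
  · ext p
    constructor
    · rintro ⟨hp1, t, rfl⟩
      obtain ⟨n, hn⟩ := hred t
      refine ⟨⟨t + n • (2 * π), ⟨Ico_subset_Icc_self hn, ?_⟩, (hp.zsmul n) t⟩, mem_range_self t⟩
      rw [mem_preimage, hΦγ] at hp1
      rw [mem_preimage, exp_add_int_mul_two_pi]
      exact hp1
    · rintro ⟨⟨t, ht, rfl⟩, -⟩
      exact ⟨by rw [mem_preimage, hΦγ]; exact ht.2, mem_range_self t⟩

theorem norm_exp_mul_I (t : ℝ) : ‖Complex.exp (t * Complex.I)‖ = 1 := Complex.norm_exp_ofReal_mul_I t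

theorem exists_boundary_log (ha0 : 0 ≤ a) (ha : a < 1) (hc : ContinuousOn f (closedCollar a))
    (hk : DifferentiableOn ℂ k (ball 0 1)) (hk0 : ∀ z ∈ ball (0:ℂ) 1, k z ≠ 0)
    (hfk : ∀ z ∈ collar a, (f z - q) * (z * k z) = 1) (hq : ∀ z, ‖z‖ = 1 → f z ≠ q) :
    ∃ P : ℝ → ℂ, Continuous P ∧ (∀ θ, P (θ + 2 * π) = P θ) ∧
      ∀ θ : ℝ, Complex.exp (P θ - θ * Complex.I) = f (Complex.exp (θ * Complex.I)) - q := by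
  obtain ⟨b, hab, hb1⟩ := exists_between ha
  obtain ⟨ℓ, hℓ, hℓk⟩ := Complex.exists_continuousOn_eqOn_exp_comp
    (isSimplyConnected_of_convex (convex_ball (0:ℂ) 1) ⟨0, mem_ball_self one_pos⟩) isOpen_ball (g := k) hk.continuousOn
    (by rintro ⟨z, hz, h⟩; exact hk0 z hz h)
  set K : Set ℂ := closedBall 0 1 ∩ {z | b ≤ ‖z‖} with hK
  have hKc : IsCompact K := (isCompact_closedBall _ _).inter_right (isClosed_le continuous_const continuous_norm)
  have hKs : K ⊆ closedCollar a := fun z hz => ⟨hab.trans_le hz.2, by simpa using hz.1⟩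
  have hu := hKc.uniformContinuousOn_of_continuous (hc.mono hKs)
  have hS : IsCompact (sphere (0:ℂ) 1) := isCompact_sphere 0 1
  have hSK : sphere (0:ℂ) 1 ⊆ K := fun z hz =>
    ⟨sphere_subset_closedBall hz, by rw [mem_sphere_zero_iff_norm] at hz; simpa [hz] using hb1.le⟩
  obtain ⟨z0, hz0, hmin⟩ := hS.exists_isMinOn (NormedSpace.sphere_nonempty.2 zero_le_one) (f := fun z => ‖f z - q‖)
    (((hc.mono (hSK.trans hKs)).sub continuousOn_const).norm)
  have hc0 : 0 < ‖f z0 - q‖ := norm_pos_iff.2 (sub_ne_zero.2 (hq z0 (by simpa using hz0)))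
  obtain ⟨δ, hδ, hδ'⟩ := Metric.uniformContinuousOn_iff.1 hu _ hc0
  obtain ⟨r, hr, hr1⟩ := exists_between (show max b (1 - δ) < 1 from max_lt hb1 (by linarith))
  rw [max_lt_iff] at hr
  have hr0 : 0 < r := by linarith
  set e : ℝ → ℂ := fun θ => Complex.exp (θ * Complex.I) with he
  have hen : ∀ θ, ‖e θ‖ = 1 := norm_exp_mul_I
  have hec : Continuous e := by fun_prop
  have hep : ∀ θ, e (θ + 2 * π) = e θ := fun θ => by
    have := exp_add_int_mul_two_pi θ 1
    rwa [one_smul] at this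
  have hrn : ∀ θ, ‖(r:ℂ) * e θ‖ = r := fun θ => by rw [norm_mul, hen, Complex.norm_real, Real.norm_of_nonneg hr0.le, mul_one]
  have hrb : ∀ θ, (r:ℂ) * e θ ∈ ball (0:ℂ) 1 := fun θ => by rw [mem_ball_zero_iff, hrn]; exact hr1
  have hrc : ∀ θ, (r:ℂ) * e θ ∈ collar a := fun θ => ⟨by rw [hrn]; linarith, by rw [hrn]; exact hr1⟩
  have heS : ∀ θ, e θ ∈ sphere (0:ℂ) 1 := fun θ => by rw [mem_sphere_zero_iff_norm, hen]
  have hφ0 : ∀ θ, f (e θ) - q ≠ 0 := fun θ => sub_ne_zero.2 (hq _ (hen θ))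
  have hclose : ∀ θ, ‖f (r * e θ) - f (e θ)‖ < ‖f (e θ) - q‖ := by
    intro θ
    have h1 : ‖f z0 - q‖ ≤ ‖f (e θ) - q‖ := hmin (heS θ)
    refine lt_of_lt_of_le ?_ h1
    rw [← dist_eq_norm]
    refine hδ' _ ⟨(ball_subset_closedBall (hrb θ)), ?_⟩ _ (hSK (heS θ)) ?_
    · rw [mem_ofPred_eq, hrn]; exact hr.1.le
    · have : (r:ℂ) * e θ - e θ = -((1 - r : ℝ) * e θ) := by push_cast; ring
      rw [dist_eq_norm, this, norm_neg, norm_mul, hen, Complex.norm_real, Real.norm_of_nonneg (by linarith)]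
      linarith
  set ρ : ℝ → ℂ := fun θ => (f (r * e θ) - q) / (f (e θ) - q) with hρ
  have hslit : ∀ θ, ρ θ ∈ Complex.slitPlane := by
    intro θ
    have h1 : ρ θ = 1 + (f (r * e θ) - f (e θ)) / (f (e θ) - q) := by
      rw [hρ]; field_simp [hφ0 θ]; ring
    rw [h1]
    refine Complex.mem_slitPlane_of_norm_lt_one ?_
    rw [norm_div, div_lt_one (norm_pos_iff.2 (hφ0 θ))]
    exact hclose θ
  have hfe : Continuous fun θ => f (e θ) := hc.comp_continuous hec fun θ => hKs (hSK (heS θ))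
  have hfr : Continuous fun θ => f (r * e θ) := hc.comp_continuous (by fun_prop) fun θ => collar_subset_closedCollar (hrc θ)
  have hρc : Continuous ρ := (hfr.sub continuous_const).div (hfe.sub continuous_const) hφ0
  refine ⟨fun θ => -(Real.log r : ℂ) - ℓ (r * e θ) - Complex.log (ρ θ), ?_, fun θ => ?_, fun θ => ?_⟩
  · exact (continuous_const.sub (hℓ.comp_continuous (by fun_prop) hrb)).sub (hρc.clog hslit)
  · simp only [hρ, hep]
  · have h1 : f (r * e θ) - q ≠ 0 := fun h => by
      have := hfk _ (hrc θ)
      rw [h, zero_mul] at this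
      exact zero_ne_one this
    have h2 : ρ θ ≠ 0 := Complex.slitPlane_ne_zero (hslit θ)
    have h3 := hfk _ (hrc θ)
    have h4 : Complex.exp (ℓ (r * e θ)) = k (r * e θ) := hℓk (hrb θ)
    have h5 : Complex.exp (Real.log r) = r := by rw [← Complex.ofReal_exp, Real.exp_log hr0]
    have h6 : Complex.exp (θ * Complex.I) = e θ := rfl
    rw [Complex.exp_sub, Complex.exp_sub, Complex.exp_sub, Complex.exp_neg, Complex.exp_log h2, h4, h5, h6]
    have h7 : k (r * e θ) ≠ 0 := hk0 _ (hrb θ)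
    have h8 : e θ ≠ 0 := Complex.exp_ne_zero _
    have h9 : (r:ℂ) ≠ 0 := Complex.ofReal_ne_zero.2 hr0.ne'
    rw [hρ]
    have h10 := hφ0 θ
    field_simp
    linear_combination (-1 : ℂ) * h3

theorem exists_int_of_exp_mul_I_eq {x y : ℝ} (h : Complex.exp (x * Complex.I) = Complex.exp (y * Complex.I)) :
    ∃ n : ℤ, x = y + n • (2 * π) := by
  obtain ⟨n, hn⟩ := Complex.exp_eq_exp_iff_exists_int.1 h
  refine ⟨n, ?_⟩
  have h1 := congrArg Complex.im hn
  simpa [zsmul_eq_mul] using h1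

theorem add_zsmul_of_add {E : Type*} [AddCommGroup E] {τ : ℝ → E} {c : ℝ} {v : E} (h : ∀ x, τ (x + c) = τ x + v) (n : ℤ) (x : ℝ) :
    τ (x + n • c) = τ x + n • v := by
  induction n with
  | zero => simp
  | succ n ih => rw [add_zsmul, one_zsmul, ← add_assoc, h, ih, add_zsmul, one_zsmul, add_assoc]
  | pred n ih =>
    have h1 := h (x + (-(n:ℤ) - 1) • c)
    rw [add_assoc, ← add_one_zsmul, sub_add_cancel, ih] at h1
    have h2 : (-(n:ℤ) - 1) • v = -(n:ℤ) • v - v := by rw [sub_zsmul, one_zsmul, sub_eq_add_neg]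
    rw [← sub_eq_iff_eq_add] at h1
    rw [← h1, h2, add_sub_assoc]

theorem injOn_sphere_of_locally_injective (hγc : Continuous γ) (hγp : ∀ θ, γ (θ + 2 * π) = γ θ)
    (hγi : InjOn γ (Ico 0 (2 * π))) (ha0 : 0 ≤ a) (ha : a < 1) (hc : ContinuousOn f (closedCollar a))
    (hk : DifferentiableOn ℂ k (ball 0 1)) (hk0 : ∀ z ∈ ball (0:ℂ) 1, k z ≠ 0)
    (hfk : ∀ z ∈ collar a, (f z - q) * (z * k z) = 1) (hq : q ∉ range γ) (hf : ∀ z, ‖z‖ = 1 → f z ∈ range γ)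
    {r : ℝ} (hr : 0 < r) (hloc : ∀ z w, ‖z‖ = 1 → ‖w‖ = 1 → ‖z - w‖ < r → z ≠ w → f z ≠ f w) :
    (∀ z w, ‖z‖ = 1 → ‖w‖ = 1 → z ≠ w → f z ≠ f w) ∧ ∀ t, ∃ z, ‖z‖ = 1 ∧ f z = γ t := by
  obtain ⟨Φ, hΦ, hΦγ⟩ := exists_circle_chart hγc hγp hγi
  obtain ⟨P, hP, hPp, hPf⟩ := exists_boundary_log ha0 ha hc hk hk0 hfk (fun z hz h => hq (h ▸ hf z hz))
  have hγz : ∀ (n : ℤ) (t : ℝ), γ (t + n • (2 * π)) = γ t := fun n t => (Function.Periodic.zsmul hγp n) t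
  have hγΦ : ∀ s t : ℝ, Complex.exp (s * Complex.I) = Complex.exp (t * Complex.I) → γ s = γ t := by
    intro s t h
    obtain ⟨n, rfl⟩ := exists_int_of_exp_mul_I_eq h
    exact hγz n t
  set e : ℝ → ℂ := fun θ => Complex.exp (θ * Complex.I) with he
  have hen : ∀ θ, ‖e θ‖ = 1 := norm_exp_mul_I
  have hec : Continuous e := by fun_prop
  have hep : ∀ (n : ℤ) θ, e (θ + n • (2 * π)) = e θ := fun n θ => exp_add_int_mul_two_pi θ n
  have hep1 : ∀ θ, e (θ + 2 * π) = e θ := fun θ => by simpa using hep 1 θ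
  have hfe : Continuous fun θ => f (e θ) := hc.comp_continuous hec fun θ => ⟨by rw [hen]; exact ha, (hen θ).le⟩
  have hfΓ : ∀ θ, f (e θ) ∈ range γ := fun θ => hf _ (hen θ)
  have hcn : ∀ θ, ‖Φ (f (e θ))‖ = 1 := fun θ => by
    obtain ⟨t, ht⟩ := hfΓ θ
    rw [← ht, hΦγ]
    exact norm_exp_mul_I t
  obtain ⟨L, hL, hLe⟩ := exists_continuous_log (c := fun θ => Φ (f (e θ))) (hΦ.comp_continuous hfe hfΓ) (fun θ => norm_pos_iff.1 (by rw [hcn]; exact one_pos))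
  obtain ⟨lam, hlam, hlame⟩ := exists_continuous_log (c := fun t => γ t - q) (by fun_prop)
    (fun t h => hq ⟨t, sub_eq_zero.1 h⟩)
  set τ : ℝ → ℝ := fun θ => (L θ).im with hτ
  have hτc : Continuous τ := Complex.continuous_im.comp hL
  have hτe : ∀ θ, Complex.exp (τ θ * Complex.I) = Φ (f (e θ)) := by
    intro θ
    rw [← hLe]
    congr 1
    have h1 : Real.exp (L θ).re = 1 := by rw [← Complex.norm_exp, hLe, hcn]
    rw [Real.exp_eq_one_iff] at h1
    apply Complex.ext <;> simp [hτ, h1]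
  have hγτ : ∀ θ, γ (τ θ) = f (e θ) := by
    intro θ
    obtain ⟨t, ht⟩ := hfΓ θ
    rw [← ht]
    refine hγΦ _ _ ?_
    rw [hτe, ← ht, hΦγ]
  obtain ⟨d, hd⟩ := exists_int_of_exp_eq (L₁ := fun θ => τ (θ + 2 * π) * Complex.I) (L₂ := fun θ => τ θ * Complex.I)
    (by fun_prop) (by fun_prop) (fun θ => by rw [hτe, hτe, hep1])
  have hτd : ∀ θ, τ (θ + 2 * π) = τ θ + d • (2 * π) := fun θ => by
    have := congrArg Complex.im (hd θ)
    simpa [zsmul_eq_mul] using this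
  obtain ⟨N, hN⟩ := exists_int_of_exp_eq (L₁ := fun t => lam (t + 2 * π)) (L₂ := lam)
    (by fun_prop) hlam (fun t => by rw [hlame, hlame, hγp])
  obtain ⟨n, hn⟩ := exists_int_of_exp_eq (L₁ := fun θ => lam (τ θ)) (L₂ := fun θ => P θ - θ * Complex.I)
    (by fun_prop) (by fun_prop) (fun θ => by rw [hlame, hPf, hγτ])
  have hdN : d * N = -1 := by
    have h1 := add_zsmul_of_add hN d (τ 0)
    rw [← hτd, hn, hn, hPp] at h1
    have h2 : (2 * π * Complex.I : ℂ) ≠ 0 := Complex.two_pi_I_ne_zero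
    have h3 : ((d * N : ℤ) : ℂ) * (2 * π * Complex.I) = (-1 : ℂ) * (2 * π * Complex.I) := by
      push_cast
      rw [zsmul_eq_mul] at h1
      push_cast at h1
      linear_combination -h1
    have h4 := mul_right_cancel₀ h2 h3
    exact_mod_cast h4
  have hdd : d * d = 1 := by
    rcases Int.isUnit_iff.1 (IsUnit.of_mul_eq_one (-N) (by rw [mul_neg, hdN, neg_neg])) with h | h <;> rw [h] <;> norm_num
  have hτn : ∀ (n : ℤ) θ, τ (θ + n • (2 * π)) = τ θ + n • (d • (2 * π)) := fun n θ => add_zsmul_of_add hτd n θ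
  have hτi : Function.Injective τ := by
    refine injective_of_locally_injective hτc (lt_min hr one_pos) fun x y hxy h => ?_
    have h1 : f (e x) = f (e y) := by rw [← hγτ, ← hγτ, h]
    have h2 : ‖e x - e y‖ ≤ |x - y| := by
      have h3 : e x - e y = e y * (Complex.exp (Complex.I * (x - y : ℝ)) - 1) := by
        rw [he]; simp only
        rw [mul_sub, ← Complex.exp_add, mul_one]
        congr 2
        push_cast; ring
      rw [h3, norm_mul, hen, one_mul]
      simpa using Real.norm_exp_I_mul_ofReal_sub_one_le (x := x - y)
    have h4 : e x = e y := by
      by_contra hne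
      exact hloc _ _ (hen x) (hen y) (h2.trans_lt (hxy.trans_le (min_le_left _ _))) hne h1
    obtain ⟨m, hm⟩ := exists_int_of_exp_mul_I_eq h4
    have h5 : |x - y| < 1 := hxy.trans_le (min_le_right _ _)
    have h6 : m = 0 := by
      by_contra hm0
      have h7 : (1:ℝ) ≤ |(m:ℝ)| := by exact_mod_cast Int.one_le_abs hm0
      rw [hm, add_sub_cancel_left, zsmul_eq_mul, abs_mul, abs_of_pos two_pi_pos] at h5
      nlinarith [pi_gt_three]
    rw [hm, h6]; simp
  have hsurj : ∀ z : ℂ, ‖z‖ = 1 → ∃ θ, e θ = z := fun z hz => by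
    refine ⟨z.arg, ?_⟩
    have := Complex.norm_mul_exp_arg_mul_I z
    rwa [hz, Complex.ofReal_one, one_mul] at this
  refine ⟨?_, fun t => ?_⟩
  · intro z w hz hw hne h
    obtain ⟨x, rfl⟩ := hsurj z hz
    obtain ⟨y, rfl⟩ := hsurj w hw
    have h1 : Complex.exp (τ x * Complex.I) = Complex.exp (τ y * Complex.I) := by rw [hτe, hτe, h]
    obtain ⟨m, hm⟩ := exists_int_of_exp_mul_I_eq h1
    have h2 : τ x = τ (y + (m * d) • (2 * π)) := by
      rw [hτn, hm, smul_smul, mul_assoc, hdd, mul_one]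
    have h3 := hτi h2
    rw [h3, hep] at hne
    exact hne rfl
  · obtain ⟨m, hm⟩ := exists_nat_ge |t - τ 0|
    have h2 : |t - τ 0| ≤ m * (2 * π) := by nlinarith [pi_gt_three, (Nat.cast_nonneg m : (0:ℝ) ≤ m)]
    rw [abs_le] at h2
    have e1 : τ (0 + ((m:ℤ) * d) • (2 * π)) = τ 0 + m * (2 * π) := by
      rw [hτn, smul_smul, mul_assoc, hdd, mul_one, zsmul_eq_mul]; simp
    have e2 : τ (0 + ((-(m:ℤ)) * d) • (2 * π)) = τ 0 - m * (2 * π) := by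
      rw [hτn, smul_smul, mul_assoc, hdd, mul_one, zsmul_eq_mul]; simp; ring
    obtain ⟨θ, hθ⟩ := mem_range_of_exists_le_of_exists_ge hτc (c := t) ⟨_, e2.le.trans (by linarith)⟩
      ⟨_, (by linarith : t ≤ τ 0 + m * (2 * π)).trans e1.ge⟩
    exact ⟨e θ, hen θ, by rw [← hγτ, hθ]⟩

end BoundaryInjective

section ReflectionDerivative
open Set Filter Topology
open scoped ENNReal ComplexConjugate

/-- The inverse of `v ↦ α v + β v̄` when its determinant does not vanish. -/
noncomputable def wirtingerEquiv (α β : ℂ) (h : ‖α‖ ^ 2 - ‖β‖ ^ 2 ≠ 0) : ℂ ≃L[ℝ] ℂ :=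
  ContinuousLinearEquiv.equivOfInverse (wirtinger α β)
    (wirtinger (conj α / ((‖α‖ ^ 2 - ‖β‖ ^ 2 : ℝ) : ℂ)) (-β / ((‖α‖ ^ 2 - ‖β‖ ^ 2 : ℝ) : ℂ)))
    (fun v => by
      have hD : ((‖α‖ ^ 2 - ‖β‖ ^ 2 : ℝ) : ℂ) ≠ 0 := Complex.ofReal_ne_zero.2 h
      have h1 : ((‖α‖ ^ 2 - ‖β‖ ^ 2 : ℝ) : ℂ) = conj α * α - conj β * β := by
        push_cast; rw [Complex.conj_mul', Complex.conj_mul']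
      simp only [wirtinger_apply, map_add, map_mul, Complex.conj_conj]
      field_simp
      rw [h1]; ring)
    (fun v => by
      have hD : ((‖α‖ ^ 2 - ‖β‖ ^ 2 : ℝ) : ℂ) ≠ 0 := Complex.ofReal_ne_zero.2 h
      have h1 : ((‖α‖ ^ 2 - ‖β‖ ^ 2 : ℝ) : ℂ) = conj α * α - conj β * β := by
        push_cast; rw [Complex.conj_mul', Complex.conj_mul']
      simp only [wirtinger_apply, map_add, map_mul, map_div₀, map_neg, Complex.conj_conj, Complex.conj_ofReal]
      field_simp
      rw [h1]; ring)

theorem coe_wirtingerEquiv (α β : ℂ) (h : ‖α‖ ^ 2 - ‖β‖ ^ 2 ≠ 0) :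
    (wirtingerEquiv α β h : ℂ →L[ℝ] ℂ) = wirtinger α β := rfl

theorem coe_wirtingerEquiv_symm (α β : ℂ) (h : ‖α‖ ^ 2 - ‖β‖ ^ 2 ≠ 0) :
    ((wirtingerEquiv α β h).symm : ℂ →L[ℝ] ℂ) =
      wirtinger (conj α / ((‖α‖ ^ 2 - ‖β‖ ^ 2 : ℝ) : ℂ)) (-β / ((‖α‖ ^ 2 - ‖β‖ ^ 2 : ℝ) : ℂ)) := rfl

variable {f g : ℂ → ℂ} {a ε : ℝ} {z : ℂ}

theorem hasFDerivAt_inv_conj (hz : z ≠ 0) :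
    HasFDerivAt (fun z : ℂ => (conj z)⁻¹) (wirtinger 0 (-((conj z) ^ 2)⁻¹)) z := by
  have h1 : HasFDerivAt (fun z : ℂ => conj z) (Complex.conjCLE : ℂ →L[ℝ] ℂ) z := Complex.conjCLE.hasFDerivAt
  have h2 := (hasFDerivAt_wirtinger (hasDerivAt_inv ((map_ne_zero conj).2 hz))).comp z h1
  refine h2.congr_fderiv ?_
  ext v; simp

theorem IsFlatOn.hasFDerivAt_reflection (hf : IsFlatOn f a ε) (hz : z ∈ collar a) (hz0 : z ≠ 0) :
    HasFDerivAt (reflection f)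
      (wirtinger (((conj z)⁻¹ - z) * deriv (deriv f) z) (-((conj z) ^ 2)⁻¹ * deriv f z)) z := by
  have h1 := hasFDerivAt_wirtinger (hf.differentiableAt hz).hasDerivAt
  have h2 := hasFDerivAt_wirtinger (hf.differentiableAt_deriv hz).hasDerivAt
  have h3 := (hasFDerivAt_inv_conj hz0).sub (hasFDerivAt_wirtinger (hasDerivAt_id z))
  refine (h1.add (h3.mul h2)).congr_fderiv ?_
  ext v; simp; ring

theorem IsFlatOn.contDiffAt_reflection (hf : IsFlatOn f a ε) (hz : z ∈ collar a) (hz0 : z ≠ 0) :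
    ContDiffAt ℝ 1 (reflection f) z := by
  have h1 : ContDiffAt ℂ 1 f z := (hf.diff.analyticAt ((isOpen_collar a).mem_nhds hz)).contDiffAt
  have h2 : ContDiffAt ℂ 1 (deriv f) z := (hf.diff.analyticAt ((isOpen_collar a).mem_nhds hz)).deriv.contDiffAt
  have h3 : ContDiffAt ℝ 1 (fun z : ℂ => conj z) z := Complex.conjCLE.contDiff.contDiffAt
  exact (h1.restrict_scalars ℝ).add (((h3.inv ((map_ne_zero conj).2 hz0)).sub contDiffAt_id).mul (h2.restrict_scalars ℝ))

theorem contDiffAt_leftInverse {φ : ℂ → ℂ} {U : Set ℂ} (hU : IsOpen U) (hg : DifferentiableOn ℂ g U)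
    (hφ : ∀ z ∈ U, φ (g z) = z) (hz : z ∈ U) : ContDiffAt ℝ 1 φ (g z) := by
  have hi : InjOn g U := fun x hx y hy h => by rw [← hφ x hx, ← hφ y hy, h]
  have h1 : DifferentiableOn ℂ φ (g '' U) := by
    rintro _ ⟨x, hx, rfl⟩
    exact (hasDerivAt_leftInverse hU hg hφ hx).differentiableAt.differentiableWithinAt
  have h2 : ContDiffAt ℂ 1 φ (g z) :=
    (h1.analyticAt ((isOpen_image_of_injOn hU hg hi).mem_nhds (mem_image_of_mem g hz))).contDiffAt
  exact h2.restrict_scalars ℝ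

theorem isPreconnected_collar (ha : 0 ≤ a) : IsPreconnected (collar a) := by
  have h : collar a = (fun p : ℝ × ℝ => (p.1 : ℂ) * Complex.exp (p.2 * Complex.I)) '' (Ioo a 1 ×ˢ univ) := by
    ext z
    constructor
    · intro hz
      exact ⟨(‖z‖, z.arg), ⟨hz, mem_univ _⟩, Complex.norm_mul_exp_arg_mul_I z⟩
    · rintro ⟨⟨r, t⟩, ⟨hr, -⟩, rfl⟩
      have : ‖(r : ℂ) * Complex.exp (t * Complex.I)‖ = r := by
        rw [norm_mul, norm_exp_mul_I, mul_one, Complex.norm_real, Real.norm_of_nonneg (ha.trans hr.1.le)]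
      exact ⟨by rw [this]; exact hr.1, by rw [this]; exact hr.2⟩
  rw [h]
  exact (isPreconnected_Ioo.prod isPreconnected_univ).image _ (by fun_prop)

end ReflectionDerivative

section Gluing
open Set Filter Topology
open scoped ENNReal ComplexConjugate

variable {f g : ℂ → ℂ} {a ε : ℝ} {z : ℂ}

/-- `f` is flat on a collar, extends continuously to the circle, and its reflection maps the collar
into the image of the univalent function `g`. -/
structure IsGlued (f g : ℂ → ℂ) (a : ℝ) : Prop where
  flat : IsFlatOn f a (1 / 10000)
  half_le : 1 / 2 ≤ a
  lt_one : a < 1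
  cont : ContinuousOn f (closedCollar a)
  decay : ∀ η > 0, ∃ b < 1, ∀ z ∈ collar b, (1 - ‖z‖) * ‖deriv f z‖ ≤ η
  diff : DifferentiableOn ℂ g (ball 0 1)
  inj : InjOn g (ball 0 1)
  injOn : InjOn (reflection f) (closedCollar a)
  maps : ∀ z ∈ collar a, reflection f z ∈ g '' ball 0 1
  boundary : ∀ z, ‖z‖ = 1 → f z ∉ g '' ball 0 1

/-- The map `g⁻¹ ∘ E`, where `E` is the reflection of `f`. -/
noncomputable def transition (f g : ℂ → ℂ) (z : ℂ) : ℂ := Function.invFunOn g (ball 0 1) (reflection f z)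

namespace IsGlued

theorem mono (h : IsGlued f g a) {b : ℝ} (hab : a ≤ b) (hb : b < 1) : IsGlued f g b :=
  ⟨h.flat.mono hab, h.half_le.trans hab, hb, h.cont.mono (closedCollar_subset hab), h.decay, h.diff, h.inj,
    h.injOn.mono (closedCollar_subset hab), fun z hz => h.maps z (collar_subset hab hz), h.boundary⟩

theorem ne_zero (h : IsGlued f g a) (hz : z ∈ collar a) : z ≠ 0 := fun h0 => by
  have h1 := hz.1
  have h2 := h.half_le
  rw [h0, norm_zero] at h1
  linarith

theorem transition_mem (h : IsGlued f g a) (hz : z ∈ collar a) : transition f g z ∈ ball (0:ℂ) 1 :=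
  Function.invFunOn_mem (h.maps z hz)

theorem apply_transition (h : IsGlued f g a) (hz : z ∈ collar a) : g (transition f g z) = reflection f z :=
  Function.invFunOn_eq (h.maps z hz)

theorem deriv_ne_zero (h : IsGlued f g a) (hz : z ∈ collar a) : deriv g (transition f g z) ≠ 0 :=
  deriv_ne_zero_of_injOn isOpen_ball h.diff h.inj (h.transition_mem hz)

theorem injOn_transition (h : IsGlued f g a) : InjOn (transition f g) (collar a) := fun z hz w hw e => by
  refine h.injOn (collar_subset_closedCollar hz) (collar_subset_closedCollar hw) ?_
  rw [← h.apply_transition hz, ← h.apply_transition hw, e]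

theorem contDiffAt_transition (h : IsGlued f g a) (hz : z ∈ collar a) : ContDiffAt ℝ 1 (transition f g) z := by
  have h1 := contDiffAt_leftInverse isOpen_ball h.diff (fun w hw => h.inj.leftInvOn_invFunOn hw) (h.transition_mem hz)
  rw [h.apply_transition hz] at h1
  exact h1.comp z (h.flat.contDiffAt_reflection hz (h.ne_zero hz))

theorem hasFDerivAt_transition (h : IsGlued f g a) (hz : z ∈ collar a) :
    HasFDerivAt (transition f g)
      (wirtinger ((deriv g (transition f g z))⁻¹ * (((conj z)⁻¹ - z) * deriv (deriv f) z))
        ((deriv g (transition f g z))⁻¹ * (-((conj z) ^ 2)⁻¹ * deriv f z))) z := by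
  have h1 := hasDerivAt_leftInverse isOpen_ball h.diff (fun w hw => h.inj.leftInvOn_invFunOn hw) (h.transition_mem hz)
  rw [h.apply_transition hz] at h1
  refine ((hasFDerivAt_wirtinger h1).comp z (h.flat.hasFDerivAt_reflection hz (h.ne_zero hz))).congr_fderiv ?_
  ext v
  simp
  ring

/-- The dilatation bound for the reflection. -/
theorem dilatation_le (h : IsGlued f g a) (hz : z ∈ collar a) :
    ‖((conj z)⁻¹ - z) * deriv (deriv f) z‖ ≤ 1 / 2 * ‖-((conj z) ^ 2)⁻¹ * deriv f z‖ := by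
  have h1 := norm_inv_conj_sub_le (h.half_le.trans hz.1.le) hz.2.le
  have h2 := h.flat.bound z hz
  have h3 : ‖deriv f z‖ ≤ ‖-((conj z) ^ 2)⁻¹ * deriv f z‖ := by
    rw [norm_mul, norm_neg, norm_inv, norm_pow, RCLike.norm_conj]
    refine le_mul_of_one_le_left (norm_nonneg _) ((one_le_inv₀ ?_).2 ?_)
    · have := norm_pos_iff.2 (h.ne_zero hz); positivity
    · exact pow_le_one₀ (norm_nonneg _) hz.2.le
  rw [norm_mul]
  have h4 := mul_le_mul_of_nonneg_right h1 (norm_nonneg (deriv (deriv f) z))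
  nlinarith [norm_nonneg (deriv f z)]

theorem det_pos (h : IsGlued f g a) (hz : z ∈ collar a) :
    0 < ‖-((conj z) ^ 2)⁻¹ * deriv f z‖ := by
  have h0 := h.ne_zero hz
  rw [norm_pos_iff]
  exact mul_ne_zero (neg_ne_zero.2 (inv_ne_zero (pow_ne_zero _ ((map_ne_zero conj).2 h0)))) (h.flat.deriv_ne_zero hz)

theorem det_ne_zero (h : IsGlued f g a) (hz : z ∈ collar a) :
    ‖(deriv g (transition f g z))⁻¹ * (((conj z)⁻¹ - z) * deriv (deriv f) z)‖ ^ 2 -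
      ‖(deriv g (transition f g z))⁻¹ * (-((conj z) ^ 2)⁻¹ * deriv f z)‖ ^ 2 ≠ 0 := by
  have h1 := h.dilatation_le hz
  have h2 := h.det_pos hz
  have h3 : 0 < ‖(deriv g (transition f g z))⁻¹‖ := norm_pos_iff.2 (inv_ne_zero (h.deriv_ne_zero hz))
  rw [norm_mul, norm_mul (_)⁻¹ (-_ * _), mul_pow, mul_pow, ← mul_sub]
  refine mul_ne_zero (by positivity) ?_
  have := norm_nonneg (((conj z)⁻¹ - z) * deriv (deriv f) z)
  nlinarith

theorem exists_lt_norm_transition (h : IsGlued f g a) {R : ℝ} (hR : R < 1) :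
    ∃ b < 1, a ≤ b ∧ ∀ z ∈ collar b, R < ‖transition f g z‖ := by
  obtain ⟨c, hac, hc1⟩ := exists_between h.lt_one
  have hE := h.flat.continuousOn_reflection h.half_le h.cont h.decay
  set K : Set ℂ := closedBall 0 1 ∩ {z | c ≤ ‖z‖} with hK
  have hKc : IsCompact K := (isCompact_closedBall _ _).inter_right (isClosed_le continuous_const continuous_norm)
  have hKs : K ⊆ closedCollar a := fun z hz => ⟨hac.trans_le hz.2, by simpa using hz.1⟩
  have hI : IsClosed (g '' closedBall 0 R) :=
    ((isCompact_closedBall _ _).image_of_continuousOn (h.diff.continuousOn.mono (closedBall_subset_ball hR))).isClosed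
  set T : Set ℂ := K ∩ reflection f ⁻¹' (g '' closedBall 0 R) with hT
  have hTc : IsCompact T := hKc.of_isClosed_subset ((hE.mono hKs).preimage_isClosed_of_isClosed hKc.isClosed hI) inter_subset_left
  have key : ∃ b < 1, c ≤ b ∧ ∀ z ∈ T, ‖z‖ ≤ b := by
    rcases T.eq_empty_or_nonempty with h0 | h0
    · exact ⟨c, hc1, le_rfl, by simp [h0]⟩
    · obtain ⟨z0, hz0, hmax⟩ := hTc.exists_isMaxOn h0 continuous_norm.continuousOn
      refine ⟨‖z0‖, lt_of_le_of_ne (by simpa using hz0.1.1) fun h1 => ?_, hz0.1.2, fun z hz => hmax hz⟩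
      obtain ⟨x, hx, hx'⟩ := hz0.2
      rw [reflection_eq_of_norm_eq_one h1] at hx'
      exact h.boundary z0 h1 ⟨x, closedBall_subset_ball hR hx, hx'⟩
  obtain ⟨b, hb1, hcb, hb⟩ := key
  refine ⟨b, hb1, hac.le.trans hcb, fun z hz => ?_⟩
  by_contra! hle
  have hza : z ∈ collar a := ⟨by linarith [hz.1], hz.2⟩
  have := hb z ⟨⟨by simpa using hz.2.le, hcb.trans hz.1.le⟩, ⟨_, by simpa using hle, h.apply_transition hza⟩⟩
  exact absurd hz.1 (not_lt.2 this)

theorem map_nhds_transition (h : IsGlued f g a) (hz : z ∈ collar a) :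
    map (transition f g) (𝓝 z) = 𝓝 (transition f g z) := by
  have h1 : HasFDerivAt (transition f g) (wirtingerEquiv _ _ (h.det_ne_zero hz) : ℂ →L[ℝ] ℂ) z := by
    rw [coe_wirtingerEquiv]; exact h.hasFDerivAt_transition hz
  exact ((h.contDiffAt_transition hz).hasStrictFDerivAt' h1 one_ne_zero).map_nhds_eq_of_equiv

theorem isOpen_image_transition (h : IsGlued f g a) : IsOpen (transition f g '' collar a) := by
  rw [isOpen_iff_mem_nhds]
  rintro _ ⟨z, hz, rfl⟩
  rw [← h.map_nhds_transition hz]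
  exact image_mem_map ((isOpen_collar a).mem_nhds hz)

theorem exists_collar_subset_image (h : IsGlued f g a) :
    ∃ R, 0 ≤ R ∧ R < 1 ∧ collar R ⊆ transition f g '' collar a := by
  set X := transition f g
  obtain ⟨c, hac, hc1⟩ := exists_between h.lt_one
  have hc0 : 0 < c := by have := h.half_le; linarith
  have hXc : ContinuousOn X (collar a) := fun z hz => (h.contDiffAt_transition hz).continuousAt.continuousWithinAt
  have hCs : sphere (0:ℂ) c ⊆ collar a := fun z hz => by
    rw [mem_sphere_zero_iff_norm] at hz; exact ⟨hz ▸ hac, hz ▸ hc1⟩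
  obtain ⟨z0, hz0, hmax⟩ := (isCompact_sphere (0:ℂ) c).exists_isMaxOn (NormedSpace.sphere_nonempty.2 hc0.le)
    (hXc.mono hCs).norm
  have hR1 : ‖X z0‖ < 1 := by simpa using h.transition_mem (hCs hz0)
  have hc' := h.mono hac.le hc1
  refine ⟨‖X z0‖, norm_nonneg _, hR1, ?_⟩
  refine Subset.trans ?_ (image_mono (collar_subset hac.le))
  refine (isPreconnected_collar (norm_nonneg _)).subset_of_closure_inter_subset hc'.isOpen_image_transition ?_ ?_
  · obtain ⟨b, hb1, hcb, hb⟩ := hc'.exists_lt_norm_transition hR1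
    obtain ⟨s, hbs, hs1⟩ := exists_between hb1
    have hs : (s:ℂ) ∈ collar b := by
      have : ‖(s:ℂ)‖ = s := by rw [Complex.norm_real, Real.norm_of_nonneg (by linarith)]
      exact ⟨by rw [this]; exact hbs, by rw [this]; exact hs1⟩
    exact ⟨X s, ⟨hb _ hs, by simpa using hc'.transition_mem (collar_subset hcb hs)⟩, mem_image_of_mem _ (collar_subset hcb hs)⟩
  · rintro ξ ⟨hξ, hξR⟩
    obtain ⟨R', hξ', hR'⟩ := exists_between hξR.2
    obtain ⟨b, hb1, hcb, hb⟩ := hc'.exists_lt_norm_transition hR'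
    set K : Set ℂ := closedBall 0 b ∩ {z | c ≤ ‖z‖} with hK
    have hKc : IsCompact K := (isCompact_closedBall _ _).inter_right (isClosed_le continuous_const continuous_norm)
    have hKs : K ⊆ collar a := fun z hz => ⟨hac.trans_le hz.2, (by simpa using hz.1 : ‖z‖ ≤ b).trans_lt hb1⟩
    have hcl : IsClosed (X '' K ∪ {w | R' ≤ ‖w‖}) :=
      (hKc.image_of_continuousOn (hXc.mono hKs)).isClosed.union (isClosed_le continuous_const continuous_norm)
    have hsub : X '' collar c ⊆ X '' K ∪ {w | R' ≤ ‖w‖} := by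
      rintro _ ⟨z, hz, rfl⟩
      by_cases hzb : ‖z‖ ≤ b
      · exact Or.inl ⟨z, ⟨by simpa using hzb, hz.1.le⟩, rfl⟩
      · exact Or.inr (hb z ⟨not_le.1 hzb, hz.2⟩).le
    rcases closure_minimal hsub hcl hξ with ⟨z, hz, rfl⟩ | h1
    · refine ⟨z, ⟨lt_of_le_of_ne hz.2 fun he => ?_, (hKs hz).2⟩, rfl⟩
      have : ‖X z‖ ≤ ‖X z0‖ := hmax (show z ∈ sphere (0:ℂ) c by rw [mem_sphere_zero_iff_norm, he])
      exact absurd hξR.1 (not_lt.2 this)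
    · exact absurd hξ' (not_lt.2 h1)

end IsGlued
end Gluing

section GluedIntegral
open Set Filter Topology
open scoped ENNReal ComplexConjugate

variable {f g : ℂ → ℂ} {a : ℝ}

theorem dz_wirtinger_comp (p : ℂ) (L : ℂ →L[ℝ] ℂ) : dz ((wirtinger p 0).comp L) = p * dz L := by
  simp only [dz, ContinuousLinearMap.comp_apply, wirtinger_apply]
  ring

theorem contDiffAt_invFunOn {X : ℂ → ℂ} {U : Set ℂ} (hU : IsOpen U) (hi : InjOn X U) {z : ℂ} (hz : z ∈ U) {e : ℂ ≃L[ℝ] ℂ}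
    (hc : ContDiffAt ℝ 1 X z) (hX : HasFDerivAt X (e : ℂ →L[ℝ] ℂ) z) :
    ContDiffAt ℝ 1 (Function.invFunOn X U) (X z) ∧
      HasFDerivAt (Function.invFunOn X U) (e.symm : ℂ →L[ℝ] ℂ) (X z) := by
  have hs := hc.hasStrictFDerivAt' hX one_ne_zero
  have hu := hs.localInverse_unique (g := Function.invFunOn X U)
    (by filter_upwards [hU.mem_nhds hz] with w hw using hi.leftInvOn_invFunOn hw)
  exact ⟨(hc.to_localInverse hX one_ne_zero).congr_of_eventuallyEq hu, hs.to_localInverse.hasFDerivAt.congr_of_eventuallyEq hu⟩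

theorem dilatation_density_le {s A B p q t i : ℝ} (hs : 0 < s) (hA : 0 ≤ A) (hp : 0 < p) (ht : 0 < t)
    (h1 : A ≤ 3 * t * q) (h2 : A ≤ 1 / 2 * B) (h3 : p ≤ B) (h4 : t * p / 8 ≤ i) :
    s ^ 2 * (B ^ 2 - A ^ 2) * (p * (s * A / (s ^ 2 * (B ^ 2 - A ^ 2))) / i) ^ 2 ≤ 768 * (q / p) ^ 2 := by
  have hi : 0 < i := lt_of_lt_of_le (by positivity) h4
  have hD : 3 / 4 * p ^ 2 ≤ B ^ 2 - A ^ 2 := by nlinarith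
  have hD0 : 0 < B ^ 2 - A ^ 2 := lt_of_lt_of_le (by positivity) hD
  have e : s ^ 2 * (B ^ 2 - A ^ 2) * (p * (s * A / (s ^ 2 * (B ^ 2 - A ^ 2))) / i) ^ 2
      = p ^ 2 / (B ^ 2 - A ^ 2) * (A / i) ^ 2 := by
    field_simp
  have h5 : p ^ 2 / (B ^ 2 - A ^ 2) ≤ 4 / 3 := by
    rw [div_le_iff₀ hD0]; linarith
  have h6 : A / i ≤ 24 * (q / p) := by
    have hq : 0 ≤ q := by
      have : 0 ≤ 3 * t * q := hA.trans h1
      by_contra! hq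
      nlinarith
    rw [div_le_iff₀ hi]
    calc A ≤ 3 * t * q := h1
      _ = 24 * (q / p) * (t * p / 8) := by field_simp; ring
      _ ≤ _ := by gcongr
  calc _ = p ^ 2 / (B ^ 2 - A ^ 2) * (A / i) ^ 2 := e
    _ ≤ 4 / 3 * (24 * (q / p)) ^ 2 := by gcongr
    _ = _ := by ring

/-- Finiteness of the pre-Schwarzian energy of `f` on a collar forces finiteness of the weighted
Schwarzian energy of the univalent function on the other side. -/
theorem IsGlued.lintegral_schwarzian_lt_top (h : IsGlued f g a) (hb : Bornology.IsBounded (g '' ball 0 1))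
    (hd : Disjoint (f '' collar a) (g '' ball 0 1))
    (hφ : ∫⁻ z in collar a, ENNReal.ofReal (‖preSchwarzian f z‖ ^ 2) < ⊤) :
    ∫⁻ z in ball (0:ℂ) 1, ENNReal.ofReal ((1 - ‖z‖) ^ 2 * ‖schwarzian g z‖ ^ 2) < ⊤ := by
  set X := transition f g with hX
  set c := (3 + a) / 4 with hc
  have ha1 := h.lt_one
  have hac : a ≤ c := by linarith
  have hc1 : c < 1 := by linarith
  have h' := h.mono hac hc1
  have hsub : collar c ⊆ collar a := collar_subset hac
  have hS : (g '' ball (0:ℂ) 1).Nonempty := ⟨g 0, 0, mem_ball_self one_pos, rfl⟩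
  have hdist : ∀ z ∈ collar c, (1 - ‖z‖) * ‖deriv f z‖ / 8 ≤ infDist (f z) (g '' ball 0 1) := fun z hz =>
    h.flat.le_infDist h.cont hS hd hz.2 (by have := hz.1; linarith)
  have hfd : ∀ z ∈ collar c, 0 < ‖deriv f z‖ := fun z hz => norm_pos_iff.2 (h'.flat.deriv_ne_zero hz)
  obtain ⟨R, hR0, hR1, hR⟩ := h'.exists_collar_subset_image
  set Y := Function.invFunOn X (collar c) with hY
  have hYX : ∀ z ∈ collar c, Y (X z) = z := fun z hz => h'.injOn_transition.leftInvOn_invFunOn hz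
  have hYd : ∀ z (hz : z ∈ collar c), ContDiffAt ℝ 1 Y (X z) ∧
      HasFDerivAt Y ((wirtingerEquiv _ _ (h'.det_ne_zero hz)).symm : ℂ →L[ℝ] ℂ) (X z) := fun z hz => by
    refine contDiffAt_invFunOn (isOpen_collar c) h'.injOn_transition hz (h'.contDiffAt_transition hz) ?_
    rw [coe_wirtingerEquiv]
    exact h'.hasFDerivAt_transition hz
  have hdz : ∀ z (hz : z ∈ collar c), dz (fderiv ℝ (fun ξ => f (Y ξ)) (X z)) = deriv f z *
      (conj ((deriv g (X z))⁻¹ * (((conj z)⁻¹ - z) * deriv (deriv f) z)) /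
        ((‖(deriv g (X z))⁻¹ * (((conj z)⁻¹ - z) * deriv (deriv f) z)‖ ^ 2 -
      ‖(deriv g (X z))⁻¹ * (-((conj z) ^ 2)⁻¹ * deriv f z)‖ ^ 2 : ℝ) : ℂ)) := fun z hz => by
    have h1 : HasFDerivAt f (wirtinger (deriv f z) 0) (Y (X z)) := by
      rw [hYX z hz]
      exact hasFDerivAt_wirtinger (h'.flat.differentiableAt hz).hasDerivAt
    have h2 := h1.comp (X z) (hYd z hz).2
    rw [show (fun ξ => f (Y ξ)) = f ∘ Y from rfl, h2.fderiv, dz_wirtinger_comp, coe_wirtingerEquiv_symm, dz_wirtinger]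
  refine WeilPetersson.lintegral_schwarzian_lt_top (h := fun ξ => f (Y ξ)) hR1 h.diff h.inj ?_ ?_ ?_ hb ?_
  · intro ξ hξ
    obtain ⟨z, hz, rfl⟩ := hR hξ
    have h1 : ContDiffAt ℂ 1 f (Y (X z)) := by
      rw [hYX z hz]
      exact (h'.flat.diff.analyticAt ((isOpen_collar c).mem_nhds hz)).contDiffAt
    exact ((h1.restrict_scalars ℝ).comp (X z) (hYd z hz).1).contDiffWithinAt
  · intro ξ hξ
    obtain ⟨z, hz, rfl⟩ := hR hξ
    show f (Y (X z)) ∉ _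
    rw [hYX z hz, mem_closure_iff_infDist_zero hS]
    have := hdist z hz
    have h1 : 0 < 1 - ‖z‖ := sub_pos.2 hz.2
    have h2 := hfd z hz
    have h3 : 0 < (1 - ‖z‖) * ‖deriv f z‖ / 8 := by positivity
    exact (h3.trans_le this).ne'
  · intro ε hε
    obtain ⟨b, hb1, hbd⟩ := h.decay (ε / 3) (by positivity)
    have hm1 : max b c < 1 := max_lt hb1 hc1
    obtain ⟨b', hb', hb'1⟩ := exists_between hm1
    rw [max_lt_iff] at hb'
    have hac' : a < c := by linarith
    set K : Set ℂ := closedBall 0 b' ∩ {z | c ≤ ‖z‖} with hK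
    have hKc : IsCompact K := (isCompact_closedBall _ _).inter_right (isClosed_le continuous_const continuous_norm)
    have hKs : K ⊆ collar a := fun z hz => ⟨hac'.trans_le hz.2, (by simpa using hz.1 : ‖z‖ ≤ b').trans_lt hb'1⟩
    have hXc : ContinuousOn X (collar a) := fun z hz => (h.contDiffAt_transition hz).continuousAt.continuousWithinAt
    have hb'K : (b' : ℂ) ∈ K := by
      have : ‖(b':ℂ)‖ = b' := by rw [Complex.norm_real, Real.norm_of_nonneg (by linarith [h.half_le])]
      exact ⟨by simpa using this.le, by rw [mem_ofPred_eq, this]; exact hb'.2.le⟩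
    obtain ⟨z0, hz0, hmax⟩ := hKc.exists_isMaxOn ⟨_, hb'K⟩ (hXc.mono hKs).norm
    refine ⟨max R ‖X z0‖, max_lt hR1 (by simpa using h.transition_mem (hKs hz0)), fun ξ hξ => ?_⟩
    obtain ⟨z, hz, rfl⟩ := hR (collar_subset (le_max_left _ _) hξ)
    have hzb : b' < ‖z‖ := by
      by_contra! hle
      have h1 : ‖X z‖ ≤ ‖X z0‖ := hmax (show z ∈ K from ⟨by simpa using hle, hz.1.le⟩)
      exact absurd hξ.1 (not_lt.2 (h1.trans (le_max_right _ _)))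
    show ‖f (Y (X z)) - g (X z)‖ ≤ ε
    rw [hYX z hz, h'.apply_transition hz, reflection, sub_add_cancel_left, norm_neg, norm_mul]
    have h1 := hbd z ⟨hb'.1.trans hzb, hz.2⟩
    have h2 := norm_inv_conj_sub_le (h'.half_le.trans hz.1.le) hz.2.le
    nlinarith [norm_nonneg (deriv f z)]
  · calc _ ≤ ∫⁻ ξ in X '' collar c, ENNReal.ofReal ((‖dz (fderiv ℝ (fun ξ => f (Y ξ)) ξ)‖ / infDist (f (Y ξ)) (g '' ball 0 1)) ^ 2) :=
          lintegral_mono_set hR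
      _ = ∫⁻ z in collar c, _ := lintegral_image_eq_lintegral_abs_det_fderiv_mul volume (isOpen_collar c).measurableSet
          (fun z hz => (h'.hasFDerivAt_transition hz).hasFDerivWithinAt) h'.injOn_transition _
      _ ≤ ∫⁻ z in collar c, 768 * ENNReal.ofReal (‖preSchwarzian f z‖ ^ 2) := by
          refine setLIntegral_mono' (isOpen_collar c).measurableSet fun z hz => ?_
          rw [← ENNReal.ofReal_mul (abs_nonneg _), hYX z hz, hdz z hz,
            show (768:ℝ≥0∞) = ENNReal.ofReal 768 by norm_num, ← ENNReal.ofReal_mul (by norm_num)]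
          refine ENNReal.ofReal_le_ofReal ?_
          have h2 := h'.dilatation_le hz
          have h3 : ‖deriv f z‖ ≤ ‖-((conj z) ^ 2)⁻¹ * deriv f z‖ := by
            rw [norm_mul, norm_neg, norm_inv, norm_pow, RCLike.norm_conj]
            refine le_mul_of_one_le_left (norm_nonneg _) ((one_le_inv₀ ?_).2 ?_)
            · have := norm_pos_iff.2 (h'.ne_zero hz); positivity
            · exact pow_le_one₀ (norm_nonneg _) hz.2.le
          have h1 : ‖((conj z)⁻¹ - z) * deriv (deriv f) z‖ ≤ 3 * (1 - ‖z‖) * ‖deriv (deriv f) z‖ := by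
            rw [norm_mul]
            exact mul_le_mul_of_nonneg_right (norm_inv_conj_sub_le (h'.half_le.trans hz.1.le) hz.2.le) (norm_nonneg _)
          have hs : 0 < ‖(deriv g (X z))⁻¹‖ := norm_pos_iff.2 (inv_ne_zero (h'.deriv_ne_zero hz))
          have key := dilatation_density_le hs (norm_nonneg _) (hfd z hz) (sub_pos.2 hz.2) h1 h2 h3 (hdist z hz)
          have hA := norm_nonneg (((conj z)⁻¹ - z) * deriv (deriv f) z)
          rw [det_wirtinger, norm_mul (deriv f z), norm_div, RCLike.norm_conj, Complex.norm_real, Real.norm_eq_abs,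
            norm_mul (deriv g (X z))⁻¹ (((conj z)⁻¹ - z) * deriv (deriv f) z),
            norm_mul (deriv g (X z))⁻¹ (-((conj z) ^ 2)⁻¹ * deriv f z), mul_pow, mul_pow, ← mul_sub, preSchwarzian, norm_div]
          rw [abs_mul, abs_of_pos (pow_pos hs 2), abs_sub_comm, abs_of_nonneg (by nlinarith)]
          exact key
      _ ≤ ∫⁻ z in collar a, 768 * ENNReal.ofReal (‖preSchwarzian f z‖ ^ 2) := lintegral_mono_set hsub
      _ < ⊤ := by
          rw [lintegral_const_mul' _ _ (by norm_num)]
          exact ENNReal.mul_lt_top (by norm_num) hφ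

end GluedIntegral

section OneSide
open Set Filter Topology
open scoped ENNReal ComplexConjugate

variable {f g k : ℂ → ℂ} {γ : ℝ → ℂ} {a : ℝ} {q : ℂ}

theorem exists_decay_deriv (ha : a < 1) (hf : DifferentiableOn ℂ f (collar a)) (hi : InjOn f (collar a))
    (hb : Bornology.IsBounded (f '' collar a)) :
    ∀ η > 0, ∃ b < 1, a ≤ b ∧ ∀ z ∈ collar b, (1 - ‖z‖) * ‖deriv f z‖ ≤ η := by
  intro η hη
  have h1 : ∫⁻ z in collar a, ENNReal.ofReal ((1 - ‖z‖) ^ (2 * 0) * ‖deriv f z‖ ^ 2) < ⊤ := by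
    simp only [mul_zero, pow_zero, one_mul]
    rw [lintegral_deriv_sq (isOpen_collar a) hf hi]
    exact hb.measure_lt_top
  obtain ⟨b, hab, hb1, h2⟩ := exists_collar_norm_le ha 0 (hf.deriv (isOpen_collar a)) h1 hη
  exact ⟨b, hb1, hab, fun z hz => by simpa using h2 z hz⟩

theorem eqOn_deriv_collar {F : ℂ → ℂ} (h : EqOn F f (collar a)) : EqOn (deriv F) (deriv f) (collar a) := fun _ hz =>
  (h.eventuallyEq_of_mem ((isOpen_collar a).mem_nhds hz)).deriv_eq

theorem eqOn_preSchwarzian {F : ℂ → ℂ} (h : EqOn F f (collar a)) :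
    EqOn (preSchwarzian F) (preSchwarzian f) (collar a) := fun z hz => by
  have h1 := eqOn_deriv_collar h
  rw [preSchwarzian, preSchwarzian, h1 hz, eqOn_deriv_collar h1 hz]

theorem preSchwarzian_univalent_lt_top (hγc : Continuous γ) (hγp : ∀ θ, γ (θ + 2 * π) = γ θ)
    (hγi : InjOn γ (Ico 0 (2 * π))) (ha : a < 1) (hf : DifferentiableOn ℂ f (collar a)) (hi : InjOn f (collar a))
    (hg : DifferentiableOn ℂ g (ball 0 1)) (hgi : InjOn g (ball 0 1)) (hgb : Bornology.IsBounded (g '' ball 0 1))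
    (hfg : Disjoint (f '' collar a) (g '' ball 0 1)) (hγg : Disjoint (range γ) (g '' ball 0 1))
    (hprox : ∀ ε > 0, ∃ b < 1, ∀ z ∈ collar b, infDist (f z) (range γ) < ε)
    (hcover : ∀ b < 1, ∃ ε > 0, ∀ w, infDist w (range γ) < ε → w ∈ range γ ∨ w ∈ g '' ball 0 1 ∨ w ∈ f '' collar b)
    (hk : DifferentiableOn ℂ k (ball 0 1)) (hk0 : ∀ z ∈ ball (0:ℂ) 1, k z ≠ 0)
    (hfk : ∀ z ∈ collar a, (f z - q) * (z * k z) = 1) (hq : q ∉ range γ)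
    (hφ : ∫⁻ z in collar a, ENNReal.ofReal (‖preSchwarzian f z‖ ^ 2) < ⊤) :
    ∫⁻ z in ball (0:ℂ) 1, ENNReal.ofReal (‖preSchwarzian g z‖ ^ 2) < ⊤ := by
  have hΓ : IsCompact (range γ) := by
    rw [← (show Function.Periodic γ (2 * π) from hγp).image_Icc two_pi_pos 0]
    exact isCompact_Icc.image hγc
  have hΓne : (range γ).Nonempty := range_nonempty γ
  -- shrink the collar
  obtain ⟨b₀, hb₀, hb₀'⟩ := hprox 1 one_pos
  set a₁ := max (max a b₀) (1 / 2) with ha₁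
  have haa₁ : a ≤ a₁ := (le_max_left _ _).trans (le_max_left _ _)
  have hba₁ : b₀ ≤ a₁ := (le_max_right _ _).trans (le_max_left _ _)
  have h2a₁ : 1 / 2 ≤ a₁ := le_max_right _ _
  have ha₁1 : a₁ < 1 := max_lt (max_lt ha hb₀) (by norm_num)
  have hb : Bornology.IsBounded (f '' collar a₁) := by
    refine (hΓ.isBounded.thickening (δ := 1)).subset ?_
    rintro _ ⟨z, hz, rfl⟩
    rw [mem_thickening_iff_infDist_lt hΓne]
    exact hb₀' z (collar_subset hba₁ hz)
  have hf₁ := hf.mono (collar_subset haa₁)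
  have hi₁ := hi.mono (collar_subset haa₁)
  have hdec := exists_decay_deriv ha₁1 hf₁ hi₁ hb
  have hφ₁ : ∫⁻ z in collar a₁, ENNReal.ofReal (‖preSchwarzian f z‖ ^ 2) < ⊤ :=
    (lintegral_mono_set (collar_subset haa₁)).trans_lt hφ
  have hd0 : ∀ z ∈ collar a₁, deriv f z ≠ 0 := fun z hz => deriv_ne_zero_of_injOn (isOpen_collar _) hf₁ hi₁ hz
  obtain ⟨a₂, ha₁₂, ha₂1, hpre⟩ := exists_collar_norm_le ha₁1 0
    (differentiableOn_preSchwarzian (isOpen_collar a₁) hf₁ hd0) (by simpa using hφ₁) (show (0:ℝ) < 1 / 10000 by norm_num)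
  have hflat : IsFlatOn f a₂ (1 / 10000) := by
    refine ⟨hf₁.mono (collar_subset ha₁₂), hi₁.mono (collar_subset ha₁₂), fun z hz => ?_⟩
    have h1 := hpre z hz
    have h2 := norm_pos_iff.2 (hd0 z (collar_subset ha₁₂ hz))
    rw [preSchwarzian, norm_div, zero_add, pow_one, ← mul_div_assoc, div_le_iff₀ h2] at h1
    exact h1
  -- extend to the circle
  obtain ⟨F, hFf, hFc⟩ := hflat.exists_extension (by norm_num) (by norm_num) ha₂1
    (fun η hη => by obtain ⟨b, h1, -, h2⟩ := hdec η hη; exact ⟨b, h1, h2⟩)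
  have hF := hflat.congr hFf
  have hFd := eqOn_deriv_collar hFf
  have h2a₂ : 1 / 2 ≤ a₂ := h2a₁.trans ha₁₂
  have hFdec : ∀ η > 0, ∃ b < 1, ∀ z ∈ collar b, (1 - ‖z‖) * ‖deriv F z‖ ≤ η := fun η hη => by
    obtain ⟨b, h1, -, h2⟩ := hdec η hη
    refine ⟨max b a₂, max_lt h1 ha₂1, fun z hz => ?_⟩
    rw [hFd (collar_subset (le_max_right _ _) hz)]
    exact h2 z (collar_subset (le_max_left _ _) hz)
  have hFΓ : ∀ z, ‖z‖ = 1 → F z ∈ range γ := by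
    intro z hz
    rw [hΓ.isClosed.mem_iff_infDist_zero hΓne]
    refine le_antisymm (le_of_forall_pos_le_add fun ε hε => ?_) infDist_nonneg
    rw [zero_add]
    obtain ⟨b, hb1, hb⟩ := hprox ε hε
    have hm : max b a₂ < 1 := max_lt hb1 ha₂1
    have hzc : z ∈ closure (collar (max b a₂)) := mem_closure_collar hm ⟨by rw [hz]; exact hm, hz.le⟩
    have h1 : ContinuousWithinAt F (collar (max b a₂)) z :=
      (hFc z ⟨by rw [hz]; exact ha₂1, hz.le⟩).mono
        ((collar_subset (le_max_right _ _)).trans collar_subset_closedCollar)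
    have h2 := h1.mem_closure hzc (t := {w | infDist w (range γ) ≤ ε}) fun w hw => by
      rw [mem_ofPred_eq, hFf (collar_subset (le_max_right _ _) hw)]
      exact (hb w (collar_subset (le_max_left _ _) hw)).le
    rwa [(isClosed_le (continuous_infDist_pt _) continuous_const).closure_eq] at h2
  -- injectivity on the circle
  set m := (1 - a₂) / 4 with hm
  have hm0 : 0 < m := by linarith
  have hm2 : m ≤ 1 / 2 := by linarith
  have ha₂m : a₂ ≤ 1 - 4 * m := by linarith
  have hS : ∀ b < 1, ∀ z : ℂ, ‖z‖ = 1 → z ∈ closedCollar b := fun b hb z hz => ⟨by rw [hz]; exact hb, hz.le⟩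
  obtain ⟨hFi, hFs⟩ := injOn_sphere_of_locally_injective hγc hγp hγi (by linarith) ha₂1 hFc hk hk0
    (fun z hz => by rw [hFf hz]; exact hfk z (collar_subset (haa₁.trans ha₁₂) hz)) hq hFΓ hm0
    (fun z w hz hw hzw hne => by
      rw [← reflection_eq_of_norm_eq_one (f := F) hz, ← reflection_eq_of_norm_eq_one (f := F) hw]
      exact hF.reflection_ne hFc hm2 ha₂m (hS _ (by linarith) z hz) (hS _ (by linarith) w hw) hzw hne)
  -- injectivity on a collar
  have hE := hF.continuousOn_reflection h2a₂ hFc hFdec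
  obtain ⟨b₁, hb₁1, hab₁, hb₁⟩ := exists_forall_closedCollar_ne ha₂1 hE hE (fun z w hz hw hne => by
    rw [reflection_eq_of_norm_eq_one hz, reflection_eq_of_norm_eq_one hw]; exact hFi z w hz hw hne) hm0
  obtain ⟨b₂, hb₂1, hab₂, hb₂⟩ := exists_forall_closedCollar_ne ha₂1 hE hFc (fun z w hz hw hne => by
    rw [reflection_eq_of_norm_eq_one hz]; exact hFi z w hz hw hne) hm0
  set b₃ := max (max b₁ b₂) (1 - m) with hb₃
  have h13 : b₁ ≤ b₃ := (le_max_left _ _).trans (le_max_left _ _)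
  have h23 : b₂ ≤ b₃ := (le_max_right _ _).trans (le_max_left _ _)
  have hm3 : 1 - m ≤ b₃ := le_max_right _ _
  have hb₃1 : b₃ < 1 := max_lt (max_lt hb₁1 hb₂1) (by linarith)
  have hab₃ : a₂ ≤ b₃ := hab₁.trans h13
  have hEi : InjOn (reflection F) (closedCollar b₃) := by
    intro z hz w hw e
    by_contra hne
    rcases lt_or_ge ‖z - w‖ m with h1 | h1
    · exact hF.reflection_ne hFc hm2 ha₂m (closedCollar_subset hm3 hz) (closedCollar_subset hm3 hw) h1 hne e
    · exact hb₁ z (closedCollar_subset h13 hz) w (closedCollar_subset h13 hw) h1 e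
  have hEF : ∀ z ∈ collar b₃, ∀ w ∈ collar b₃, reflection F z ≠ F w := by
    intro z hz w hw
    rcases lt_or_ge ‖z - w‖ m with h1 | h1
    · exact hF.reflection_ne_self hFc hm2 ha₂m (collar_subset hm3 hz) (collar_subset hm3 hw) h1
    · exact hb₂ z (closedCollar_subset h23 (collar_subset_closedCollar hz)) w
        (closedCollar_subset h23 (collar_subset_closedCollar hw)) h1
  -- the reflected collar lies on the other side
  obtain ⟨ε, hε, hcov⟩ := hcover b₃ hb₃1
  obtain ⟨b₄, hb₄1, hb₄⟩ := hprox (ε / 2) (by positivity)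
  obtain ⟨b₅, hb₅1, hb₅⟩ := hFdec (ε / 6) (by positivity)
  set b := max (max b₄ b₅) b₃ with hbdef
  have h4b : b₄ ≤ b := (le_max_left _ _).trans (le_max_left _ _)
  have h5b : b₅ ≤ b := (le_max_right _ _).trans (le_max_left _ _)
  have h3b : b₃ ≤ b := le_max_right _ _
  have hb1 : b < 1 := max_lt (max_lt hb₄1 hb₅1) hb₃1
  have hmaps : ∀ z ∈ collar b, reflection F z ∈ g '' ball 0 1 := by
    intro z hz
    have hz3 := collar_subset h3b hz
    have hz2 := collar_subset hab₃ hz3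
    have h1 : infDist (reflection F z) (range γ) < ε := by
      have h2 := hb₄ z (collar_subset h4b hz)
      have h3 := hb₅ z (collar_subset h5b hz)
      have h4 := norm_inv_conj_sub_le (h2a₂.trans hz2.1.le) hz.2.le
      have h5 : dist (reflection F z) (f z) ≤ ε / 2 := by
        rw [dist_eq_norm, reflection, hFf hz2, add_sub_cancel_left, norm_mul]
        nlinarith [norm_nonneg (deriv F z)]
      have h6 := infDist_le_infDist_add_dist (s := range γ) (x := reflection F z) (y := f z)
      linarith
    rcases hcov _ h1 with ⟨t, ht⟩ | h2 | ⟨w, hw, hw'⟩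
    · obtain ⟨u, hu, hu'⟩ := hFs t
      have h3 : reflection F u = reflection F z := by rw [reflection_eq_of_norm_eq_one hu, hu', ht]
      have h4 := hEi (hS _ hb₃1 u hu) (collar_subset_closedCollar hz3) h3
      rw [h4] at hu
      exact absurd hu hz.2.ne
    · exact h2
    · rw [← hFf (collar_subset hab₃ hw)] at hw'
      exact absurd hw'.symm (hEF z hz3 w hw)
  have hab : a₂ ≤ b := hab₃.trans h3b
  have hglue : IsGlued F g b := ⟨hF.mono hab, h2a₂.trans hab, hb1, hFc.mono (closedCollar_subset hab), hFdec, hg, hgi,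
    hEi.mono (closedCollar_subset h3b), hmaps, fun z hz h => disjoint_left.1 hγg (hFΓ z hz) h⟩
  have hFg : Disjoint (F '' collar b) (g '' ball 0 1) := by
    refine hfg.mono_left ?_
    rintro _ ⟨z, hz, rfl⟩
    rw [hFf (collar_subset hab hz)]
    exact ⟨z, collar_subset ((haa₁.trans ha₁₂).trans hab) hz, rfl⟩
  have hFφ : ∫⁻ z in collar b, ENNReal.ofReal (‖preSchwarzian F z‖ ^ 2) < ⊤ := by
    rw [setLIntegral_congr_fun (isOpen_collar b).measurableSet (g := fun z => ENNReal.ofReal (‖preSchwarzian f z‖ ^ 2))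
      (fun z hz => by simp only [eqOn_preSchwarzian hFf (collar_subset hab hz)])]
    exact (lintegral_mono_set (collar_subset (ha₁₂.trans hab))).trans_lt hφ₁
  have hSch := hglue.lintegral_schwarzian_lt_top hgb hFg hFφ
  have hcb : collar 0 ⊆ ball (0:ℂ) 1 := fun z hz => by simpa using hz.2
  refine lintegral_preSchwarzian_lt_top hg (fun z hz => deriv_ne_zero_of_injOn isOpen_ball hg hgi hz) zero_lt_one
    ((lintegral_mono_set hcb).trans_lt hSch) fun η hη => ?_
  obtain ⟨c, hc1, -, hc⟩ := exists_decay_deriv zero_lt_one (hg.mono hcb) (hgi.mono hcb) (hgb.subset (image_mono hcb)) η hη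
  exact ⟨c, hc1, hc⟩

end OneSide

section Welding
open Set Filter Topology
open scoped ENNReal ComplexConjugate

variable {φ ψ : ℂ → ℂ} {γ : ℝ → ℂ}

theorem exists_collar_mapsTo (hd : DifferentiableOn ℂ φ (ball 0 1)) (hi : InjOn φ (ball 0 1))
    (hb : Bornology.IsBounded (φ '' ball 0 1)) {O : Set ℂ} (hO : IsOpen O)
    (hcl : closure (φ '' ball 0 1) ⊆ φ '' ball 0 1 ∪ O) : ∃ b < 1, ∀ z ∈ collar b, φ z ∈ O := by
  set χ := Function.invFunOn φ (ball 0 1)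
  have hχ : ∀ z ∈ ball (0:ℂ) 1, χ (φ z) = z := fun z hz => hi.leftInvOn_invFunOn hz
  have hK : IsCompact (closure (φ '' ball 0 1) \ O) := hb.isCompact_closure.diff hO
  have hKs : closure (φ '' ball 0 1) \ O ⊆ φ '' ball 0 1 := fun p hp => (hcl hp.1).resolve_right hp.2
  have hχc : ContinuousOn χ (φ '' ball 0 1) := by
    rintro _ ⟨z, hz, rfl⟩
    exact (continuousAt_leftInverse isOpen_ball hd hχ hz).continuousWithinAt
  obtain ⟨b, hb1, hb'⟩ := exists_lt_subset_ball (hK.image_of_continuousOn (hχc.mono hKs)).isClosed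
    (show χ '' (closure (φ '' ball 0 1) \ O) ⊆ ball 0 1 by
      rintro _ ⟨p, hp, rfl⟩
      obtain ⟨z, hz, rfl⟩ := hKs hp
      rw [hχ z hz]; exact hz)
  refine ⟨b, hb1, fun z hz => ?_⟩
  have hz1 : z ∈ ball (0:ℂ) 1 := by simpa using hz.2
  by_contra hzO
  have := hb' ⟨φ z, ⟨subset_closure ⟨z, hz1, rfl⟩, hzO⟩, rfl⟩
  rw [hχ z hz1, mem_ball_zero_iff] at this
  exact lt_asymm this hz.1

theorem exists_infDist_lt_imp {S : Set ℂ} (hS : IsCompact S) (hne : S.Nonempty) {P : ℂ → Prop}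
    (h : ∀ p ∈ S, ∀ᶠ w in 𝓝 p, P w) : ∃ ε > 0, ∀ w, infDist w S < ε → P w := by
  obtain ⟨ε, hε, h1⟩ := hS.exists_thickening_subset_open (isOpen_interior (s := {w | P w}))
    fun p hp => mem_interior_iff_mem_nhds.2 (h p hp)
  exact ⟨ε, hε, fun w hw => interior_subset (h1 ((mem_thickening_iff_infDist_lt hne).2 hw))⟩

theorem exists_eq_mul_of_injOn (hd : DifferentiableOn ℂ φ (ball 0 1)) (hi : InjOn φ (ball 0 1)) (h0 : φ 0 = 0) :
    ∃ k : ℂ → ℂ, DifferentiableOn ℂ k (ball 0 1) ∧ (∀ z ∈ ball (0:ℂ) 1, k z ≠ 0) ∧ ∀ z, φ z = z * k z := by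
  have hm : (0:ℂ) ∈ ball (0:ℂ) 1 := mem_ball_self one_pos
  have hk : ∀ z, φ z = z * dslope φ 0 z := fun z => by
    have := sub_smul_dslope φ 0 z
    rw [h0, sub_zero, sub_zero, smul_eq_mul] at this
    exact this.symm
  refine ⟨dslope φ 0, (Complex.differentiableOn_dslope (isOpen_ball.mem_nhds hm)).2 hd, fun z hz => ?_, hk⟩
  by_cases hz0 : z = 0
  · rw [hz0, dslope_same]
    exact deriv_ne_zero_of_injOn isOpen_ball hd hi hm
  · intro h
    have h1 := hk z
    rw [h, mul_zero, ← h0] at h1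
    exact hz0 (hi hz hm h1)

theorem exists_le_norm_of_injOn (hd : DifferentiableOn ℂ φ (ball 0 1)) (hi : InjOn φ (ball 0 1)) (h0 : φ 0 = 0) :
    ∃ c > 0, ∀ z ∈ collar (1 / 2), c ≤ ‖φ z‖ := by
  have hs : ball (0:ℂ) (1 / 2) ⊆ ball 0 1 := ball_subset_ball (by norm_num)
  have ho := isOpen_image_of_injOn isOpen_ball (hd.mono hs) (hi.mono hs)
  obtain ⟨c, hc, hc'⟩ := Metric.isOpen_iff.1 ho 0 ⟨0, mem_ball_self (by norm_num), h0⟩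
  refine ⟨c, hc, fun z hz => ?_⟩
  by_contra! hlt
  obtain ⟨w, hw, hw'⟩ := hc' (mem_ball_zero_iff.2 hlt)
  have h1 := hi (hs hw) (by simpa using hz.2) hw'
  rw [h1, mem_ball_zero_iff] at hw
  exact lt_asymm hw hz.1

theorem preSchwarzian_inv {U : Set ℂ} (hU : IsOpen U) (hd : DifferentiableOn ℂ φ U) (hne : ∀ z ∈ U, φ z ≠ 0)
    (h' : ∀ z ∈ U, deriv φ z ≠ 0) {z : ℂ} (hz : z ∈ U) :
    preSchwarzian (fun z => (φ z)⁻¹) z = preSchwarzian φ z - 2 * (deriv φ z / φ z) := by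
  have h1 : ∀ w ∈ U, HasDerivAt φ (deriv φ w) w := fun w hw => (hd.differentiableAt (hU.mem_nhds hw)).hasDerivAt
  have h2 : EqOn (deriv fun z => (φ z)⁻¹) (fun w => -deriv φ w / φ w ^ 2) U := fun w hw => ((h1 w hw).inv (hne w hw)).deriv
  have h3 : HasDerivAt (deriv φ) (deriv (deriv φ) z) z :=
    ((hd.deriv hU).differentiableAt (hU.mem_nhds hz)).hasDerivAt
  have h4 := (h3.neg.div ((h1 z hz).pow 2) (pow_ne_zero 2 (hne z hz)))
  have h5 : deriv (deriv fun z => (φ z)⁻¹) z = _ := (h2.eventuallyEq_of_mem (hU.mem_nhds hz)).deriv_eq.trans h4.deriv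
  have := hne z hz
  have := h' z hz
  rw [preSchwarzian, h5, h2 hz, preSchwarzian]
  simp only [Pi.neg_apply, Pi.pow_apply]
  field_simp
  push_cast
  ring

theorem lintegral_norm_sub_sq_lt_top {U : Set ℂ} {u v : ℂ → ℂ} (hm : AEMeasurable u (volume.restrict U))
    (hu : ∫⁻ z in U, ENNReal.ofReal (‖u z‖ ^ 2) < ⊤)
    (hv : ∫⁻ z in U, ENNReal.ofReal (‖v z‖ ^ 2) < ⊤) : ∫⁻ z in U, ENNReal.ofReal (‖u z - v z‖ ^ 2) < ⊤ := by
  calc _ ≤ ∫⁻ z in U, (2 * ENNReal.ofReal (‖u z‖ ^ 2) + 2 * ENNReal.ofReal (‖v z‖ ^ 2)) := by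
        refine lintegral_mono fun z => ?_
        rw [show (2:ℝ≥0∞) = ENNReal.ofReal 2 by norm_num, ← ENNReal.ofReal_mul (by norm_num), ← ENNReal.ofReal_mul (by norm_num),
          ← ENNReal.ofReal_add (by positivity) (by positivity)]
        refine ENNReal.ofReal_le_ofReal ?_
        have h1 := norm_sub_le (u z) (v z)
        nlinarith [norm_nonneg (u z - v z), sq_nonneg (‖u z‖ - ‖v z‖)]
    _ < ⊤ := by
        rw [lintegral_add_left' ((hm.norm.pow_const 2).ennreal_ofReal.const_mul 2), lintegral_const_mul' _ _ (by norm_num),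
          lintegral_const_mul' _ _ (by norm_num)]
        exact ENNReal.add_lt_top.2 ⟨ENNReal.mul_lt_top (by norm_num) hu, ENNReal.mul_lt_top (by norm_num) hv⟩

theorem lintegral_logDeriv_lt_top (hd : DifferentiableOn ℂ φ (ball 0 1)) (hi : InjOn φ (ball 0 1)) (h0 : φ 0 = 0)
    (hb : Bornology.IsBounded (φ '' ball 0 1)) :
    ∫⁻ z in collar (1 / 2), ENNReal.ofReal (‖deriv φ z / φ z‖ ^ 2) < ⊤ := by
  obtain ⟨c, hc, hc'⟩ := exists_le_norm_of_injOn hd hi h0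
  have hsub : collar (1 / 2) ⊆ ball (0:ℂ) 1 := fun z hz => by simpa using hz.2
  calc _ ≤ ∫⁻ z in collar (1 / 2), ENNReal.ofReal ((c⁻¹) ^ 2) * ENNReal.ofReal (‖deriv φ z‖ ^ 2) := by
        refine setLIntegral_mono' (isOpen_collar _).measurableSet fun z hz => ?_
        rw [← ENNReal.ofReal_mul (by positivity), ← mul_pow, norm_div, div_eq_inv_mul]
        have := hc' z hz
        gcongr
    _ ≤ ∫⁻ z in ball 0 1, ENNReal.ofReal ((c⁻¹) ^ 2) * ENNReal.ofReal (‖deriv φ z‖ ^ 2) := lintegral_mono_set hsub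
    _ < ⊤ := by
        rw [lintegral_const_mul' _ _ ENNReal.ofReal_ne_top, lintegral_deriv_sq isOpen_ball hd hi]
        exact ENNReal.mul_lt_top ENNReal.ofReal_lt_top hb.measure_lt_top

/-- Two bounded univalent maps `φ`, `ψ` of the disc fixing `0` such that `φ(𝔻)` and `1 / ψ(𝔻)` are the
two sides of the Jordan curve `γ` on the sphere. -/
structure IsWelded (φ ψ : ℂ → ℂ) (γ : ℝ → ℂ) : Prop where
  continuous : Continuous γ
  periodic : ∀ θ, γ (θ + 2 * π) = γ θ
  injOn : InjOn γ (Ico 0 (2 * π))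
  ne_zero : ∀ t, γ t ≠ 0
  diff_left : DifferentiableOn ℂ φ (ball 0 1)
  inj_left : InjOn φ (ball 0 1)
  zero_left : φ 0 = 0
  bdd_left : Bornology.IsBounded (φ '' ball 0 1)
  diff_right : DifferentiableOn ℂ ψ (ball 0 1)
  inj_right : InjOn ψ (ball 0 1)
  zero_right : ψ 0 = 0
  bdd_right : Bornology.IsBounded (ψ '' ball 0 1)
  avoid_left : ∀ z ∈ ball (0:ℂ) 1, ∀ t, φ z ≠ γ t
  avoid_right : ∀ z ∈ ball (0:ℂ) 1, ∀ t, ψ z * γ t ≠ 1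
  avoid : ∀ z ∈ ball (0:ℂ) 1, ∀ w ∈ ball (0:ℂ) 1, φ z * ψ w ≠ 1
  cover : ∀ p ≠ 0, (∃ z ∈ ball (0:ℂ) 1, φ z = p) ∨ (∃ t, γ t = p) ∨ ∃ w ∈ ball (0:ℂ) 1, ψ w * p = 1

namespace IsWelded

theorem symm (h : IsWelded φ ψ γ) : IsWelded ψ φ (fun t => (γ t)⁻¹) where
  continuous := h.continuous.inv₀ h.ne_zero
  periodic θ := by rw [h.periodic]
  injOn s hs t ht e := h.injOn hs ht (inv_injective e)
  ne_zero t := inv_ne_zero (h.ne_zero t)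
  diff_left := h.diff_right
  inj_left := h.inj_right
  zero_left := h.zero_right
  bdd_left := h.bdd_right
  diff_right := h.diff_left
  inj_right := h.inj_left
  zero_right := h.zero_left
  bdd_right := h.bdd_left
  avoid_left z hz t e := h.avoid_right z hz t (by rw [e, inv_mul_cancel₀ (h.ne_zero t)])
  avoid_right z hz t e := h.avoid_left z hz t (by rwa [mul_inv_eq_one₀ (h.ne_zero t)] at e)
  avoid z hz w hw e := h.avoid w hw z hz (by rwa [mul_comm])
  cover p hp := by
    rcases h.cover p⁻¹ (inv_ne_zero hp) with ⟨z, hz, e⟩ | ⟨t, e⟩ | ⟨w, hw, e⟩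
    · exact Or.inr (Or.inr ⟨z, hz, by rw [e, inv_mul_cancel₀ hp]⟩)
    · exact Or.inr (Or.inl ⟨t, by rw [e, inv_inv]⟩)
    · exact Or.inl ⟨w, hw, by rwa [mul_inv_eq_one₀ hp] at e⟩

theorem apply_ne_zero (h : IsWelded φ ψ γ) {z : ℂ} (hz : z ∈ ball (0:ℂ) 1) (hz0 : z ≠ 0) : φ z ≠ 0 := fun e =>
  hz0 (h.inj_left hz (mem_ball_self one_pos) (e.trans h.zero_left.symm))

theorem closure_subset (h : IsWelded φ ψ γ) : closure (φ '' ball 0 1) ⊆ φ '' ball 0 1 ∪ range γ := by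
  have hV := isOpen_image_of_injOn isOpen_ball h.diff_right h.inj_right
  have h1 : IsOpen ({0}ᶜ ∩ (fun p : ℂ => p⁻¹) ⁻¹' (ψ '' ball 0 1)) :=
    (continuousOn_inv₀ (G₀ := ℂ)).isOpen_inter_preimage isOpen_compl_singleton hV
  intro p hp
  by_contra hne
  rw [mem_union, not_or] at hne
  have hp0 : p ≠ 0 := fun e => hne.1 ⟨0, mem_ball_self one_pos, h.zero_left.trans e.symm⟩
  rcases h.cover p hp0 with h2 | h2 | ⟨w, hw, e⟩
  · exact hne.1 h2
  · exact hne.2 h2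
  · obtain ⟨_, ⟨hx0, w', hw', e'⟩, z, hz, rfl⟩ := mem_closure_iff.1 hp _ h1 ⟨hp0, w, hw, eq_inv_of_mul_eq_one_left e⟩
    refine h.avoid z hz w' hw' ?_
    rw [e', mul_inv_cancel₀ hx0]

theorem preSchwarzian_lt_top (h : IsWelded φ ψ γ)
    (hφ : ∫⁻ z in ball (0:ℂ) 1, ENNReal.ofReal (‖preSchwarzian φ z‖ ^ 2) < ⊤) :
    ∫⁻ z in ball (0:ℂ) 1, ENNReal.ofReal (‖preSchwarzian ψ z‖ ^ 2) < ⊤ := by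
  obtain ⟨k, hk, hk0, hφk⟩ := exists_eq_mul_of_injOn h.diff_left h.inj_left h.zero_left
  have hs := h.symm
  set Γ := range fun t => (γ t)⁻¹ with hΓdef
  have hΓ : IsCompact Γ := by
    rw [hΓdef, ← (show Function.Periodic (fun t => (γ t)⁻¹) (2 * π) from hs.periodic).image_Icc two_pi_pos 0]
    exact isCompact_Icc.image hs.continuous
  have hΓne : Γ.Nonempty := range_nonempty _
  have hsub : collar (1 / 2) ⊆ ball (0:ℂ) 1 := fun z hz => by simpa using hz.2
  have hb0 : ∀ b : ℝ, 0 ≤ b → ∀ z ∈ collar b, φ z ≠ 0 := fun b hb z hz =>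
    h.apply_ne_zero (by simpa using hz.2) (norm_pos_iff.1 (hb.trans_lt hz.1))
  have hne := hb0 (1 / 2) (by norm_num)
  have hφd : ∀ z ∈ collar (1 / 2), deriv φ z ≠ 0 := fun z hz =>
    deriv_ne_zero_of_injOn isOpen_ball h.diff_left h.inj_left (hsub hz)
  refine preSchwarzian_univalent_lt_top (f := fun z => (φ z)⁻¹) (k := k) (q := 0) hs.continuous hs.periodic hs.injOn
    (show (1 / 2 : ℝ) < 1 by norm_num)
    ((h.diff_left.mono hsub).inv hne) (fun z hz w hw e => h.inj_left (hsub hz) (hsub hw) (inv_injective e))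
    h.diff_right h.inj_right h.bdd_right ?_ ?_ ?_ ?_ hk hk0 ?_ ?_ ?_
  · rw [disjoint_left]
    rintro _ ⟨z, hz, rfl⟩ ⟨w, hw, e⟩
    exact h.avoid z (hsub hz) w hw (by rw [e, mul_inv_cancel₀ (hne z hz)])
  · rw [disjoint_left]
    rintro _ ⟨t, rfl⟩ ⟨w, hw, e⟩
    exact hs.avoid_left w hw t e
  · intro ε hε
    have hO : IsOpen ({0}ᶜ ∩ (fun p : ℂ => p⁻¹) ⁻¹' {w | infDist w Γ < ε}) :=
      (continuousOn_inv₀ (G₀ := ℂ)).isOpen_inter_preimage isOpen_compl_singleton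
        (isOpen_lt (continuous_infDist_pt _) continuous_const)
    obtain ⟨b, hb1, hb⟩ := exists_collar_mapsTo h.diff_left h.inj_left h.bdd_left hO
      (h.closure_subset.trans (union_subset_union_right _ (by
        rintro _ ⟨t, rfl⟩
        refine ⟨h.ne_zero t, ?_⟩
        rw [mem_preimage, mem_ofPred_eq, infDist_zero_of_mem (show (γ t)⁻¹ ∈ Γ from ⟨t, rfl⟩)]
        exact hε)))
    exact ⟨b, hb1, fun z hz => (hb z hz).2⟩
  · intro b hb1
    refine exists_infDist_lt_imp hΓ hΓne ?_
    rintro _ ⟨t, rfl⟩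
    have hc : IsClosed (φ '' closedBall 0 b) :=
      ((isCompact_closedBall _ _).image_of_continuousOn
        (h.diff_left.continuousOn.mono (closedBall_subset_ball hb1))).isClosed
    have h0 := inv_ne_zero (h.ne_zero t)
    have h1 : ∀ᶠ w in 𝓝 (γ t)⁻¹, w⁻¹ ∉ φ '' closedBall 0 b := by
      refine (continuousAt_inv₀ h0).eventually (hc.isOpen_compl.mem_nhds ?_)
      rintro ⟨z, hz, e⟩
      rw [inv_inv] at e
      exact h.avoid_left z (closedBall_subset_ball hb1 hz) t e
    filter_upwards [h1, isOpen_ne.mem_nhds h0] with w hw hw0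
    rcases hs.cover w hw0 with h2 | h2 | ⟨z, hz, e⟩
    · exact Or.inr (Or.inl h2)
    · exact Or.inl h2
    · refine Or.inr (Or.inr ⟨z, ⟨?_, by simpa using hz⟩, (eq_inv_of_mul_eq_one_right e).symm⟩)
      by_contra! hle
      exact hw ⟨z, by simpa using hle, eq_inv_of_mul_eq_one_left e⟩
  · intro z hz
    rw [sub_zero, ← hφk, inv_mul_cancel₀ (hne z hz)]
  · rintro ⟨t, e⟩
    exact hs.ne_zero t e
  · rw [setLIntegral_congr_fun (isOpen_collar _).measurableSet
      (g := fun z => ENNReal.ofReal (‖preSchwarzian φ z - 2 * (deriv φ z / φ z)‖ ^ 2))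
      (fun z hz => by simp only [preSchwarzian_inv (isOpen_collar _) (h.diff_left.mono hsub) hne hφd hz])]
    refine lintegral_norm_sub_sq_lt_top (measurable_preSchwarzian φ).aemeasurable ((lintegral_mono_set hsub).trans_lt hφ) ?_
    have h1 := lintegral_logDeriv_lt_top h.diff_left h.inj_left h.zero_left h.bdd_left
    simp only [norm_mul, mul_pow]
    rw [show (fun z => ENNReal.ofReal (‖(2:ℂ)‖ ^ 2 * ‖deriv φ z / φ z‖ ^ 2)) =
      fun z => ENNReal.ofReal (‖(2:ℂ)‖ ^ 2) * ENNReal.ofReal (‖deriv φ z / φ z‖ ^ 2) from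
      funext fun z => ENNReal.ofReal_mul (by positivity), lintegral_const_mul' _ _ ENNReal.ofReal_ne_top]
    exact ENNReal.mul_lt_top ENNReal.ofReal_lt_top h1

theorem preSchwarzian_lt_top_iff (h : IsWelded φ ψ γ) :
    ∫⁻ z in ball (0:ℂ) 1, ENNReal.ofReal (‖preSchwarzian φ z‖ ^ 2) < ⊤ ↔
      ∫⁻ z in ball (0:ℂ) 1, ENNReal.ofReal (‖preSchwarzian ψ z‖ ^ 2) < ⊤ :=
  ⟨h.preSchwarzian_lt_top, h.symm.preSchwarzian_lt_top⟩

end IsWelded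
end Welding

section Exterior
open Set Filter Topology
open scoped ENNReal ComplexConjugate

variable {φ ψ G : ℂ → ℂ} {γ : ℝ → ℂ}

theorem lintegral_logDeriv_cofactor_lt_top {k : ℂ → ℂ} (hd : DifferentiableOn ℂ φ (ball 0 1)) (hi : InjOn φ (ball 0 1))
    (h0 : φ 0 = 0) (hb : Bornology.IsBounded (φ '' ball 0 1)) (hk : DifferentiableOn ℂ k (ball 0 1))
    (hk0 : ∀ z ∈ ball (0:ℂ) 1, k z ≠ 0) (hφ : ∀ z, φ z = z * k z) :
    ∫⁻ z in ball (0:ℂ) 1, ENNReal.ofReal (‖deriv k z / k z‖ ^ 2) < ⊤ := by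
  have hcov : ball (0:ℂ) 1 ⊆ collar (1 / 2) ∪ closedBall 0 (1 / 2) := fun z hz => by
    by_cases h : 1 / 2 < ‖z‖
    · exact Or.inl ⟨h, by simpa using hz⟩
    · exact Or.inr (by simpa using h)
  have hsub : closedBall (0:ℂ) (1 / 2) ⊆ ball 0 1 := closedBall_subset_ball (by norm_num)
  refine (lintegral_mono_set hcov).trans_lt ((lintegral_union_le _ _ _).trans_lt (ENNReal.add_lt_top.2 ⟨?_, ?_⟩))
  · have h1 : ∀ z ∈ collar (1 / 2), ‖deriv k z / k z‖ = ‖z⁻¹ - deriv φ z / φ z‖ := fun z hz => by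
      have hz1 : z ∈ ball (0:ℂ) 1 := by simpa using hz.2
      have hz0 : z ≠ 0 := norm_pos_iff.1 ((by norm_num : (0:ℝ) < 1 / 2).trans hz.1)
      have h2 : HasDerivAt φ _ z := ((hasDerivAt_id z).mul
        (hk.differentiableAt (isOpen_ball.mem_nhds hz1)).hasDerivAt).congr_of_eventuallyEq (Eventually.of_forall hφ)
      rw [h2.deriv, hφ, norm_sub_rev]
      have := hk0 z hz1
      simp only [id]
      congr 1
      field_simp
      ring
    rw [setLIntegral_congr_fun (isOpen_collar _).measurableSet fun z hz => by rw [h1 z hz]]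
    refine lintegral_norm_sub_sq_lt_top measurable_inv.aemeasurable ?_ (lintegral_logDeriv_lt_top hd hi h0 hb)
    · have h3 : ∫⁻ z in collar (1 / 2), ENNReal.ofReal (‖z⁻¹‖ ^ 2) ≤ ∫⁻ z in collar (1 / 2), ENNReal.ofReal (2 ^ 2) := by
        refine setLIntegral_mono' (isOpen_collar _).measurableSet fun z hz => ENNReal.ofReal_le_ofReal ?_
        rw [norm_inv]
        have : ‖z‖⁻¹ ≤ 2 := inv_le_of_inv_le₀ (by norm_num) (by linarith [hz.1])
        gcongr
      refine h3.trans_lt ?_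
      rw [setLIntegral_const]
      exact ENNReal.mul_lt_top ENNReal.ofReal_lt_top
        ((measure_mono fun z hz => show z ∈ ball (0:ℂ) 1 by simpa using hz.2).trans_lt measure_ball_lt_top)
  · have hc : ContinuousOn (fun z => deriv k z / k z) (closedBall 0 (1 / 2)) :=
      ((hk.deriv isOpen_ball).continuousOn.mono hsub).div (hk.continuousOn.mono hsub) fun z hz => hk0 z (hsub hz)
    obtain ⟨C, hC⟩ := (isCompact_closedBall (0:ℂ) (1 / 2)).exists_bound_of_continuousOn hc
    have h3 : ∫⁻ z in closedBall (0:ℂ) (1 / 2), ENNReal.ofReal (‖deriv k z / k z‖ ^ 2) ≤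
        ∫⁻ z in closedBall (0:ℂ) (1 / 2), ENNReal.ofReal (C ^ 2) := by
      refine setLIntegral_mono' measurableSet_closedBall fun z hz => ENNReal.ofReal_le_ofReal ?_
      have := hC z hz
      gcongr
    refine h3.trans_lt ?_
    rw [setLIntegral_const]
    exact ENNReal.mul_lt_top ENNReal.ofReal_lt_top measure_closedBall_lt_top

theorem preSchwarzian_comp_inv {U : Set ℂ} (hU : IsOpen U) (hG : DifferentiableOn ℂ G U)
    (h' : ∀ z ∈ U, deriv G z ≠ 0) {w : ℂ} (hw0 : w ≠ 0) (hw : w⁻¹ ∈ U) :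
    preSchwarzian (fun w => G w⁻¹) w = -(preSchwarzian G w⁻¹ / w ^ 2) - 2 / w := by
  have h1 : ∀ᶠ v in 𝓝 w, v⁻¹ ∈ U ∧ v ≠ 0 :=
    ((continuousAt_inv₀ hw0).eventually (hU.mem_nhds hw)).and (isOpen_ne.mem_nhds hw0)
  have h2 : deriv (fun w => G w⁻¹) =ᶠ[𝓝 w] fun v => deriv G v⁻¹ * -(v ^ 2)⁻¹ := h1.mono fun v hv =>
    ((hG.differentiableAt (hU.mem_nhds hv.1)).hasDerivAt.comp v (hasDerivAt_inv hv.2)).deriv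
  have h3 : HasDerivAt (fun v => deriv G v⁻¹) (deriv (deriv G) w⁻¹ * -(w ^ 2)⁻¹) w :=
    HasDerivAt.comp w (((hG.deriv hU).differentiableAt (hU.mem_nhds hw)).hasDerivAt) (hasDerivAt_inv hw0)
  have h4 := h3.mul (((hasDerivAt_pow 2 w).inv (pow_ne_zero 2 hw0)).neg)
  have h5 : deriv (deriv fun w => G w⁻¹) w = _ := h2.deriv_eq.trans h4.deriv
  have := h' _ hw
  rw [preSchwarzian, h5, h2.self_of_nhds, preSchwarzian]
  simp only [Pi.neg_apply, Pi.inv_apply]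
  generalize deriv G w⁻¹ = a at *
  generalize deriv (deriv G) w⁻¹ = b
  field_simp
  push_cast
  ring

theorem one_lt_norm_inv {w : ℂ} (hw : w ∈ ball (0:ℂ) 1) (hw0 : w ≠ 0) : 1 < ‖w⁻¹‖ := by
  rw [norm_inv]
  exact (one_lt_inv₀ (norm_pos_iff.2 hw0)).2 (mem_ball_zero_iff.1 hw)

theorem image_inv_punctured_ball : (fun w : ℂ => w⁻¹) '' (ball 0 1 \ {0}) = {z : ℂ | 1 < ‖z‖} := by
  ext z
  rw [mem_ofPred_eq]
  constructor
  · rintro ⟨w, ⟨hw, hw0⟩, rfl⟩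
    exact one_lt_norm_inv hw hw0
  · intro hz
    have hz0 : z ≠ 0 := norm_pos_iff.1 (one_pos.trans hz)
    exact ⟨z⁻¹, ⟨by rw [mem_ball_zero_iff, norm_inv]; exact inv_lt_one_of_one_lt₀ hz, inv_ne_zero hz0⟩, inv_inv z⟩

theorem lintegral_exterior_preSchwarzian (hd : DifferentiableOn ℂ ψ (ball 0 1)) (hi : InjOn ψ (ball 0 1))
    {k : ℂ → ℂ} (hk : DifferentiableOn ℂ k (ball 0 1))
    (hk0 : ∀ z ∈ ball (0:ℂ) 1, k z ≠ 0) (hψ : ∀ z, ψ z = z * k z)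
    (hG : DifferentiableOn ℂ G {z : ℂ | 1 < ‖z‖}) (hGi : InjOn G {z : ℂ | 1 < ‖z‖})
    (hGψ : ∀ w ≠ 0, (ψ w)⁻¹ = G w⁻¹) :
    ∫⁻ z in {z : ℂ | 1 < ‖z‖}, ENNReal.ofReal (‖preSchwarzian G z‖ ^ 2) =
      ∫⁻ w in ball (0:ℂ) 1, ENNReal.ofReal (‖preSchwarzian ψ w - 2 * (deriv k w / k w)‖ ^ 2) := by
  have hU : IsOpen (ball (0:ℂ) 1 \ {0}) := isOpen_ball.sdiff isClosed_singleton
  have hΔ : IsOpen {z : ℂ | 1 < ‖z‖} := isOpen_lt continuous_const continuous_norm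
  rw [← image_inv_punctured_ball, lintegral_image_holomorphic hU
    (fun w hw => (hasDerivAt_inv hw.2).differentiableAt.differentiableWithinAt) inv_injective.injOn,
    ← setLIntegral_congr (show (ball (0:ℂ) 1 \ {0} : Set ℂ) =ᵐ[volume] ball 0 1 from
      sdiff_null_ae_eq_self (measure_singleton (0:ℂ)))]
  refine setLIntegral_congr_fun hU.measurableSet fun w hw => ?_
  have hw0 : w ≠ 0 := hw.2
  have hwΔ : w⁻¹ ∈ {z : ℂ | 1 < ‖z‖} := image_inv_punctured_ball ▸ mem_image_of_mem _ hw
  have hkw := hk0 w hw.1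
  have h1 := preSchwarzian_comp_inv hΔ hG (fun z hz => deriv_ne_zero_of_injOn hΔ hG hGi hz) hw0 hwΔ
  have h2 : (fun w => G w⁻¹) =ᶠ[𝓝 w] fun w => (ψ w)⁻¹ :=
    (eventually_ne_nhds hw0).mono fun v hv => (hGψ v hv).symm
  have h3 : preSchwarzian (fun w => G w⁻¹) w = preSchwarzian (fun w => (ψ w)⁻¹) w := by
    rw [preSchwarzian, h2.deriv.deriv_eq, h2.deriv_eq, preSchwarzian]
  have h4 : ∀ z ∈ ball (0:ℂ) 1 \ {0}, ψ z ≠ 0 := fun z hz => by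
    rw [hψ]; exact mul_ne_zero hz.2 (hk0 z hz.1)
  rw [preSchwarzian_inv hU (hd.mono sdiff_subset) h4
    (fun z hz => deriv_ne_zero_of_injOn isOpen_ball hd hi hz.1) hw] at h3
  have h5 : HasDerivAt ψ _ w := ((hasDerivAt_id w).mul
    (hk.differentiableAt (isOpen_ball.mem_nhds hw.1)).hasDerivAt).congr_of_eventuallyEq (Eventually.of_forall hψ)
  rw [h1, h5.deriv, hψ w, id] at h3
  have h6 : preSchwarzian G w⁻¹ = -w ^ 2 * (preSchwarzian ψ w - 2 * (deriv k w / k w)) := by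
    have h7 : preSchwarzian G w⁻¹ = -w ^ 2 * ((-(preSchwarzian G w⁻¹ / w ^ 2) - 2 / w) + 2 / w) := by
      field_simp
      ring
    rw [h7, h3]
    field_simp
    ring
  rw [h6, ← ENNReal.ofReal_mul (by positivity), (hasDerivAt_inv hw0).deriv]
  congr 1
  rw [norm_mul, mul_pow, ← mul_assoc, ← mul_pow, ← norm_mul]
  have : -(w ^ 2)⁻¹ * -w ^ 2 = 1 := by field_simp
  rw [this]
  simp

theorem exterior_preSchwarzian_lt_top_iff (hd : DifferentiableOn ℂ ψ (ball 0 1)) (hi : InjOn ψ (ball 0 1))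
    (h0 : ψ 0 = 0) (hb : Bornology.IsBounded (ψ '' ball 0 1))
    (hG : DifferentiableOn ℂ G {z : ℂ | 1 < ‖z‖}) (hGi : InjOn G {z : ℂ | 1 < ‖z‖})
    (hGψ : ∀ w ≠ 0, (ψ w)⁻¹ = G w⁻¹) :
    ∫⁻ z in {z : ℂ | 1 < ‖z‖}, ENNReal.ofReal (‖preSchwarzian G z‖ ^ 2) < ⊤ ↔
      ∫⁻ w in ball (0:ℂ) 1, ENNReal.ofReal (‖preSchwarzian ψ w‖ ^ 2) < ⊤ := by
  obtain ⟨k, hk, hk0, hψ⟩ := exists_eq_mul_of_injOn hd hi h0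
  rw [lintegral_exterior_preSchwarzian hd hi hk hk0 hψ hG hGi hGψ]
  have h1 : ∫⁻ z in ball (0:ℂ) 1, ENNReal.ofReal (‖2 * (deriv k z / k z)‖ ^ 2) < ⊤ := by
    have h2 : ∀ z : ℂ, ENNReal.ofReal (‖2 * (deriv k z / k z)‖ ^ 2) = ENNReal.ofReal (2 ^ 2) * ENNReal.ofReal (‖deriv k z / k z‖ ^ 2) := fun z => by
      rw [← ENNReal.ofReal_mul (by norm_num), norm_mul, mul_pow]
      norm_num
    simp_rw [h2]
    rw [lintegral_const_mul' _ _ ENNReal.ofReal_ne_top]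
    exact ENNReal.mul_lt_top ENNReal.ofReal_lt_top (lintegral_logDeriv_cofactor_lt_top hd hi h0 hb hk hk0 hψ)
  refine ⟨fun h => ?_, fun h => lintegral_norm_sub_sq_lt_top (measurable_preSchwarzian ψ).aemeasurable h h1⟩
  have hm : AEMeasurable (fun z => 2 * (deriv k z / k z)) (volume.restrict (ball 0 1)) :=
    ((((hk.deriv isOpen_ball).continuousOn.div hk.continuousOn hk0).const_mul 2).aestronglyMeasurable
      measurableSet_ball).aemeasurable
  simp_rw [norm_sub_rev (preSchwarzian ψ _)] at h
  simpa using lintegral_norm_sub_sq_lt_top hm h1 h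

end Exterior

section Assembly
open Set Filter Topology
open scoped ENNReal ComplexConjugate

/-- The exterior map `G`, transplanted to the disc by inverting source and target. -/
noncomputable def invertedMap (G : ℂ → ℂ) (w : ℂ) : ℂ := if w = 0 then 0 else (G w⁻¹)⁻¹

theorem invertedMap_zero (G : ℂ → ℂ) : invertedMap G 0 = 0 := if_pos rfl

theorem invertedMap_of_ne {G : ℂ → ℂ} {w : ℂ} (hw : w ≠ 0) : invertedMap G w = (G w⁻¹)⁻¹ := if_neg hw

theorem differentiableOn_invertedMap {G : ℂ → ℂ} (hG : DifferentiableOn ℂ G {z : ℂ | 1 < ‖z‖})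
    (h0 : ∀ z, 1 < ‖z‖ → G z ≠ 0)
    (hGinf : Tendsto G (Bornology.cobounded ℂ) (Bornology.cobounded ℂ)) :
    DifferentiableOn ℂ (invertedMap G) (ball 0 1) := by
  have hΔ : IsOpen {z : ℂ | 1 < ‖z‖} := isOpen_lt continuous_const continuous_norm
  refine (Complex.differentiableOn_compl_singleton_and_continuousAt_iff
    (ball_mem_nhds (0:ℂ) one_pos)).1 ⟨fun w hw => ?_, ?_⟩
  · have h1 := one_lt_norm_inv hw.1 hw.2
    have h2 : DifferentiableAt ℂ (fun w : ℂ => (G w⁻¹)⁻¹) w :=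
      ((hG.differentiableAt (hΔ.mem_nhds h1)).comp w (differentiableAt_inv hw.2)).inv (h0 _ h1)
    exact (h2.congr_of_eventuallyEq
      ((eventually_ne_nhds hw.2).mono fun v hv => invertedMap_of_ne hv)).differentiableWithinAt
  · rw [continuousAt_iff_punctured_nhds, invertedMap_zero]
    have h1 : Tendsto (fun w : ℂ => (G w⁻¹)⁻¹) (𝓝[≠] 0) (𝓝 0) :=
      tendsto_inv₀_cobounded.comp (hGinf.comp tendsto_inv₀_nhdsNE_zero)
    exact h1.congr' (eventually_mem_nhdsWithin.mono fun v hv => (invertedMap_of_ne hv).symm)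

theorem injOn_invertedMap {G : ℂ → ℂ} (hi : InjOn G {z : ℂ | 1 < ‖z‖}) (h0 : ∀ z, 1 < ‖z‖ → G z ≠ 0) :
    InjOn (invertedMap G) (ball 0 1) := by
  intro z hz w hw e
  by_cases hz0 : z = 0 <;> by_cases hw0 : w = 0
  · rw [hz0, hw0]
  · rw [hz0, invertedMap_zero, invertedMap_of_ne hw0] at e
    exact absurd e.symm (inv_ne_zero (h0 _ (one_lt_norm_inv hw hw0)))
  · rw [hw0, invertedMap_zero, invertedMap_of_ne hz0] at e
    exact absurd e (inv_ne_zero (h0 _ (one_lt_norm_inv hz hz0)))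
  · rw [invertedMap_of_ne hz0, invertedMap_of_ne hw0] at e
    exact inv_injective (hi (one_lt_norm_inv hz hz0) (one_lt_norm_inv hw hw0) (inv_injective e))

theorem invertedMap_mul_ne_one {G : ℂ → ℂ} {w p : ℂ} (hp : ∀ z, 1 < ‖z‖ → G z ≠ p) (h0 : ∀ z, 1 < ‖z‖ → G z ≠ 0)
    (hw : w ∈ ball (0:ℂ) 1) : invertedMap G w * p ≠ 1 := by
  by_cases hw0 : w = 0
  · rw [hw0, invertedMap_zero, zero_mul]
    exact zero_ne_one
  · have h1 := one_lt_norm_inv hw hw0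
    rw [invertedMap_of_ne hw0, Ne, inv_mul_eq_one₀ (h0 _ h1)]
    exact hp _ h1

/-- The two Riemann maps of a Jordan curve, normalised so that the interior one fixes `0`. -/
theorem isWelded_of_bijOn {γ : ℝ → ℂ} (hγc : Continuous γ) (hγp : ∀ θ, γ (θ + 2 * π) = γ θ)
    (hγi : InjOn γ (Ico 0 (2 * π))) {Ω Ω' : Set ℂ} (hΩo : IsOpen Ω) (hdisj : Disjoint Ω Ω')
    (hunion : Ω ∪ Ω' = (range γ)ᶜ) (hΩb : Bornology.IsBounded Ω) {F G : ℂ → ℂ}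
    (hF : DifferentiableOn ℂ F (ball 0 1)) (hFbij : BijOn F (ball 0 1) Ω)
    (hG : DifferentiableOn ℂ G {z : ℂ | 1 < ‖z‖}) (hGbij : BijOn G {z : ℂ | 1 < ‖z‖} Ω')
    (hGinf : Tendsto G (Bornology.cobounded ℂ) (Bornology.cobounded ℂ)) :
    IsWelded (fun z => F z - F 0) (invertedMap fun z => G z - F 0) (fun t => γ t - F 0) := by
  have hF0 : F 0 ∈ Ω := hFbij.mapsTo (mem_ball_self one_pos)
  have hFγ : ∀ z ∈ ball (0:ℂ) 1, ∀ t, F z ≠ γ t := fun z hz t e =>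
    (hunion.subset (Or.inl (hFbij.mapsTo hz))) ⟨t, e.symm⟩
  have hGγ : ∀ z, 1 < ‖z‖ → ∀ t, G z ≠ γ t := fun z hz t e =>
    (hunion.subset (Or.inr (hGbij.mapsTo hz))) ⟨t, e.symm⟩
  have hGF : ∀ z, 1 < ‖z‖ → ∀ w ∈ ball (0:ℂ) 1, G z ≠ F w := fun z hz w hw e =>
    disjoint_left.1 hdisj (hFbij.mapsTo hw) (e ▸ hGbij.mapsTo hz)
  have h0 : ∀ z : ℂ, 1 < ‖z‖ → G z - F 0 ≠ 0 := fun z hz =>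
    sub_ne_zero.2 (hGF z hz 0 (mem_ball_self one_pos))
  have hinf : Tendsto (fun z => G z - F 0) (Bornology.cobounded ℂ) (Bornology.cobounded ℂ) :=
    tendsto_norm_atTop_iff_cobounded.1 (tendsto_atTop_mono (fun z => norm_sub_norm_le (G z) (F 0))
      (tendsto_atTop_add_const_right _ (-‖F 0‖) (tendsto_norm_atTop_iff_cobounded.2 hGinf)))
  refine ⟨hγc.sub continuous_const, fun θ => by rw [hγp], fun s hs t ht e => hγi hs ht (sub_left_injective e),
    fun t => sub_ne_zero.2 (hFγ 0 (mem_ball_self one_pos) t).symm, hF.sub_const _,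
    fun z hz w hw e => hFbij.injOn hz hw (sub_left_injective e), sub_self _, ?_,
    differentiableOn_invertedMap (hG.sub_const _) h0 hinf,
    injOn_invertedMap (fun z hz w hw e => hGbij.injOn hz hw (sub_left_injective e)) h0, invertedMap_zero _, ?_,
    fun z hz t e => hFγ z hz t (sub_left_injective e),
    fun w hw t => invertedMap_mul_ne_one (fun z hz e => hGγ z hz t (sub_left_injective e)) h0 hw,
    fun z hz w hw => ?_, fun p hp => ?_⟩
  · refine (hΩb.sub (Bornology.isBounded_singleton (x := F 0))).subset ?_
    rintro _ ⟨z, hz, rfl⟩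
    exact ⟨F z, hFbij.mapsTo hz, F 0, rfl, rfl⟩
  · obtain ⟨r, hr, hr'⟩ := Metric.isOpen_iff.1 hΩo _ hF0
    refine isBounded_iff_forall_norm_le.2 ⟨r⁻¹, ?_⟩
    rintro _ ⟨w, hw, rfl⟩
    by_cases hw0 : w = 0
    · rw [hw0, invertedMap_zero, norm_zero]
      positivity
    · rw [invertedMap_of_ne hw0, norm_inv]
      refine inv_anti₀ hr ?_
      by_contra! hlt
      exact disjoint_left.1 hdisj (hr' (mem_ball_iff_norm.2 hlt)) (hGbij.mapsTo (one_lt_norm_inv hw hw0))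
  · rw [mul_comm]
    exact invertedMap_mul_ne_one (fun v hv e => hGF v hv z hz (sub_left_injective e)) h0 hw
  · by_cases hpγ : p + F 0 ∈ range γ
    · obtain ⟨t, ht⟩ := hpγ
      exact Or.inr (Or.inl ⟨t, by rw [ht, add_sub_cancel_right]⟩)
    · rcases hunion.superset hpγ with h1 | h1
      · obtain ⟨z, hz, e⟩ := hFbij.surjOn h1
        exact Or.inl ⟨z, hz, by rw [e, add_sub_cancel_right]⟩
      · obtain ⟨z, hz, e⟩ := hGbij.surjOn h1
        obtain ⟨w, ⟨hw, hw0⟩, rfl⟩ := image_inv_punctured_ball.superset hz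
        exact Or.inr (Or.inr ⟨w, hw, by rw [invertedMap_of_ne hw0, e, add_sub_cancel_right, inv_mul_cancel₀ hp]⟩)

theorem preSchwarzian_sub_const (f : ℂ → ℂ) (c : ℂ) : preSchwarzian (fun z => f z - c) = preSchwarzian f := by
  have h : deriv (fun z => f z - c) = deriv f := funext fun z => deriv_sub_const c
  funext z
  rw [preSchwarzian, h, preSchwarzian]

end Assembly

end WeilPetersson

theorem wp_quasicircle_interior_iff_exterior
    -- the Jordan curve `Γ = range γ`, parametrized `2π`-periodically and injectively
    (γ : ℝ → ℂ) (hγc : Continuous γ) (hγp : ∀ θ, γ (θ + 2 * π) = γ θ)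
    (hγi : Set.InjOn γ (Set.Ico 0 (2 * π)))
    -- `Γ` is a quasicircle: Ahlfors' bounded turning condition
    (hqc : ∃ C : ℝ, 0 < C ∧ ∀ s t : ℝ, s ≤ t → t ≤ s + 2 * π →
      min (Metric.diam (γ '' Set.Icc s t)) (Metric.diam (γ '' Set.Icc t (s + 2 * π)))
        ≤ C * ‖γ s - γ t‖)
    -- interior `Ω` and exterior `Ωstar`
    (Ω Ωstar : Set ℂ)
    (hΩo : IsOpen Ω) (hΩconn : IsConnected Ω) (hΩso : IsOpen Ωstar)
    (hΩsconn : IsConnected Ωstar) (hdisj : Disjoint Ω Ωstar)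
    (hunion : Ω ∪ Ωstar = (Set.range γ)ᶜ)
    (hΩbdd : Bornology.IsBounded Ω) (hΩsunbdd : ¬ Bornology.IsBounded Ωstar)
    -- the interior Riemann map `F : 𝔻 → Ω`
    (F : ℂ → ℂ) (hF : DifferentiableOn ℂ F (ball (0 : ℂ) 1))
    (hFbij : Set.BijOn F (ball (0 : ℂ) 1) Ω)
    -- the exterior Riemann map `G : Δ → Ω*` with `G(z) → ∞` as `z → ∞`
    (G : ℂ → ℂ) (hG : DifferentiableOn ℂ G {z : ℂ | 1 < ‖z‖})
    (hGbij : Set.BijOn G {z : ℂ | 1 < ‖z‖} Ωstar)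
    (hGinf : Filter.Tendsto G (Bornology.cobounded ℂ) (Bornology.cobounded ℂ)) :
    (∫⁻ z in ball (0 : ℂ) 1,
        ENNReal.ofReal (‖deriv (deriv F) z / deriv F z‖ ^ 2)) < ⊤ ↔
    (∫⁻ z in {z : ℂ | 1 < ‖z‖},
        ENNReal.ofReal (‖deriv (deriv G) z / deriv G z‖ ^ 2)) < ⊤ := by
  have hw := WeilPetersson.isWelded_of_bijOn hγc hγp hγi hΩo hdisj hunion hΩbdd hF hFbij hG hGbij hGinf
  have h1 := hw.preSchwarzian_lt_top_iff
  rw [WeilPetersson.preSchwarzian_sub_const] at h1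
  refine h1.trans ?_
  rw [← WeilPetersson.exterior_preSchwarzian_lt_top_iff hw.diff_right hw.inj_right hw.zero_right hw.bdd_right
    (hG.sub_const (F 0)) (fun z hz w hw e => hGbij.injOn hz hw (sub_left_injective e))
    (fun w hw0 => by rw [WeilPetersson.invertedMap_of_ne hw0, inv_inv]), WeilPetersson.preSchwarzian_sub_const]
  rfl
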